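/- arXiv:2401.05539 — 9 statements merged into one kernel-verified Lean document; each statement's English description precedes it below -/
import Mathlib

section
/- Suppose μ₀(i,j) ≥ 0 for all (i,j), and suppose (ρ̃, m̃ˣ, m̃ʸ) ∈ C(μ₀) satisfies ρ̃(i,j,t) > 0 for all (i,j,t). If there are two obstacle functions b̃, b′ : {1,…,n_x}×{1,…,n_y} → ℝ such that (ρ̃, m̃ˣ, m̃ʸ) minimizes 𝓛(·,·;b̃) over all (ρ, mˣ, mʸ) ∈ C(μ₀) with ρ componentwise positive, and (ρ̃, m̃ˣ, m̃ʸ) also minimizes 𝓛(·,·;b′) over the same set, then there exists a constant c ∈ ℝ with b′(i,j) = b̃(i,j) + c for all (i,j). (Unique identifiability of the obstacle in the discretized inverse crowd-motion problem.) -/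
open Finset

namespace MFG0

/-- Time interpolation of a density onto the central grid (0-based indices: the Lean
index `t : Fin nt` corresponds to the 1-based index `t+1`). -/
noncomputable def rhoBar (nx ny nt : ℕ) (μ0 : Fin nx → Fin ny → ℝ)
    (ρ : Fin nx → Fin ny → Fin nt → ℝ) (i : Fin nx) (j : Fin ny) (t : Fin nt) : ℝ :=
  ((if h : 0 < t.val then
      ρ i j ⟨t.val - 1, lt_of_le_of_lt (Nat.sub_le _ _) t.isLt⟩
    else μ0 i j) + ρ i j t) / 2

/-- Spatial interpolation of the x-flux onto the central grid (with the zero-flux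
boundary convention `mˣ(0) = mˣ(n_x) = 0`). -/
noncomputable def mBarX (nx ny nt : ℕ) (mx : Fin (nx - 1) → Fin ny → Fin nt → ℝ)
    (i : Fin nx) (j : Fin ny) (t : Fin nt) : ℝ :=
  ((if h : 0 < i.val then mx ⟨i.val - 1, by have := i.isLt; omega⟩ j t else 0) +
   (if h : i.val < nx - 1 then mx ⟨i.val, h⟩ j t else 0)) / 2

/-- Spatial interpolation of the y-flux onto the central grid. -/
noncomputable def mBarY (nx ny nt : ℕ) (my : Fin nx → Fin (ny - 1) → Fin nt → ℝ)
    (i : Fin nx) (j : Fin ny) (t : Fin nt) : ℝ :=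
  ((if h : 0 < j.val then my i ⟨j.val - 1, by have := j.isLt; omega⟩ t else 0) +
   (if h : j.val < ny - 1 then my i ⟨j.val, h⟩ t else 0)) / 2

/-- Discrete time derivative `D_t(ρ;μ₀)` with `Δt = 1/n_t`. -/
noncomputable def DtOp (nx ny nt : ℕ) (μ0 : Fin nx → Fin ny → ℝ)
    (ρ : Fin nx → Fin ny → Fin nt → ℝ) (i : Fin nx) (j : Fin ny) (t : Fin nt) : ℝ :=
  (ρ i j t - (if h : 0 < t.val then
      ρ i j ⟨t.val - 1, lt_of_le_of_lt (Nat.sub_le _ _) t.isLt⟩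
    else μ0 i j)) / ((1 : ℝ) / nt)

/-- Discrete x-derivative `D_x mˣ` with `Δx = 1/n_x` (zero-flux boundary). -/
noncomputable def DxOp (nx ny nt : ℕ) (mx : Fin (nx - 1) → Fin ny → Fin nt → ℝ)
    (i : Fin nx) (j : Fin ny) (t : Fin nt) : ℝ :=
  ((if h : i.val < nx - 1 then mx ⟨i.val, h⟩ j t else 0) -
   (if h : 0 < i.val then mx ⟨i.val - 1, by have := i.isLt; omega⟩ j t else 0)) /
    ((1 : ℝ) / nx)

/-- Discrete y-derivative `D_y mʸ` with `Δy = 1/n_y` (zero-flux boundary). -/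
noncomputable def DyOp (nx ny nt : ℕ) (my : Fin nx → Fin (ny - 1) → Fin nt → ℝ)
    (i : Fin nx) (j : Fin ny) (t : Fin nt) : ℝ :=
  ((if h : j.val < ny - 1 then my i ⟨j.val, h⟩ t else 0) -
   (if h : 0 < j.val then my i ⟨j.val - 1, by have := j.isLt; omega⟩ t else 0)) /
    ((1 : ℝ) / ny)

/-- The discrete constraint set `C(μ₀)`: mass conservation
`D_tρ + D_xmˣ + D_ymʸ = 0` at every grid point. -/
def inC (nx ny nt : ℕ) (μ0 : Fin nx → Fin ny → ℝ)
    (ρ : Fin nx → Fin ny → Fin nt → ℝ) (mx : Fin (nx - 1) → Fin ny → Fin nt → ℝ)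
    (my : Fin nx → Fin (ny - 1) → Fin nt → ℝ) : Prop :=
  ∀ (i : Fin nx) (j : Fin ny) (t : Fin nt),
    DtOp nx ny nt μ0 ρ i j t + DxOp nx ny nt mx i j t + DyOp nx ny nt my i j t = 0

/-- The discrete crowd-motion objective `𝓛(ρ,m;b)` with `Δx = 1/n_x`, `Δy = 1/n_y`,
`Δt = 1/n_t`. -/
noncomputable def obj (nx ny nt : ℕ) (hnt : 0 < nt) (γI γT : ℝ)
    (μ0 μ1 b : Fin nx → Fin ny → ℝ)
    (ρ : Fin nx → Fin ny → Fin nt → ℝ) (mx : Fin (nx - 1) → Fin ny → Fin nt → ℝ)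
    (my : Fin nx → Fin (ny - 1) → Fin nt → ℝ) : ℝ :=
  ((1 : ℝ) / nx) * ((1 : ℝ) / ny) * ((1 : ℝ) / nt) *
      (∑ i : Fin nx, ∑ j : Fin ny, ∑ t : Fin nt,
        (((mBarX nx ny nt mx i j t) ^ 2 + (mBarY nx ny nt my i j t) ^ 2) /
            (2 * rhoBar nx ny nt μ0 ρ i j t)
          + γI * rhoBar nx ny nt μ0 ρ i j t * Real.log (rhoBar nx ny nt μ0 ρ i j t)))
    + ((1 : ℝ) / nx) * ((1 : ℝ) / ny) * ((1 : ℝ) / nt) *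
        (∑ i : Fin nx, ∑ j : Fin ny, ∑ t : Fin nt, ρ i j t * b i j)
    + γT * ((1 : ℝ) / nx) * ((1 : ℝ) / ny) *
        (∑ i : Fin nx, ∑ j : Fin ny,
          ρ i j ⟨nt - 1, Nat.sub_lt hnt one_pos⟩ *
            (Real.log (ρ i j ⟨nt - 1, Nat.sub_lt hnt one_pos⟩) - Real.log (μ1 i j)))

section Linearity

variable {nx ny nt : ℕ}

lemma rhoBar_add_smul (μ0 : Fin nx → Fin ny → ℝ) (ρ σ : Fin nx → Fin ny → Fin nt → ℝ) (s : ℝ)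
    (i : Fin nx) (j : Fin ny) (t : Fin nt) :
    rhoBar nx ny nt μ0 (fun i j t => ρ i j t + s * σ i j t) i j t =
      rhoBar nx ny nt μ0 ρ i j t + s * rhoBar nx ny nt (fun _ _ => 0) σ i j t := by
  unfold rhoBar; split_ifs <;> ring

lemma mBarX_add_smul (m w : Fin (nx - 1) → Fin ny → Fin nt → ℝ) (s : ℝ)
    (i : Fin nx) (j : Fin ny) (t : Fin nt) :
    mBarX nx ny nt (fun i j t => m i j t + s * w i j t) i j t =
      mBarX nx ny nt m i j t + s * mBarX nx ny nt w i j t := by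
  unfold mBarX; split_ifs <;> ring

lemma mBarY_add_smul (m w : Fin nx → Fin (ny - 1) → Fin nt → ℝ) (s : ℝ)
    (i : Fin nx) (j : Fin ny) (t : Fin nt) :
    mBarY nx ny nt (fun i j t => m i j t + s * w i j t) i j t =
      mBarY nx ny nt m i j t + s * mBarY nx ny nt w i j t := by
  unfold mBarY; split_ifs <;> ring

lemma DtOp_add_smul (μ0 : Fin nx → Fin ny → ℝ) (ρ σ : Fin nx → Fin ny → Fin nt → ℝ) (s : ℝ)
    (i : Fin nx) (j : Fin ny) (t : Fin nt) :
    DtOp nx ny nt μ0 (fun i j t => ρ i j t + s * σ i j t) i j t =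
      DtOp nx ny nt μ0 ρ i j t + s * DtOp nx ny nt (fun _ _ => 0) σ i j t := by
  unfold DtOp; split_ifs <;> ring

lemma DxOp_add_smul (m w : Fin (nx - 1) → Fin ny → Fin nt → ℝ) (s : ℝ)
    (i : Fin nx) (j : Fin ny) (t : Fin nt) :
    DxOp nx ny nt (fun i j t => m i j t + s * w i j t) i j t =
      DxOp nx ny nt m i j t + s * DxOp nx ny nt w i j t := by
  unfold DxOp; split_ifs <;> ring

lemma DyOp_add_smul (m w : Fin nx → Fin (ny - 1) → Fin nt → ℝ) (s : ℝ)
    (i : Fin nx) (j : Fin ny) (t : Fin nt) :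
    DyOp nx ny nt (fun i j t => m i j t + s * w i j t) i j t =
      DyOp nx ny nt m i j t + s * DyOp nx ny nt w i j t := by
  unfold DyOp; split_ifs <;> ring

lemma inC_add_smul {μ0 : Fin nx → Fin ny → ℝ} {ρ σ : Fin nx → Fin ny → Fin nt → ℝ}
    {mx wx : Fin (nx - 1) → Fin ny → Fin nt → ℝ} {my wy : Fin nx → Fin (ny - 1) → Fin nt → ℝ}
    (h : inC nx ny nt μ0 ρ mx my) (h0 : inC nx ny nt (fun _ _ => 0) σ wx wy) (s : ℝ) :
    inC nx ny nt μ0 (fun i j t => ρ i j t + s * σ i j t) (fun i j t => mx i j t + s * wx i j t)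
      (fun i j t => my i j t + s * wy i j t) := by
  intro i j t
  rw [DtOp_add_smul, DxOp_add_smul, DyOp_add_smul]
  linear_combination h i j t + s * h0 i j t

lemma rhoBar_pos {μ0 : Fin nx → Fin ny → ℝ} {ρ : Fin nx → Fin ny → Fin nt → ℝ}
    (hμ0 : ∀ i j, 0 ≤ μ0 i j) (hρ : ∀ i j t, 0 < ρ i j t)
    (i : Fin nx) (j : Fin ny) (t : Fin nt) : 0 < rhoBar nx ny nt μ0 ρ i j t := by
  unfold rhoBar
  split_ifs with h
  · linarith [hρ i j t, hρ i j ⟨t.val - 1, lt_of_le_of_lt (Nat.sub_le _ _) t.isLt⟩]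
  · linarith [hρ i j t, hμ0 i j]

end Linearity

/-- The objective is differentiable along lines through a positive density. -/
lemma differentiableAt_obj_line {nx ny nt : ℕ} (hnt : 0 < nt) (γI γT : ℝ)
    (μ0 μ1 b : Fin nx → Fin ny → ℝ) (hμ0 : ∀ i j, 0 ≤ μ0 i j)
    {ρ : Fin nx → Fin ny → Fin nt → ℝ} (hρ : ∀ i j t, 0 < ρ i j t)
    (σ : Fin nx → Fin ny → Fin nt → ℝ)
    (mx wx : Fin (nx - 1) → Fin ny → Fin nt → ℝ) (my wy : Fin nx → Fin (ny - 1) → Fin nt → ℝ) :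
    DifferentiableAt ℝ (fun s : ℝ => obj nx ny nt hnt γI γT μ0 μ1 b
      (fun i j t => ρ i j t + s * σ i j t) (fun i j t => mx i j t + s * wx i j t)
      (fun i j t => my i j t + s * wy i j t)) 0 := by
  unfold obj
  simp only [rhoBar_add_smul, mBarX_add_smul, mBarY_add_smul]
  have hline (a c : ℝ) : DifferentiableAt ℝ (fun s : ℝ => a + s * c) 0 := by fun_prop
  have hlog {a : ℝ} (c : ℝ) (ha : 0 < a) :
      DifferentiableAt ℝ (fun s : ℝ => Real.log (a + s * c)) 0 :=
    (hline a c).log (by simpa using ha.ne')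
  refine DifferentiableAt.add (DifferentiableAt.add ?_ (by fun_prop)) ?_
  · refine DifferentiableAt.const_mul (DifferentiableAt.fun_sum fun i _ =>
      DifferentiableAt.fun_sum fun j _ => DifferentiableAt.fun_sum fun t _ => ?_) _
    have hpos := rhoBar_pos hμ0 hρ i j t
    refine DifferentiableAt.add (DifferentiableAt.fun_div (by fun_prop) (by fun_prop) ?_)
      (DifferentiableAt.mul (by fun_prop) (hlog _ hpos))
    simpa using hpos.ne'
  · refine DifferentiableAt.const_mul (DifferentiableAt.fun_sum fun i _ =>
      DifferentiableAt.fun_sum fun j _ => ?_) _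
    exact (hline _ _).mul ((hlog _ (hρ _ _ _)).sub (by fun_prop))

/-- The first-order condition: along an admissible direction, the derivative of the objective
vanishes at a minimizer. -/
lemma deriv_obj_line_eq_zero {nx ny nt : ℕ} (hnt : 0 < nt) {γI γT : ℝ}
    {μ0 μ1 b : Fin nx → Fin ny → ℝ}
    {ρ σ : Fin nx → Fin ny → Fin nt → ℝ} (hρ : ∀ i j t, 0 < ρ i j t)
    {mx wx : Fin (nx - 1) → Fin ny → Fin nt → ℝ} {my wy : Fin nx → Fin (ny - 1) → Fin nt → ℝ}
    (hfeas : inC nx ny nt μ0 ρ mx my) (hdir : inC nx ny nt (fun _ _ => 0) σ wx wy)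
    (hmin : ∀ (ρ' : Fin nx → Fin ny → Fin nt → ℝ) (mx' : Fin (nx - 1) → Fin ny → Fin nt → ℝ)
        (my' : Fin nx → Fin (ny - 1) → Fin nt → ℝ),
        (∀ i j t, 0 < ρ' i j t) → inC nx ny nt μ0 ρ' mx' my' →
        obj nx ny nt hnt γI γT μ0 μ1 b ρ mx my ≤ obj nx ny nt hnt γI γT μ0 μ1 b ρ' mx' my') :
    deriv (fun s : ℝ => obj nx ny nt hnt γI γT μ0 μ1 b
      (fun i j t => ρ i j t + s * σ i j t) (fun i j t => mx i j t + s * wx i j t)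
      (fun i j t => my i j t + s * wy i j t)) 0 = 0 := by
  apply IsLocalMin.deriv_eq_zero
  have hpos : ∀ᶠ s : ℝ in nhds 0, ∀ i j t, 0 < ρ i j t + s * σ i j t := by
    simp only [Filter.eventually_all]
    intro i j t
    have hc : ContinuousAt (fun s : ℝ => ρ i j t + s * σ i j t) 0 := by fun_prop
    exact hc.eventually (lt_mem_nhds (by simpa using hρ i j t))
  filter_upwards [hpos] with s hs
  simpa using hmin _ _ _ hs (inC_add_smul hfeas hdir s)

lemma obj_sub_obj {nx ny nt : ℕ} (hnt : 0 < nt) (γI γT : ℝ) (μ0 μ1 b b' : Fin nx → Fin ny → ℝ)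
    (ρ : Fin nx → Fin ny → Fin nt → ℝ) (mx : Fin (nx - 1) → Fin ny → Fin nt → ℝ)
    (my : Fin nx → Fin (ny - 1) → Fin nt → ℝ) :
    obj nx ny nt hnt γI γT μ0 μ1 b' ρ mx my - obj nx ny nt hnt γI γT μ0 μ1 b ρ mx my =
      ((1 : ℝ) / nx) * ((1 : ℝ) / ny) * ((1 : ℝ) / nt) *
        ∑ i, ∑ j, ∑ t, ρ i j t * (b' i j - b i j) := by
  simp only [obj, mul_sub, Finset.sum_sub_distrib]
  ring

/-- If a feasible point is a minimizer for two obstacles, their difference is orthogonal to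
every admissible density variation. -/
lemma sum_mul_sub_eq_zero {nx ny nt : ℕ} (hnx : 0 < nx) (hny : 0 < ny) (hnt : 0 < nt)
    {γI γT : ℝ} {μ0 μ1 b b' : Fin nx → Fin ny → ℝ} (hμ0 : ∀ i j, 0 ≤ μ0 i j)
    {ρ σ : Fin nx → Fin ny → Fin nt → ℝ} (hρ : ∀ i j t, 0 < ρ i j t)
    {mx wx : Fin (nx - 1) → Fin ny → Fin nt → ℝ} {my wy : Fin nx → Fin (ny - 1) → Fin nt → ℝ}
    (hfeas : inC nx ny nt μ0 ρ mx my) (hdir : inC nx ny nt (fun _ _ => 0) σ wx wy)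
    (hmin : ∀ (ρ' : Fin nx → Fin ny → Fin nt → ℝ) (mx' : Fin (nx - 1) → Fin ny → Fin nt → ℝ)
        (my' : Fin nx → Fin (ny - 1) → Fin nt → ℝ),
        (∀ i j t, 0 < ρ' i j t) → inC nx ny nt μ0 ρ' mx' my' →
        obj nx ny nt hnt γI γT μ0 μ1 b ρ mx my ≤ obj nx ny nt hnt γI γT μ0 μ1 b ρ' mx' my')
    (hmin' : ∀ (ρ' : Fin nx → Fin ny → Fin nt → ℝ) (mx' : Fin (nx - 1) → Fin ny → Fin nt → ℝ)
        (my' : Fin nx → Fin (ny - 1) → Fin nt → ℝ),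
        (∀ i j t, 0 < ρ' i j t) → inC nx ny nt μ0 ρ' mx' my' →
        obj nx ny nt hnt γI γT μ0 μ1 b' ρ mx my ≤ obj nx ny nt hnt γI γT μ0 μ1 b' ρ' mx' my') :
    ∑ i, ∑ j, ∑ t, σ i j t * (b' i j - b i j) = 0 := by
  have hd := (differentiableAt_obj_line hnt γI γT μ0 μ1 b hμ0 hρ σ mx wx my wy).hasDerivAt
  have hd' := (differentiableAt_obj_line hnt γI γT μ0 μ1 b' hμ0 hρ σ mx wx my wy).hasDerivAt
  rw [deriv_obj_line_eq_zero hnt hρ hfeas hdir hmin] at hd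
  rw [deriv_obj_line_eq_zero hnt hρ hfeas hdir hmin'] at hd'
  have hsub := hd'.fun_sub hd
  simp only [obj_sub_obj, add_mul, Finset.sum_add_distrib, mul_assoc, ← Finset.mul_sum] at hsub
  simp only [← mul_assoc, mul_add] at hsub
  have hlin := (((hasDerivAt_id (0 : ℝ)).const_mul
    ((1 : ℝ) / nx * (1 / ny) * (1 / nt))).mul_const
      (∑ i, ∑ j, ∑ t, σ i j t * (b' i j - b i j))).const_add
    ((1 : ℝ) / nx * (1 / ny) * (1 / nt) * ∑ i, ∑ j, ∑ t, ρ i j t * (b' i j - b i j))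
  have hzero := hlin.unique (by simpa using hsub)
  simpa [hnx.ne', hny.ne', hnt.ne'] using hzero

/-- A flux concentrated at the last time step is admissible, with the density variation
determined by its divergence. -/
lemma inC_last {nx ny nt : ℕ} (hnt : 0 < nt) (u : Fin (nx - 1) → Fin ny → ℝ)
    (v : Fin nx → Fin (ny - 1) → ℝ) :
    inC nx ny nt (fun _ _ => 0)
      (fun i j t => if t.val = nt - 1 then
        -(DxOp nx ny nt (fun i j _ => u i j) i j t + DyOp nx ny nt (fun i j _ => v i j) i j t) / nt
        else 0)
      (fun i j t => if t.val = nt - 1 then u i j else 0)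
      (fun i j t => if t.val = nt - 1 then v i j else 0) := by
  intro i j t
  have hnt' : (nt : ℝ) ≠ 0 := by exact_mod_cast hnt.ne'
  have hprev : t.val - 1 = nt - 1 → ¬ 0 < t.val := by have := t.isLt; omega
  by_cases ht : t.val = nt - 1
  · have hif : (if 0 < t.val then
        if t.val - 1 = nt - 1 then
          -(DxOp nx ny nt (fun i j _ => u i j) i j t + DyOp nx ny nt (fun i j _ => v i j) i j t) / nt
        else 0 else 0) = (0 : ℝ) := by
      split_ifs <;> first | rfl | exact absurd ‹_› (hprev ‹_›)
    simp only [DxOp, DyOp] at hif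
    simp only [DtOp, DxOp, DyOp, ht, if_true, dite_eq_ite] at hif ⊢
    rw [hif]
    field_simp
    ring
  · have hif (x : ℝ) : (if 0 < t.val then if t.val - 1 = nt - 1 then x else 0 else 0) = 0 := by
      split_ifs <;> first | rfl | exact absurd ‹_› (hprev ‹_›)
    simp only [DtOp, DxOp, DyOp, ht, if_false, dite_eq_ite]
    rw [hif]
    simp

/-- **Unique identifiability of the obstacle (discretized inverse crowd-motion problem).**
If `μ₀ ≥ 0`, `(ρ̃,m̃ˣ,m̃ʸ) ∈ C(μ₀)` with `ρ̃ > 0` componentwise, and `(ρ̃,m̃ˣ,m̃ʸ)`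
minimizes the objective `𝓛(·,·;b)` over componentwise-positive elements of `C(μ₀)`
both for `b = b̃` and for `b = b′`, then `b′ = b̃ + c` for some constant `c`. -/
theorem stmt0 (nx ny nt : ℕ) (hnx : 0 < nx) (hny : 0 < ny) (hnt : 0 < nt)
    (γI γT : ℝ) (hγI : 0 ≤ γI) (hγT : 0 ≤ γT)
    (μ0 μ1 : Fin nx → Fin ny → ℝ)
    (hμ0 : ∀ i j, 0 ≤ μ0 i j) (hμ1 : ∀ i j, 0 < μ1 i j)
    (ρt : Fin nx → Fin ny → Fin nt → ℝ)
    (mxt : Fin (nx - 1) → Fin ny → Fin nt → ℝ)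
    (myt : Fin nx → Fin (ny - 1) → Fin nt → ℝ)
    (hρt : ∀ i j t, 0 < ρt i j t)
    (hfeas : inC nx ny nt μ0 ρt mxt myt)
    (bt b' : Fin nx → Fin ny → ℝ)
    (hmin : ∀ (ρ : Fin nx → Fin ny → Fin nt → ℝ)
        (mx : Fin (nx - 1) → Fin ny → Fin nt → ℝ)
        (my : Fin nx → Fin (ny - 1) → Fin nt → ℝ),
        (∀ i j t, 0 < ρ i j t) → inC nx ny nt μ0 ρ mx my →
        obj nx ny nt hnt γI γT μ0 μ1 bt ρt mxt myt ≤
          obj nx ny nt hnt γI γT μ0 μ1 bt ρ mx my)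
    (hmin' : ∀ (ρ : Fin nx → Fin ny → Fin nt → ℝ)
        (mx : Fin (nx - 1) → Fin ny → Fin nt → ℝ)
        (my : Fin nx → Fin (ny - 1) → Fin nt → ℝ),
        (∀ i j t, 0 < ρ i j t) → inC nx ny nt μ0 ρ mx my →
        obj nx ny nt hnt γI γT μ0 μ1 b' ρt mxt myt ≤
          obj nx ny nt hnt γI γT μ0 μ1 b' ρ mx my) :
    ∃ c : ℝ, ∀ i j, b' i j = bt i j + c := by
  have hnx' : (nx : ℝ) ≠ 0 := by exact_mod_cast hnx.ne'
  have hny' : (ny : ℝ) ≠ 0 := by exact_mod_cast hny.ne'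
  have hnt' : (nt : ℝ) ≠ 0 := by exact_mod_cast hnt.ne'
  have hdiv (u : Fin (nx - 1) → Fin ny → ℝ) (v : Fin nx → Fin (ny - 1) → ℝ) :
      ∑ i, ∑ j, (DxOp nx ny nt (fun i j _ => u i j) i j ⟨nt - 1, Nat.sub_lt hnt one_pos⟩ +
        DyOp nx ny nt (fun i j _ => v i j) i j ⟨nt - 1, Nat.sub_lt hnt one_pos⟩) *
          (b' i j - bt i j) = 0 := by
    have h := sum_mul_sub_eq_zero hnx hny hnt hμ0 hρt hfeas (inC_last hnt u v) hmin hmin'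
    have hlast (t : Fin nt) : t.val = nt - 1 ↔ t = ⟨nt - 1, Nat.sub_lt hnt one_pos⟩ := by
      rw [Fin.ext_iff]
    simp only [hlast, ite_mul, zero_mul, Finset.sum_ite_eq', Finset.mem_univ, if_true,
      div_mul_eq_mul_div, neg_mul, ← Finset.sum_div, Finset.sum_neg_distrib] at h
    simpa [hnt'] using h
  have hx (i : ℕ) (hi : i + 1 < nx) (j : Fin ny) :
      b' ⟨i + 1, hi⟩ j - bt ⟨i + 1, hi⟩ j = b' ⟨i, by omega⟩ j - bt ⟨i, by omega⟩ j := by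
    have h := hdiv (fun k l => if k.val = i then if l = j then 1 else 0 else 0) (fun _ _ => 0)
    have hD (k : Fin nx) (l : Fin ny) (t : Fin nt) :
        DxOp nx ny nt (fun k l _ => if k.val = i then if l = j then 1 else 0 else 0) k l t =
          ((if k = ⟨i, by omega⟩ then if l = j then 1 else 0 else 0) -
            (if k = ⟨i + 1, hi⟩ then if l = j then 1 else 0 else 0)) / ((1 : ℝ) / nx) := by
      simp only [DxOp, Fin.ext_iff]
      congr 2 <;> split_ifs <;> first | rfl | omega
    simp only [hD, DyOp, dite_eq_ite, ite_self, sub_self, zero_div, add_zero,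
      div_mul_eq_mul_div, ← Finset.sum_div, sub_mul, Finset.sum_sub_distrib, ite_mul, one_mul,
      zero_mul, Finset.sum_ite_irrel, Finset.sum_const_zero, Finset.sum_ite_eq',
      Finset.mem_univ, if_true] at h
    field_simp at h
    linarith [(mul_eq_zero.mp h).resolve_right hnx']
  have hy (i : Fin nx) (j : ℕ) (hj : j + 1 < ny) :
      b' i ⟨j + 1, hj⟩ - bt i ⟨j + 1, hj⟩ = b' i ⟨j, by omega⟩ - bt i ⟨j, by omega⟩ := by
    have h := hdiv (fun _ _ => 0) (fun k l => if l.val = j then if k = i then 1 else 0 else 0)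
    have hD (k : Fin nx) (l : Fin ny) (t : Fin nt) :
        DyOp nx ny nt (fun k l _ => if l.val = j then if k = i then 1 else 0 else 0) k l t =
          ((if l = ⟨j, by omega⟩ then if k = i then 1 else 0 else 0) -
            (if l = ⟨j + 1, hj⟩ then if k = i then 1 else 0 else 0)) / ((1 : ℝ) / ny) := by
      simp only [DyOp, Fin.ext_iff]
      congr 2 <;> split_ifs <;> first | rfl | omega
    simp only [hD, DxOp, dite_eq_ite, ite_self, sub_self, zero_div, zero_add,
      div_mul_eq_mul_div, ← Finset.sum_div, sub_mul, Finset.sum_sub_distrib, ite_mul, one_mul,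
      zero_mul, Finset.sum_ite_eq',
      Finset.mem_univ, if_true] at h
    field_simp at h
    linarith [(mul_eq_zero.mp h).resolve_right hny']
  have hx0 (i : ℕ) (hi : i < nx) (j : Fin ny) :
      b' ⟨i, hi⟩ j - bt ⟨i, hi⟩ j = b' ⟨0, hnx⟩ j - bt ⟨0, hnx⟩ j := by
    induction i with
    | zero => rfl
    | succ i ih => rw [hx i hi j, ih]
  have hy0 (i : Fin nx) (j : ℕ) (hj : j < ny) :
      b' i ⟨j, hj⟩ - bt i ⟨j, hj⟩ = b' i ⟨0, hny⟩ - bt i ⟨0, hny⟩ := by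
    induction j with
    | zero => rfl
    | succ j ih => rw [hy i j hj, ih]
  refine ⟨b' ⟨0, hnx⟩ ⟨0, hny⟩ - bt ⟨0, hnx⟩ ⟨0, hny⟩, fun i j => ?_⟩
  linarith [hx0 i i.isLt j, hy0 ⟨0, hnx⟩ j j.isLt]

end MFG0
end

section
/- Let n_x, n_y, n_t be positive integers and Δt > 0. Let ψ : {1,…,n_x}×{1,…,n_y}×{1,…,n_t} → ℝ and δ : {1,…,n_x}×{1,…,n_y} → ℝ satisfy: (i) (ψ(i,j,t+1) − ψ(i,j,t))/Δt + δ(i,j) = 0 for all i, j and all 1 ≤ t ≤ n_t−1; (ii) −ψ(i,j,n_t)/Δt + δ(i,j) = 0 for all i, j; (iii) ψ(i+1,j,t) = ψ(i,j,t) for all 1 ≤ i ≤ n_x−1 and all j, t; (iv) ψ(i,j+1,t) = ψ(i,j,t) for all 1 ≤ j ≤ n_y−1 and all i, t. Then there exists a constant c ∈ ℝ such that δ(i,j) = c for all (i,j), and moreover ψ(i,j,t) = (n_t − t + 1)·Δt·c for all (i,j,t). -/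
/-- A function on `Fin n` that is invariant under the successor is constant. -/
theorem fin_eq_of_forall_succ_eq {n : ℕ} {α : Type*} (f : Fin n → α)
    (hf : ∀ (i : Fin n) (h : i.val + 1 < n), f ⟨i.val + 1, h⟩ = f i) (i j : Fin n) :
    f i = f j := by
  have eq_zero : ∀ (k : ℕ) (hk : k < n), f ⟨k, hk⟩ = f ⟨0, by omega⟩ := by
    intro k
    induction k with
    | zero => intro _; rfl
    | succ k ih => intro hk; exact (hf ⟨k, by omega⟩ hk).trans (ih _)
  exact (eq_zero i i.isLt).trans (eq_zero j j.isLt).symm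

/-- A sequence on `Fin n` with constant decrement `s` and last value `s` is linear. -/
theorem fin_eq_sub_mul_of_succ_eq_sub {n : ℕ} (hn : 0 < n) (a : Fin n → ℝ) (s : ℝ)
    (hstep : ∀ (t : Fin n) (h : t.val + 1 < n), a ⟨t.val + 1, h⟩ = a t - s)
    (hlast : a ⟨n - 1, Nat.sub_lt hn one_pos⟩ = s) (t : Fin n) :
    a t = ((n : ℝ) - (t.val : ℝ)) * s := by
  have h := fin_eq_of_forall_succ_eq (fun t : Fin n => a t + (t.val : ℝ) * s)
    (fun t ht => by simp only [hstep t ht]; push_cast; ring)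
    t ⟨n - 1, Nat.sub_lt hn one_pos⟩
  simp only [hlast, Nat.cast_pred hn] at h
  linarith

/-- **Discrete rigidity lemma.**
If `ψ : {1,…,n_x}×{1,…,n_y}×{1,…,n_t} → ℝ` (indexed here by `Fin`s, 0-based) and
`δ : {1,…,n_x}×{1,…,n_y} → ℝ` satisfy
(i) `(ψ(i,j,t+1) − ψ(i,j,t))/Δt + δ(i,j) = 0` for `1 ≤ t ≤ n_t−1`,
(ii) `−ψ(i,j,n_t)/Δt + δ(i,j) = 0`,
(iii) `ψ(i+1,j,t) = ψ(i,j,t)`, and (iv) `ψ(i,j+1,t) = ψ(i,j,t)`,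
then there is a constant `c` with `δ(i,j) = c` for all `(i,j)`, and
`ψ(i,j,t) = (n_t − t + 1)·Δt·c` for all `(i,j,t)`.
(A 0-based index `t : Fin n_t` corresponds to the 1-based index `t+1`, so
`n_t − (t+1) + 1 = n_t − t.val`.) -/
theorem stmt1 (nx ny nt : ℕ) (hnx : 0 < nx) (hny : 0 < ny) (hnt : 0 < nt)
    (Δt : ℝ) (hΔt : 0 < Δt)
    (ψ : Fin nx → Fin ny → Fin nt → ℝ) (δ : Fin nx → Fin ny → ℝ)
    (h1 : ∀ (i : Fin nx) (j : Fin ny) (t : Fin nt) (h : t.val + 1 < nt),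
      (ψ i j ⟨t.val + 1, h⟩ - ψ i j t) / Δt + δ i j = 0)
    (h2 : ∀ (i : Fin nx) (j : Fin ny),
      -(ψ i j ⟨nt - 1, Nat.sub_lt hnt one_pos⟩) / Δt + δ i j = 0)
    (h3 : ∀ (i : Fin nx) (j : Fin ny) (t : Fin nt) (h : i.val + 1 < nx),
      ψ ⟨i.val + 1, h⟩ j t = ψ i j t)
    (h4 : ∀ (i : Fin nx) (j : Fin ny) (t : Fin nt) (h : j.val + 1 < ny),
      ψ i ⟨j.val + 1, h⟩ t = ψ i j t) :
    ∃ c : ℝ, (∀ (i : Fin nx) (j : Fin ny), δ i j = c) ∧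
      (∀ (i : Fin nx) (j : Fin ny) (t : Fin nt),
        ψ i j t = ((nt : ℝ) - (t.val : ℝ)) * Δt * c) := by
  have hlast : ∀ i j, ψ i j ⟨nt - 1, Nat.sub_lt hnt one_pos⟩ = Δt * δ i j := by
    intro i j
    have h := h2 i j
    field_simp at h
    linarith
  have hstep : ∀ i j (t : Fin nt) (h : t.val + 1 < nt),
      ψ i j ⟨t.val + 1, h⟩ = ψ i j t - Δt * δ i j := by
    intro i j t ht
    have h := h1 i j t ht
    field_simp at h
    linarith
  have hconst : ∀ i j, δ i j = δ ⟨0, hnx⟩ ⟨0, hny⟩ := by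
    intro i j
    apply mul_left_cancel₀ hΔt.ne'
    rw [← hlast, ← hlast]
    exact (fin_eq_of_forall_succ_eq (fun i => ψ i j _) (fun i => h3 i j _) i _).trans
      (fin_eq_of_forall_succ_eq (fun j => ψ _ j _) (fun j => h4 _ j _) j _)
  refine ⟨δ ⟨0, hnx⟩ ⟨0, hny⟩, hconst, fun i j t => ?_⟩
  rw [fin_eq_sub_mul_of_succ_eq_sub hnt (ψ i j) (Δt * δ i j) (hstep i j) (hlast i j) t,
    hconst i j, mul_assoc]
end

section
/- Let d ≥ 1, let G ∈ ℝ^{d×d} be symmetric positive definite, let γ ≥ 0, and let 0 < c̲_ρ and c̄_m > 0. Then on the convex set {(α, β) : α ≥ c̲_ρ, ‖β‖₂ ≤ c̄_m} the gradient of L_{G,γ}(α, β) := βᵀGβ/(2α) + γ·α·log α is Lipschitz continuous with Lipschitz constant max(1, λ_max(G)) · (λ_max(G)·c̄_m² + (γ+1)·c̲_ρ²)/c̲_ρ³. -/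
open Matrix Finset

/-- The largest eigenvalue of a Hermitian real matrix. -/
noncomputable def lamMax {d : ℕ} (hd : 0 < d) {G : Matrix (Fin d) (Fin d) ℝ}
    (hG : G.IsHermitian) : ℝ :=
  Finset.univ.sup' (Finset.univ_nonempty_iff.mpr ⟨⟨0, hd⟩⟩) hG.eigenvalues

/-- The largest eigenvalue bounds the action of a positive semidefinite matrix. -/
lemma norm_toEuclideanCLM_le_lamMax {d : ℕ} (hd : 0 < d) {G : Matrix (Fin d) (Fin d) ℝ}
    (hG : G.PosSemidef) (w : EuclideanSpace ℝ (Fin d)) :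
    ‖toEuclideanCLM (𝕜 := ℝ) G w‖ ≤ lamMax hd hG.1 * ‖w‖ := by
  have hle : ∀ i, hG.1.eigenvalues i ≤ lamMax hd hG.1 := fun i =>
    Finset.le_sup' hG.1.eigenvalues (Finset.mem_univ i)
  have hpos : 0 ≤ lamMax hd hG.1 := (hG.eigenvalues_nonneg ⟨0, hd⟩).trans (hle _)
  have hsymm : ∀ v w : EuclideanSpace ℝ (Fin d),
      inner ℝ (toEuclideanCLM (𝕜 := ℝ) G v) w = inner ℝ v (toEuclideanCLM (𝕜 := ℝ) G w) :=
    isSymmetric_toEuclideanLin_iff.mpr hG.1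
  have heig : ∀ i, toEuclideanCLM (𝕜 := ℝ) G (hG.1.eigenvectorBasis i)
      = hG.1.eigenvalues i • hG.1.eigenvectorBasis i := fun i => by
    apply WithLp.ofLp_injective
    simpa using hG.1.mulVec_eigenvectorBasis i
  refine le_of_sq_le_sq ?_ (by positivity)
  rw [mul_pow, ← hG.1.eigenvectorBasis.sum_sq_norm_inner_right,
    ← hG.1.eigenvectorBasis.sum_sq_norm_inner_right, Finset.mul_sum]
  refine Finset.sum_le_sum fun i _ => ?_
  rw [← hsymm, heig, inner_smul_left, norm_mul, mul_pow]
  have h0 := hG.eigenvalues_nonneg i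
  have := hle i
  simp only [conj_trivial, Real.norm_eq_abs, sq_abs]
  gcongr

/-- The gradient of the perspective function `(a, b) ↦ ⟪b, T b⟫ / (2 a)` of a symmetric quadratic
form is Lipschitz on `{a ≥ c, ‖b‖ ≤ C}`. -/
lemma perspective_gradient_dist_sq_le {E : Type*} [NormedAddCommGroup E] [InnerProductSpace ℝ E]
    (T : E →L[ℝ] E) (hT : ∀ v w, inner ℝ (T v) w = inner ℝ v (T w)) {K c C a a' : ℝ}
    (hTK : ∀ w, ‖T w‖ ≤ K * ‖w‖) (hK : 0 ≤ K) (hc : 0 < c) (ha : c ≤ a) (ha' : c ≤ a')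
    {b b' : E} (hb : ‖b‖ ≤ C) (hb' : ‖b'‖ ≤ C) :
    ((inner ℝ (a⁻¹ • b) (T (a⁻¹ • b)) - inner ℝ (a'⁻¹ • b') (T (a'⁻¹ • b'))) / 2) ^ 2
        + ‖T (a⁻¹ • b) - T (a'⁻¹ • b')‖ ^ 2
      ≤ (K * (1 + C ^ 2 / c ^ 2) / c) ^ 2 * ((a - a') ^ 2 + ‖b - b'‖ ^ 2) := by
  have hC : 0 ≤ C := (norm_nonneg b).trans hb
  have norm_le : ∀ {s : ℝ} {z : E}, c ≤ s → ‖z‖ ≤ C → ‖s⁻¹ • z‖ ≤ C / c := by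
    intro s z hs hz
    rw [norm_smul, norm_inv, Real.norm_of_nonneg (hc.le.trans hs), inv_mul_eq_div]
    gcongr
  have hu := norm_le ha hb
  have hv := norm_le ha' hb'
  have hbu : b = a • a⁻¹ • b := (smul_inv_smul₀ (hc.trans_le ha).ne' b).symm
  have hbv : b' = a' • a'⁻¹ • b' := (smul_inv_smul₀ (hc.trans_le ha').ne' b').symm
  generalize a⁻¹ • b = u at *
  generalize a'⁻¹ • b' = v at *
  set w : E := (2⁻¹ : ℝ) • (u + v) with hw
  have hwC : ‖w‖ ≤ C / c := by
    rw [hw, norm_smul]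
    have := norm_add_le u v
    norm_num
    linarith
  have hquad : (inner ℝ u (T u) - inner ℝ v (T v)) / 2 = inner ℝ w (T (u - v)) := by
    have h : inner ℝ v (T u) = inner ℝ u (T v) := by rw [← hT, real_inner_comm]
    simp only [hw, map_sub, inner_smul_left, inner_add_left, inner_sub_right, conj_trivial]
    rw [h]; ring
  have hdiff : ((a + a') / 2) • (u - v) = (b - b') - (a - a') • w := by
    rw [hbu, hbv, hw]; module
  have hTuv : ‖T (u - v)‖ ≤ K * ‖u - v‖ := hTK _
  have hin : (inner ℝ w (T (u - v))) ^ 2 ≤ (‖w‖ * ‖T (u - v)‖) ^ 2 := by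
    rw [← sq_abs]; gcongr; exact abs_real_inner_le_norm _ _
  have huv : c ^ 2 * ‖u - v‖ ^ 2 ≤ (1 + ‖w‖ ^ 2) * ((a - a') ^ 2 + ‖b - b'‖ ^ 2) := by
    have h1 : c * ‖u - v‖ ≤ ‖b - b'‖ + |a - a'| * ‖w‖ := by
      calc c * ‖u - v‖ ≤ ((a + a') / 2) * ‖u - v‖ := by gcongr; linarith
        _ = ‖((a + a') / 2) • (u - v)‖ := by
          rw [norm_smul, Real.norm_of_nonneg (by linarith)]
        _ ≤ _ := by
          rw [hdiff]
          refine (norm_sub_le _ _).trans_eq ?_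
          rw [norm_smul, Real.norm_eq_abs]
    calc c ^ 2 * ‖u - v‖ ^ 2 = (c * ‖u - v‖) ^ 2 := by ring
      _ ≤ (‖b - b'‖ + |a - a'| * ‖w‖) ^ 2 := by gcongr
      _ ≤ _ := by
        rw [← sq_abs (a - a')]
        nlinarith [sq_nonneg (‖b - b'‖ * ‖w‖ - |a - a'|)]
  rw [hquad, ← map_sub]
  have hw2 : ‖w‖ ^ 2 ≤ C ^ 2 / c ^ 2 := by rw [← div_pow]; gcongr
  calc _ ≤ (‖w‖ * ‖T (u - v)‖) ^ 2 + ‖T (u - v)‖ ^ 2 := by gcongr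
    _ = (1 + ‖w‖ ^ 2) * ‖T (u - v)‖ ^ 2 := by ring
    _ ≤ (1 + ‖w‖ ^ 2) * (K * ‖u - v‖) ^ 2 := by gcongr
    _ = (1 + ‖w‖ ^ 2) * (K / c) ^ 2 * (c ^ 2 * ‖u - v‖ ^ 2) := by field_simp
    _ ≤ (1 + ‖w‖ ^ 2) * (K / c) ^ 2 * ((1 + ‖w‖ ^ 2) * ((a - a') ^ 2 + ‖b - b'‖ ^ 2)) := by
      gcongr
    _ = (K * (1 + ‖w‖ ^ 2) / c) ^ 2 * ((a - a') ^ 2 + ‖b - b'‖ ^ 2) := by ring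
    _ ≤ _ := by gcongr

/-- The logarithm is `c⁻¹`-Lipschitz on `[c, ∞)`. -/
lemma Real.abs_log_sub_log_le {c a b : ℝ} (hc : 0 < c) (ha : c ≤ a) (hb : c ≤ b) :
    |Real.log a - Real.log b| ≤ |a - b| / c := by
  wlog h : b ≤ a generalizing a b
  · rw [abs_sub_comm, abs_sub_comm a]
    exact this hb ha (le_of_not_ge h)
  have hb0 := hc.trans_le hb
  have ha0 := hc.trans_le ha
  rw [abs_of_nonneg (sub_nonneg.mpr (Real.log_le_log hb0 h)), abs_of_nonneg (sub_nonneg.mpr h),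
    ← Real.log_div ha0.ne' hb0.ne']
  calc Real.log (a / b) ≤ a / b - 1 := Real.log_le_sub_one_of_pos (div_pos ha0 hb0)
    _ = (a - b) / b := by field_simp
    _ ≤ _ := div_le_div_of_nonneg_left (sub_nonneg.mpr h) hc hb

/-- The projection of `ℝ^{1+d}` onto its last `d` coordinates. -/
noncomputable def euclideanTail (d : ℕ) :
    EuclideanSpace ℝ (Fin (d + 1)) →L[ℝ] EuclideanSpace ℝ (Fin d) :=
  LinearMap.toContinuousLinearMap
    { toFun := fun x => WithLp.toLp 2 fun i => x i.succ
      map_add' := fun _ _ => rfl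
      map_smul' := fun _ _ => rfl }

@[simp]
lemma euclideanTail_apply {d : ℕ} (x : EuclideanSpace ℝ (Fin (d + 1))) (i : Fin d) :
    euclideanTail d x i = x i.succ := rfl

lemma norm_sq_eq_head_add_tail {d : ℕ} (x : EuclideanSpace ℝ (Fin (d + 1))) :
    ‖x‖ ^ 2 = x 0 ^ 2 + ‖euclideanTail d x‖ ^ 2 := by
  simp [EuclideanSpace.norm_sq_eq, Fin.sum_univ_succ]

lemma inner_eq_head_add_tail {d : ℕ} (x y : EuclideanSpace ℝ (Fin (d + 1))) :
    inner ℝ x y = x 0 * y 0 + inner ℝ (euclideanTail d x) (euclideanTail d y) := by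
  simp [PiLp.inner_apply, Fin.sum_univ_succ, mul_comm]

/-- The gradient of `βᵀGβ/(2α)` at `x = (α, β)`, in terms of `β/α`. -/
noncomputable def perspectiveGradient {d : ℕ} (G : Matrix (Fin d) (Fin d) ℝ)
    (x : EuclideanSpace ℝ (Fin (d + 1))) : EuclideanSpace ℝ (Fin (d + 1)) :=
  WithLp.toLp 2 (Fin.cons
    (-(inner ℝ ((x 0)⁻¹ • euclideanTail d x)
      (toEuclideanCLM (𝕜 := ℝ) G ((x 0)⁻¹ • euclideanTail d x)) / 2))
    (toEuclideanCLM (𝕜 := ℝ) G ((x 0)⁻¹ • euclideanTail d x)))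

lemma perspectiveGradient_zero {d : ℕ} (G : Matrix (Fin d) (Fin d) ℝ)
    (x : EuclideanSpace ℝ (Fin (d + 1))) :
    perspectiveGradient G x 0 = -(inner ℝ ((x 0)⁻¹ • euclideanTail d x)
      (toEuclideanCLM (𝕜 := ℝ) G ((x 0)⁻¹ • euclideanTail d x)) / 2) := rfl

lemma euclideanTail_perspectiveGradient {d : ℕ} (G : Matrix (Fin d) (Fin d) ℝ)
    (x : EuclideanSpace ℝ (Fin (d + 1))) :
    euclideanTail d (perspectiveGradient G x)
      = toEuclideanCLM (𝕜 := ℝ) G ((x 0)⁻¹ • euclideanTail d x) := rfl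

lemma hasGradientAt_perspective_add_entropy {d : ℕ} {G : Matrix (Fin d) (Fin d) ℝ}
    (hG : G.IsHermitian) (γ : ℝ) {x : EuclideanSpace ℝ (Fin (d + 1))} (hx : x 0 ≠ 0) :
    HasGradientAt (fun x : EuclideanSpace ℝ (Fin (d + 1)) =>
        (fun i => x i.succ) ⬝ᵥ G.mulVec (fun i => x i.succ) / (2 * x 0)
          + γ * x 0 * Real.log (x 0))
      (perspectiveGradient G x + EuclideanSpace.single 0 (γ * (Real.log (x 0) + 1))) x := by
  set T := toEuclideanCLM (𝕜 := ℝ) G with hTdef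
  have hsymm : ∀ v w : EuclideanSpace ℝ (Fin d), inner ℝ (T v) w = inner ℝ v (T w) :=
    isSymmetric_toEuclideanLin_iff.mpr hG
  have hfun : (fun x : EuclideanSpace ℝ (Fin (d + 1)) =>
      (fun i => x i.succ) ⬝ᵥ G.mulVec (fun i => x i.succ) / (2 * x 0)
        + γ * x 0 * Real.log (x 0))
      = fun x => inner ℝ (euclideanTail d x) (T (euclideanTail d x)) * (2 * x 0)⁻¹
        + γ * x 0 * Real.log (x 0) := by
    funext y
    rw [div_eq_mul_inv]
    congr 2
    rw [← hsymm]
    rfl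
  have h0 : HasFDerivAt (fun x : EuclideanSpace ℝ (Fin (d + 1)) => x 0)
      (EuclideanSpace.proj (𝕜 := ℝ) (0 : Fin (d + 1))) x :=
    (EuclideanSpace.proj (𝕜 := ℝ) (0 : Fin (d + 1))).hasFDerivAt
  have hP := (euclideanTail d).hasFDerivAt (x := x)
  have hq := hP.inner ℝ (T.hasFDerivAt.comp x hP)
  have hinv := (hasDerivAt_inv (mul_ne_zero two_ne_zero hx)).comp_hasFDerivAt x (h0.const_mul 2)
  have hfd := (hq.mul hinv).add ((h0.const_mul γ).mul (h0.log hx))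
  rw [hfun, hasGradientAt_iff_hasFDerivAt]
  refine hfd.congr_fderiv ?_
  ext y
  have hs : inner ℝ (T (euclideanTail d x)) (euclideanTail d y)
      = inner ℝ (euclideanTail d x) (T (euclideanTail d y)) := hsymm _ _
  have hs' : inner ℝ (euclideanTail d y) (T (euclideanTail d x))
      = inner ℝ (euclideanTail d x) (T (euclideanTail d y)) := by rw [real_inner_comm, hs]
  simp only [InnerProductSpace.toDual_apply_apply, inner_add_left, EuclideanSpace.inner_single_left,
    inner_eq_head_add_tail (perspectiveGradient G x), perspectiveGradient_zero,
    euclideanTail_perspectiveGradient, ← hTdef, map_smul, inner_smul_left, inner_smul_right, hs]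
  simp [fderivInnerCLM_apply, hs']
  field_simp
  ring

/-- **Lipschitz smoothness of the dynamic-cost integrand.**
For `d ≥ 1`, `G ≻ 0` symmetric, `γ ≥ 0`, `c̲_ρ > 0` and `c̄_m > 0`, on the convex set
`{(α,β) ∈ ℝ^{1+d} : α ≥ c̲_ρ, ‖β‖₂ ≤ c̄_m}` the gradient of
`L_{G,γ}(α,β) = βᵀGβ/(2α) + γ·α·log α` is Lipschitz with constant
`max(1, λ_max(G))·(λ_max(G)·c̄_m² + (γ+1)·c̲_ρ²)/c̲_ρ³`.
Here `ℝ^{1+d}` is `EuclideanSpace ℝ (Fin (d+1))`, with `α = x 0` and `β i = x i.succ`. -/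
theorem stmt4 (d : ℕ) (hd : 1 ≤ d) (G : Matrix (Fin d) (Fin d) ℝ)
    (hGsymm : G.IsSymm) (hG : G.PosDef) (γ : ℝ) (hγ : 0 ≤ γ)
    (cρ Cm : ℝ) (hcρ : 0 < cρ) (hCm : 0 < Cm) :
    ∀ x ∈ {x : EuclideanSpace ℝ (Fin (d + 1)) |
            cρ ≤ x 0 ∧ Real.sqrt (∑ i : Fin d, (x i.succ) ^ 2) ≤ Cm},
      ∀ y ∈ {x : EuclideanSpace ℝ (Fin (d + 1)) |
            cρ ≤ x 0 ∧ Real.sqrt (∑ i : Fin d, (x i.succ) ^ 2) ≤ Cm},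
        ‖gradient (fun x : EuclideanSpace ℝ (Fin (d + 1)) =>
            (fun i => x i.succ) ⬝ᵥ G.mulVec (fun i => x i.succ) / (2 * x 0)
              + γ * x 0 * Real.log (x 0)) x
          - gradient (fun x : EuclideanSpace ℝ (Fin (d + 1)) =>
            (fun i => x i.succ) ⬝ᵥ G.mulVec (fun i => x i.succ) / (2 * x 0)
              + γ * x 0 * Real.log (x 0)) y‖
        ≤ max 1 (lamMax hd hG.1) *
            (lamMax hd hG.1 * Cm ^ 2 + (γ + 1) * cρ ^ 2) / cρ ^ 3 * ‖x - y‖ := by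
  rintro x ⟨hx0, hxC⟩ y ⟨hy0, hyC⟩
  rw [(hasGradientAt_perspective_add_entropy hG.1 γ (hcρ.trans_le hx0).ne').gradient,
    (hasGradientAt_perspective_add_entropy hG.1 γ (hcρ.trans_le hy0).ne').gradient]
  set Λ := lamMax hd hG.1
  have hΛ : 0 ≤ Λ := (hG.posSemidef.eigenvalues_nonneg ⟨0, hd⟩).trans
    (Finset.le_sup' hG.1.eigenvalues (Finset.mem_univ _))
  have hnorm : ∀ z : EuclideanSpace ℝ (Fin (d + 1)),
      Real.sqrt (∑ i : Fin d, (z i.succ) ^ 2) = ‖euclideanTail d z‖ := fun z => by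
    simp [EuclideanSpace.norm_eq]
  rw [hnorm] at hxC hyC
  have hquad : ‖perspectiveGradient G x - perspectiveGradient G y‖
      ≤ Λ * (1 + Cm ^ 2 / cρ ^ 2) / cρ * ‖x - y‖ := by
    refine le_of_sq_le_sq ?_ (by positivity)
    rw [mul_pow, norm_sq_eq_head_add_tail, norm_sq_eq_head_add_tail (x - y), map_sub, map_sub,
      euclideanTail_perspectiveGradient, euclideanTail_perspectiveGradient, PiLp.sub_apply,
      PiLp.sub_apply, perspectiveGradient_zero, perspectiveGradient_zero]
    refine le_trans (le_of_eq ?_) (perspective_gradient_dist_sq_le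
      (toEuclideanCLM (𝕜 := ℝ) G) (isSymmetric_toEuclideanLin_iff.mpr hG.1)
      (norm_toEuclideanCLM_le_lamMax hd hG.posSemidef) hΛ hcρ hx0 hy0 hxC hyC)
    ring
  have hhead : |x 0 - y 0| ≤ ‖x - y‖ := by
    simpa using PiLp.norm_apply_le (x - y) 0
  have hlog : ‖EuclideanSpace.single (0 : Fin (d + 1)) (γ * (Real.log (x 0) + 1))
      - EuclideanSpace.single 0 (γ * (Real.log (y 0) + 1))‖ ≤ γ / cρ * ‖x - y‖ := by
    rw [← dist_eq_norm, PiLp.dist_single_same, Real.dist_eq, ← mul_sub, abs_mul,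
      abs_of_nonneg hγ, add_sub_add_right_eq_sub, div_mul_eq_mul_div, mul_div_assoc]
    gcongr
    exact (Real.abs_log_sub_log_le hcρ hx0 hy0).trans (by gcongr)
  rw [add_sub_add_comm]
  refine (norm_add_le _ _).trans ((add_le_add hquad hlog).trans ?_)
  rw [← add_mul]
  gcongr
  have h1 : 1 ≤ max 1 Λ := le_max_left _ _
  have h2 : Λ ≤ max 1 Λ := le_max_right _ _
  calc Λ * (1 + Cm ^ 2 / cρ ^ 2) / cρ + γ / cρ
      = (1 * (Λ * Cm ^ 2) + 1 * (γ * cρ ^ 2) + Λ * cρ ^ 2) / cρ ^ 3 := by field_simp; ring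
    _ ≤ (max 1 Λ * (Λ * Cm ^ 2) + max 1 Λ * (γ * cρ ^ 2) + max 1 Λ * cρ ^ 2) / cρ ^ 3 := by
      gcongr
    _ = _ := by ring
end

section
/- Let d ≥ 1, let G ∈ ℝ^{d×d} be symmetric positive definite, let γ > 0, and let 0 < c̲_ρ ≤ c̄_ρ and c̄_m > 0. Then L_{G,γ}(α, β) := βᵀGβ/(2α) + γ·α·log α is μ-strongly convex on the convex set {(α, β) : c̲_ρ ≤ α ≤ c̄_ρ, ‖β‖₂ ≤ c̄_m} with modulus μ := min(1, λ_min(G)) · min( γ·c̲_ρ/(λ_max(G)·c̄_m² + (γ+1)·c̲_ρ²), γ·c̄_ρ/(λ_max(G)·c̄_m² + (γ+1)·c̄_ρ²) ); that is, (α, β) ↦ L_{G,γ}(α, β) − (μ/2)(α² + ‖β‖₂²) is convex on that set. -/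
open Matrix Finset

/-- The smallest eigenvalue of a Hermitian real matrix. -/
noncomputable def lamMin {d : ℕ} (hd : 0 < d) {G : Matrix (Fin d) (Fin d) ℝ}
    (hG : G.IsHermitian) : ℝ :=
  Finset.univ.inf' (Finset.univ_nonempty_iff.mpr ⟨⟨0, hd⟩⟩) hG.eigenvalues

section Spectral

variable {n : Type*} [Fintype n] [DecidableEq n] {G : Matrix n n ℝ}

/-- A real quadratic form is diagonal in an orthonormal eigenbasis. -/
lemma Matrix.IsHermitian.exists_dotProduct_mulVec_eq_sum_eigenvalues (hG : G.IsHermitian)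
    (v : n → ℝ) : ∃ w : n → ℝ, v ⬝ᵥ G *ᵥ v = ∑ i, hG.eigenvalues i * w i ^ 2 ∧
      ∑ i, v i ^ 2 = ∑ i, w i ^ 2 := by
  set U : Matrix n n ℝ := (hG.eigenvectorUnitary : Matrix n n ℝ) with hU
  have hUU : U * star U = 1 := Unitary.coe_mul_star_self hG.eigenvectorUnitary
  have hspec : G = U * diagonal hG.eigenvalues * star U := by
    conv_lhs => rw [hG.spectral_theorem, Unitary.conjStarAlgAut_apply]
    rfl
  have hmove : ∀ u : n → ℝ, v ⬝ᵥ U *ᵥ u = star U *ᵥ v ⬝ᵥ u := fun u ↦ by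
    rw [dotProduct_mulVec, star_eq_conjTranspose, conjTranspose_eq_transpose_of_trivial,
      mulVec_transpose]
  refine ⟨star U *ᵥ v, ?_, ?_⟩
  · conv_lhs => rw [hspec]
    rw [← mulVec_mulVec, ← mulVec_mulVec, hmove]
    simp only [dotProduct, mulVec_diagonal]
    exact Finset.sum_congr rfl fun i _ ↦ by ring
  · have h : v ⬝ᵥ v = star U *ᵥ v ⬝ᵥ star U *ᵥ v := by
      rw [← hmove, mulVec_mulVec, hUU, one_mulVec]
    simpa only [dotProduct, ← sq] using h

end Spectral

lemma lamMin_mul_le_dotProduct_mulVec {d : ℕ} (hd : 0 < d) {G : Matrix (Fin d) (Fin d) ℝ}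
    (hG : G.IsHermitian) (v : Fin d → ℝ) :
    lamMin hd hG * ∑ i, v i ^ 2 ≤ v ⬝ᵥ G *ᵥ v := by
  obtain ⟨w, h₁, h₂⟩ := hG.exists_dotProduct_mulVec_eq_sum_eigenvalues v
  rw [h₁, h₂, Finset.mul_sum]
  exact Finset.sum_le_sum fun i hi ↦
    mul_le_mul_of_nonneg_right (Finset.inf'_le _ hi) (sq_nonneg _)

lemma dotProduct_mulVec_le_lamMax_mul {d : ℕ} (hd : 0 < d) {G : Matrix (Fin d) (Fin d) ℝ}
    (hG : G.IsHermitian) (v : Fin d → ℝ) :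
    v ⬝ᵥ G *ᵥ v ≤ lamMax hd hG * ∑ i, v i ^ 2 := by
  obtain ⟨w, h₁, h₂⟩ := hG.exists_dotProduct_mulVec_eq_sum_eigenvalues v
  rw [h₁, h₂, Finset.mul_sum]
  exact Finset.sum_le_sum fun i hi ↦
    mul_le_mul_of_nonneg_right (Finset.le_sup' _ hi) (sq_nonneg _)

lemma lamMax_nonneg {d : ℕ} (hd : 0 < d) {G : Matrix (Fin d) (Fin d) ℝ} (hG : G.PosDef) :
    0 ≤ lamMax hd hG.1 :=
  (hG.eigenvalues_pos ⟨0, hd⟩).le.trans (Finset.le_sup' _ (Finset.mem_univ _))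

/-- The function `x ↦ γ x / (S + e x ^ 2)` attains its minimum over an interval of positive reals
at an endpoint. -/
lemma min_div_add_mul_sq_le {γ S e c C x : ℝ} (hγ : 0 ≤ γ) (hS : 0 ≤ S) (he : 0 < e)
    (hc : 0 < c) (hcx : c ≤ x) (hxC : x ≤ C) :
    min (γ * c / (S + e * c ^ 2)) (γ * C / (S + e * C ^ 2)) ≤ γ * x / (S + e * x ^ 2) := by
  have hx : 0 < x := hc.trans_le hcx
  have hC : 0 < C := hx.trans_le hxC
  rcases le_total (e * c * x) S with h | h
  · refine (min_le_left _ _).trans ?_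
    rw [div_le_div_iff₀ (by positivity) (by positivity)]
    nlinarith [mul_nonneg hγ (mul_nonneg (sub_nonneg.2 hcx) (sub_nonneg.2 h))]
  · have h' : S ≤ e * C * x := h.trans (by gcongr; exact hcx.trans hxC)
    refine (min_le_right _ _).trans ?_
    rw [div_le_div_iff₀ (by positivity) (by positivity)]
    nlinarith [mul_nonneg hγ (mul_nonneg (sub_nonneg.2 hxC) (sub_nonneg.2 h'))]

/-- Lower bound for the Hessian of `(α, β) ↦ ⟪β, β⟫ / (2 α) + γ α log α` in the direction `(a, b)`,
where `x`, `y`, `z` stand for the products `⟪β, β⟫`, `⟪β, b⟫`, `⟪b, b⟫`. -/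
lemma perspective_hessian_lower_bound {γ α a x y z : ℝ} (hγ : 0 < γ) (hα : 0 < α) (hx : 0 ≤ x)
    (hyxz : y ^ 2 ≤ x * z) (hq : 0 ≤ α ^ 2 * z - 2 * α * a * y + a ^ 2 * x) :
    γ * α / (x + (γ + 1) * α ^ 2) * (a ^ 2 + z) ≤
      z / α - 2 * y * a / α ^ 2 + x * a ^ 2 / α ^ 3 + γ * a ^ 2 / α := by
  have hT : 0 < x + (γ + 1) * α ^ 2 := by positivity
  have hrw : z / α - 2 * y * a / α ^ 2 + x * a ^ 2 / α ^ 3 + γ * a ^ 2 / α =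
      (α ^ 2 * z - 2 * α * a * y + a ^ 2 * x + γ * a ^ 2 * α ^ 2) / α ^ 3 := by
    field_simp
  rw [hrw, div_mul_eq_mul_div, div_le_div_iff₀ hT (by positivity)]
  nlinarith [sq_nonneg ((x + γ * α ^ 2) * a - α * y),
    mul_nonneg (sq_nonneg α) (sub_nonneg.2 hyxz), mul_nonneg (sq_nonneg α) hq]

/-- Second derivative test for `N / (2 α) + γ α log α - μ / 2 (α ^ 2 + M)` with `α` affine and
`N`, `M` quadratic functions of one variable. -/
lemma convexOn_line_of_hessian_nonneg {γ μ α₀ a A B C P Q R : ℝ}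
    (hα : ∀ t ∈ Set.Icc (0 : ℝ) 1, 0 < α₀ + t * a)
    (h : ∀ t ∈ Set.Icc (0 : ℝ) 1, μ * (a ^ 2 + R) ≤
      C / (α₀ + t * a) - 2 * (B + t * C) * a / (α₀ + t * a) ^ 2 +
        (A + 2 * t * B + t ^ 2 * C) * a ^ 2 / (α₀ + t * a) ^ 3 + γ * a ^ 2 / (α₀ + t * a)) :
    ConvexOn ℝ (Set.Icc 0 1) fun t : ℝ ↦
      (A + 2 * t * B + t ^ 2 * C) / (2 * (α₀ + t * a)) + γ * (α₀ + t * a) * Real.log (α₀ + t * a) -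
        μ / 2 * ((α₀ + t * a) ^ 2 + (P + 2 * t * Q + t ^ 2 * R)) := by
  have hdα : ∀ t : ℝ, HasDerivAt (fun t ↦ α₀ + t * a) a t := fun t ↦ by
    simpa using ((hasDerivAt_id t).mul_const a).const_add α₀
  have hquad : ∀ A B C t : ℝ, HasDerivAt (fun t ↦ A + 2 * t * B + t ^ 2 * C)
      (2 * (B + t * C)) t := fun A B C t ↦ by
    refine (((((hasDerivAt_id t).const_mul 2).mul_const B).const_add A).add
      (((hasDerivAt_id t).pow 2).mul_const C)).congr_deriv ?_
    simp only [id]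
    push_cast
    ring
  have hlin : ∀ B C t : ℝ, HasDerivAt (fun t ↦ B + t * C) C t := fun B C t ↦ by
    simpa using ((hasDerivAt_id t).mul_const C).const_add B
  have hd₁ : ∀ t ∈ Set.Icc (0 : ℝ) 1, HasDerivAt (fun t : ℝ ↦
      (A + 2 * t * B + t ^ 2 * C) / (2 * (α₀ + t * a)) + γ * (α₀ + t * a) * Real.log (α₀ + t * a) -
        μ / 2 * ((α₀ + t * a) ^ 2 + (P + 2 * t * Q + t ^ 2 * R)))
      ((B + t * C) / (α₀ + t * a) - (A + 2 * t * B + t ^ 2 * C) * a / (2 * (α₀ + t * a) ^ 2) +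
        (γ * a * Real.log (α₀ + t * a) + γ * a) - μ * ((α₀ + t * a) * a + (Q + t * R))) t := by
    intro t ht
    have hα' := hα t ht
    refine ((((hquad A B C t).div ((hdα t).const_mul 2) (by positivity)).add
      (((hdα t).const_mul γ).mul ((hdα t).log hα'.ne'))).sub
      ((((hdα t).pow 2).add (hquad P Q R t)).const_mul (μ / 2))).congr_deriv ?_
    push_cast
    field_simp
  have hd₂ : ∀ t ∈ Set.Icc (0 : ℝ) 1, HasDerivAt (fun t : ℝ ↦
      (B + t * C) / (α₀ + t * a) - (A + 2 * t * B + t ^ 2 * C) * a / (2 * (α₀ + t * a) ^ 2) +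
        (γ * a * Real.log (α₀ + t * a) + γ * a) - μ * ((α₀ + t * a) * a + (Q + t * R)))
      (C / (α₀ + t * a) - 2 * (B + t * C) * a / (α₀ + t * a) ^ 2 +
        (A + 2 * t * B + t ^ 2 * C) * a ^ 2 / (α₀ + t * a) ^ 3 + γ * a ^ 2 / (α₀ + t * a) -
        μ * (a ^ 2 + R)) t := by
    intro t ht
    have hα' := hα t ht
    refine (((((hlin B C t).div (hdα t) hα'.ne').sub
      (((hquad A B C t).mul_const a).div (((hdα t).pow 2).const_mul 2) (mul_ne_zero two_ne_zero (pow_ne_zero 2 hα'.ne')))).add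
      ((((hdα t).log hα'.ne').const_mul (γ * a)).add_const (γ * a))).sub
      ((((hdα t).mul_const a).add (hlin Q R t)).const_mul μ)).congr_deriv ?_
    simp only [Pi.pow_apply]
    push_cast
    field_simp
    ring
  exact convexOn_of_hasDerivWithinAt2_nonneg (convex_Icc 0 1)
    (fun t ht ↦ (hd₁ t ht).continuousAt.continuousWithinAt)
    (fun t ht ↦ (hd₁ t (interior_subset ht)).hasDerivWithinAt)
    (fun t ht ↦ (hd₂ t (interior_subset ht)).hasDerivWithinAt)
    (fun t ht ↦ sub_nonneg.2 (h t (interior_subset ht)))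

/-- Convexity of a function on a convex set follows from convexity along segments. -/
lemma convexOn_of_convexOn_segments {E : Type*} [AddCommGroup E] [Module ℝ E] {s : Set E}
    {f : E → ℝ} (hs : Convex ℝ s)
    (h : ∀ p ∈ s, ∀ q ∈ s, ConvexOn ℝ (Set.Icc 0 1) fun t : ℝ ↦ f (p + t • (q - p))) :
    ConvexOn ℝ s f := by
  refine ⟨hs, fun p hp q hq a b ha hb hab ↦ ?_⟩
  have h01 := (h p hp q hq).2 (Set.left_mem_Icc.2 zero_le_one) (Set.right_mem_Icc.2 zero_le_one)
    ha hb hab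
  have hpt : p + b • (q - p) = a • p + b • q := by
    rw [eq_sub_of_add_eq hab]
    module
  simpa [hpt] using h01

lemma convex_box (ι : Type*) [Fintype ι] (c C K : ℝ) :
    Convex ℝ {p : ℝ × (ι → ℝ) | c ≤ p.1 ∧ p.1 ≤ C ∧ Real.sqrt (∑ i, (p.2 i) ^ 2) ≤ K} := by
  rintro p ⟨hp₁, hp₂, hp₃⟩ q ⟨hq₁, hq₂, hq₃⟩ a b ha hb hab
  have hI : a • p.1 + b • q.1 ∈ Set.Icc c C := convex_Icc c C ⟨hp₁, hp₂⟩ ⟨hq₁, hq₂⟩ ha hb hab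
  refine ⟨hI.1, hI.2, ?_⟩
  have hnorm : ∀ v : ι → ℝ, Real.sqrt (∑ i, v i ^ 2) = ‖WithLp.toLp 2 v‖ := fun v ↦ by
    simp [EuclideanSpace.norm_eq]
  rw [hnorm] at hp₃ hq₃ ⊢
  have := convex_closedBall (0 : EuclideanSpace ℝ ι) K (mem_closedBall_zero_iff.2 hp₃)
    (mem_closedBall_zero_iff.2 hq₃) ha hb hab
  exact mem_closedBall_zero_iff.1 this

/-- **Strong convexity of the dynamic-cost integrand on a box.**
For `d ≥ 1`, `G ≻ 0` symmetric, `γ > 0`, `0 < c̲_ρ ≤ c̄_ρ` and `c̄_m > 0`, the function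
`L_{G,γ}(α,β) = βᵀGβ/(2α) + γ·α·log α` is `μ`-strongly convex on
`{(α,β) : c̲_ρ ≤ α ≤ c̄_ρ, ‖β‖₂ ≤ c̄_m}` with
`μ = min(1, λ_min(G))·min(γc̲_ρ/(λ_max(G)c̄_m² + (γ+1)c̲_ρ²), γc̄_ρ/(λ_max(G)c̄_m² + (γ+1)c̄_ρ²))`,
i.e. `(α,β) ↦ L_{G,γ}(α,β) − (μ/2)(α² + ‖β‖₂²)` is convex there. -/
theorem stmt5 (d : ℕ) (hd : 1 ≤ d) (G : Matrix (Fin d) (Fin d) ℝ)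
    (hGsymm : G.IsSymm) (hG : G.PosDef) (γ : ℝ) (hγ : 0 < γ)
    (cρ Cρ Cm : ℝ) (hcρ : 0 < cρ) (hcC : cρ ≤ Cρ) (hCm : 0 < Cm) :
    ConvexOn ℝ
      {p : ℝ × (Fin d → ℝ) |
        cρ ≤ p.1 ∧ p.1 ≤ Cρ ∧ Real.sqrt (∑ i, (p.2 i) ^ 2) ≤ Cm}
      (fun p => p.2 ⬝ᵥ G.mulVec p.2 / (2 * p.1) + γ * p.1 * Real.log p.1
        - (min 1 (lamMin hd hG.1) *
            min (γ * cρ / (lamMax hd hG.1 * Cm ^ 2 + (γ + 1) * cρ ^ 2))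
                (γ * Cρ / (lamMax hd hG.1 * Cm ^ 2 + (γ + 1) * Cρ ^ 2)) / 2) *
          (p.1 ^ 2 + ∑ i, (p.2 i) ^ 2)) := by
  have hsymm : ∀ u v : Fin d → ℝ, v ⬝ᵥ G *ᵥ u = u ⬝ᵥ G *ᵥ v := fun u v ↦ by
    rw [dotProduct_mulVec, dotProduct_comm, ← mulVec_transpose, hGsymm.eq]
  have hnonneg : ∀ v : Fin d → ℝ, 0 ≤ v ⬝ᵥ G *ᵥ v := fun v ↦ by
    simpa using hG.posSemidef.dotProduct_mulVec_nonneg v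
  have hexp : ∀ (u v : Fin d → ℝ) (t : ℝ), (u + t • v) ⬝ᵥ G *ᵥ (u + t • v) =
      u ⬝ᵥ G *ᵥ u + 2 * t * (u ⬝ᵥ G *ᵥ v) + t ^ 2 * (v ⬝ᵥ G *ᵥ v) := fun u v t ↦ by
    simp only [mulVec_add, mulVec_smul, add_dotProduct, dotProduct_add, smul_dotProduct,
      dotProduct_smul, smul_eq_mul, hsymm u v]
    ring
  have hexp' : ∀ (u v : Fin d → ℝ) (t : ℝ), ∑ i, (u + t • v) i ^ 2 =
      ∑ i, u i ^ 2 + 2 * t * (∑ i, u i * v i) + t ^ 2 * ∑ i, v i ^ 2 := fun u v t ↦ by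
    simp only [Finset.mul_sum, ← Finset.sum_add_distrib, Pi.add_apply, Pi.smul_apply, smul_eq_mul]
    exact Finset.sum_congr rfl fun i _ ↦ by ring
  have hbox := convex_box (Fin d) cρ Cρ Cm
  refine convexOn_of_convexOn_segments hbox fun p hp q hq ↦ ?_
  have hmem := fun (t : ℝ) (ht : t ∈ Set.Icc (0 : ℝ) 1) ↦ hbox.add_smul_sub_mem hp hq ht
  simp only [Prod.fst_add, Prod.snd_add, Prod.smul_fst, Prod.smul_snd, Prod.fst_sub, Prod.snd_sub,
    smul_eq_mul, Set.mem_ofPred_eq, hexp, hexp'] at hmem ⊢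
  generalize hb : q.2 - p.2 = b at hmem ⊢
  generalize ha : q.1 - p.1 = a at hmem ⊢
  refine convexOn_line_of_hessian_nonneg (fun t ht ↦ hcρ.trans_le (hmem t ht).1) fun t ht ↦ ?_
  obtain ⟨h₁, h₂, h₃⟩ := hmem t ht
  rw [← hexp', Real.sqrt_le_left hCm.le] at h₃
  rw [← hexp]
  have hy : p.2 ⬝ᵥ G *ᵥ b + t * (b ⬝ᵥ G *ᵥ b) = (p.2 + t • b) ⬝ᵥ G *ᵥ b := by
    simp [add_dotProduct]
  rw [hy]
  generalize p.1 + t * a = α at h₁ h₂ ⊢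
  generalize p.2 + t • b = β at h₃ ⊢
  have hα : 0 < α := hcρ.trans_le h₁
  have hΛ := lamMax_nonneg hd hG
  have hx : β ⬝ᵥ G *ᵥ β ≤ lamMax hd hG.1 * Cm ^ 2 :=
    (dotProduct_mulVec_le_lamMax_mul hd hG.1 β).trans (by gcongr)
  have hcs : (β ⬝ᵥ G *ᵥ b) ^ 2 ≤ (β ⬝ᵥ G *ᵥ β) * (b ⬝ᵥ G *ᵥ b) := by
    have := discrim_le_zero (a := b ⬝ᵥ G *ᵥ b) (b := 2 * (β ⬝ᵥ G *ᵥ b)) (c := β ⬝ᵥ G *ᵥ β)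
      fun s ↦ by linarith [hexp β b s, hnonneg (β + s • b)]
    rw [discrim] at this
    linarith
  have hq' : 0 ≤ α ^ 2 * (b ⬝ᵥ G *ᵥ b) - 2 * α * a * (β ⬝ᵥ G *ᵥ b) + a ^ 2 * (β ⬝ᵥ G *ᵥ β) := by
    have h := hnonneg (α • b + (-a) • β)
    rw [hexp] at h
    simp only [mulVec_smul, smul_dotProduct, dotProduct_smul, smul_eq_mul, hsymm β b] at h
    linarith
  refine le_trans ?_ (perspective_hessian_lower_bound hγ hα (hnonneg β) hcs hq')
  have hR : 0 ≤ ∑ i, b i ^ 2 := Finset.sum_nonneg fun i _ ↦ sq_nonneg _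
  have hm : min 1 (lamMin hd hG.1) * (a ^ 2 + ∑ i, b i ^ 2) ≤ a ^ 2 + b ⬝ᵥ G *ᵥ b := by
    rw [mul_add]
    refine add_le_add ?_ ?_
    · exact mul_le_of_le_one_left (sq_nonneg a) (min_le_left _ _)
    · exact (mul_le_mul_of_nonneg_right (min_le_right _ _) hR).trans
        (lamMin_mul_le_dotProduct_mulVec hd hG.1 b)
  have hCρ : 0 < Cρ := hcρ.trans_le hcC
  have hk := min_div_add_mul_sq_le hγ.le (mul_nonneg hΛ (sq_nonneg Cm))
    (show 0 < γ + 1 by positivity) hcρ h₁ h₂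
  have hk₀ : 0 ≤ min (γ * cρ / (lamMax hd hG.1 * Cm ^ 2 + (γ + 1) * cρ ^ 2))
      (γ * Cρ / (lamMax hd hG.1 * Cm ^ 2 + (γ + 1) * Cρ ^ 2)) :=
    le_min (by positivity) (by positivity)
  have hxβ := hnonneg β
  have hk' : γ * α / (lamMax hd hG.1 * Cm ^ 2 + (γ + 1) * α ^ 2) ≤
      γ * α / (β ⬝ᵥ G *ᵥ β + (γ + 1) * α ^ 2) := by
    gcongr
  rw [mul_comm (min 1 _), mul_assoc]
  exact (mul_le_mul_of_nonneg_left hm hk₀).trans (mul_le_mul_of_nonneg_right (hk.trans hk')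
    (add_nonneg (sq_nonneg a) (hnonneg b)))
end

section
/- Let d ≥ 1, α > 0, γ ≥ 0 and β ∈ ℝ^d. Define the symmetric (d+1)×(d+1) matrix M := [[‖β‖₂² + γα², −αβᵀ], [−αβ, α²·I_d]] (so M = α³·∇²L_{I,γ}(α,β) where L_{I,γ}(α,β) = ‖β‖₂²/(2α) + γα log α). Then the characteristic polynomial of M factors as det(λ·I_{d+1} − M) = (λ² − (‖β‖₂² + (γ+1)α²)·λ + γα⁴) · (λ − α²)^{d−1}. -/
open Matrix Polynomial

theorem Matrix.det_fromBlocks_smul_one_mul_pow {R m n : Type*} [CommRing R] [Fintype m]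
    [DecidableEq m] [Fintype n] [DecidableEq n] (A : Matrix m m R) (B : Matrix m n R)
    (C : Matrix n m R) (t : R) :
    (fromBlocks A B C (t • (1 : Matrix n n R))).det * t ^ Fintype.card m =
      (t • A - B * C).det * t ^ Fintype.card n := by
  have h : fromBlocks A B C (t • (1 : Matrix n n R)) *
      fromBlocks (t • (1 : Matrix m m R)) 0 (-C) 1 =
        fromBlocks (t • A - B * C) B 0 (t • 1) := by
    simp [fromBlocks_multiply, sub_eq_add_neg]
  simpa [det_fromBlocks_zero₁₂, det_fromBlocks_zero₂₁] using congrArg det h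

/-- **Characteristic polynomial of the (scaled) Hessian of the kinetic-entropy integrand.**
For `α > 0`, `γ ≥ 0`, `β ∈ ℝ^d`, the symmetric `(d+1)×(d+1)` block matrix
`M = [[‖β‖² + γα², −αβᵀ], [−αβ, α²·I_d]]` (indexed by `Fin 1 ⊕ Fin d`) has characteristic
polynomial `(λ² − (‖β‖² + (γ+1)α²)·λ + γα⁴)·(λ − α²)^{d−1}`. -/
theorem stmt6 (d : ℕ) (hd : 1 ≤ d) (α : ℝ) (hα : 0 < α) (γ : ℝ) (hγ : 0 ≤ γ)
    (β : EuclideanSpace ℝ (Fin d)) :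
    (Matrix.fromBlocks
        (Matrix.of fun _ _ : Fin 1 => ‖β‖ ^ 2 + γ * α ^ 2)
        (Matrix.of fun (_ : Fin 1) (j : Fin d) => -α * β j)
        (Matrix.of fun (i : Fin d) (_ : Fin 1) => -α * β i)
        (α ^ 2 • (1 : Matrix (Fin d) (Fin d) ℝ))).charpoly
      = (X ^ 2 - C (‖β‖ ^ 2 + (γ + 1) * α ^ 2) * X + C (γ * α ^ 4)) *
          (X - C (α ^ 2)) ^ (d - 1) := by
  have hcharmatrix : (α ^ 2 • (1 : Matrix (Fin d) (Fin d) ℝ)).charmatrix =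
      (X - C (α ^ 2)) • (1 : Matrix (Fin d) (Fin d) ℝ[X]) := by
    ext1 i j
    by_cases h : i = j
    · subst h; simp
    · simp [h]
  have hβ : ∑ i, (C (β i) : ℝ[X]) * C (β i) = C (‖β‖ ^ 2) := by
    simp only [EuclideanSpace.real_norm_sq_eq, map_sum, C_pow, ← sq]
  have hpow : (X - C (α ^ 2)) ^ d = (X - C (α ^ 2)) ^ (d - 1) * (X - C (α ^ 2)) := by
    rw [← pow_succ, Nat.sub_add_cancel hd]
  apply mul_right_cancel₀ (X_sub_C_ne_zero (α ^ 2))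
  rw [Matrix.charpoly, charmatrix_fromBlocks, hcharmatrix]
  have hdet := Matrix.det_fromBlocks_smul_one_mul_pow
    (Matrix.of fun _ _ : Fin 1 => ‖β‖ ^ 2 + γ * α ^ 2).charmatrix
    (-(Matrix.of fun (_ : Fin 1) (j : Fin d) => -α * β j).map C)
    (-(Matrix.of fun (i : Fin d) (_ : Fin 1) => -α * β i).map C) (X - C (α ^ 2))
  rw [Fintype.card_fin, Fintype.card_fin, pow_one] at hdet
  have hsum : ∑ i, (C α * C (β i)) * (C α * C (β i)) = C α ^ 2 * C (‖β‖ ^ 2) := by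
    rw [← hβ, Finset.mul_sum]
    exact Finset.sum_congr rfl fun i _ => by ring
  rw [hdet, hpow, ← mul_assoc, det_fin_one]
  congr 2
  simp only [Matrix.sub_apply, Matrix.smul_apply, Matrix.mul_apply, Matrix.neg_apply,
    Matrix.map_apply, Matrix.of_apply, charmatrix_apply_eq, smul_eq_mul, neg_mul,
    map_neg, neg_neg, C_mul, hsum]
  simp only [C_add, C_mul, C_pow, C_1]
  ring
end

section
/- Let d ≥ 1, α > 0, γ ≥ 0 and β ∈ ℝ^d, and let M := [[‖β‖₂² + γα², −αβᵀ], [−αβ, α²·I_d]] ∈ ℝ^{(d+1)×(d+1)}. Then for every z ∈ ℝ^{d+1}: (γα⁴/(‖β‖₂² + (γ+1)α²))·‖z‖₂² ≤ zᵀMz ≤ (‖β‖₂² + (γ+1)α²)·‖z‖₂². In particular M is positive semidefinite, and positive definite when γ > 0. -/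
open Matrix

/-- The quadratic form of the block matrix `[[a, b • vᵀ], [b • v, c • 1]]`. -/
theorem dotProduct_fromBlocks_mulVec {ι : Type*} [Fintype ι] [DecidableEq ι]
    (a b c : ℝ) (v : ι → ℝ) (z : Fin 1 ⊕ ι → ℝ) :
    z ⬝ᵥ (Matrix.fromBlocks
        (Matrix.of fun _ _ : Fin 1 => a)
        (Matrix.of fun (_ : Fin 1) (j : ι) => b * v j)
        (Matrix.of fun (i : ι) (_ : Fin 1) => b * v i)
        (c • (1 : Matrix ι ι ℝ))).mulVec z =
      a * z (.inl 0) ^ 2 + 2 * b * z (.inl 0) * ∑ i, v i * z (.inr i) +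
        c * ∑ i, z (.inr i) ^ 2 := by
  rw [fromBlocks_mulVec]
  simp only [dotProduct, Fintype.sum_sum_type, Sum.elim_inl, Sum.elim_inr,
    Pi.add_apply, smul_mulVec, one_mulVec, Pi.smul_apply, smul_eq_mul, mulVec, of_apply,
    Function.comp_apply, Fin.sum_univ_one, mul_add, Finset.sum_add_distrib, Finset.mul_sum]
  rw [add_assoc, add_assoc, ← add_assoc (Finset.sum _ _), ← Finset.sum_add_distrib]
  congr 1
  · ring
  · congr 1
    · exact Finset.sum_congr rfl fun i _ => by ring
    · exact Finset.sum_congr rfl fun i _ => by ring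

/-- **Two-sided quadratic-form bounds for the (scaled) Hessian.**
For `α > 0`, `γ ≥ 0`, `β ∈ ℝ^d` and the block matrix
`M = [[‖β‖² + γα², −αβᵀ], [−αβ, α²·I_d]]` (indexed by `Fin 1 ⊕ Fin d`), every
`z ∈ ℝ^{d+1}` satisfies
`(γα⁴/(‖β‖² + (γ+1)α²))·‖z‖² ≤ zᵀMz ≤ (‖β‖² + (γ+1)α²)·‖z‖²`; in particular `M` is
positive semidefinite, and positive definite when `γ > 0`. -/
theorem stmt7 (d : ℕ) (hd : 1 ≤ d) (α : ℝ) (hα : 0 < α) (γ : ℝ) (hγ : 0 ≤ γ)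
    (β : EuclideanSpace ℝ (Fin d)) :
    (∀ z : Fin 1 ⊕ Fin d → ℝ,
      γ * α ^ 4 / (‖β‖ ^ 2 + (γ + 1) * α ^ 2) * ∑ i, (z i) ^ 2 ≤
          z ⬝ᵥ (Matrix.fromBlocks
            (Matrix.of fun _ _ : Fin 1 => ‖β‖ ^ 2 + γ * α ^ 2)
            (Matrix.of fun (_ : Fin 1) (j : Fin d) => -α * β j)
            (Matrix.of fun (i : Fin d) (_ : Fin 1) => -α * β i)
            (α ^ 2 • (1 : Matrix (Fin d) (Fin d) ℝ))).mulVec z ∧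
        z ⬝ᵥ (Matrix.fromBlocks
            (Matrix.of fun _ _ : Fin 1 => ‖β‖ ^ 2 + γ * α ^ 2)
            (Matrix.of fun (_ : Fin 1) (j : Fin d) => -α * β j)
            (Matrix.of fun (i : Fin d) (_ : Fin 1) => -α * β i)
            (α ^ 2 • (1 : Matrix (Fin d) (Fin d) ℝ))).mulVec z ≤
          (‖β‖ ^ 2 + (γ + 1) * α ^ 2) * ∑ i, (z i) ^ 2) ∧
      (Matrix.fromBlocks
        (Matrix.of fun _ _ : Fin 1 => ‖β‖ ^ 2 + γ * α ^ 2)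
        (Matrix.of fun (_ : Fin 1) (j : Fin d) => -α * β j)
        (Matrix.of fun (i : Fin d) (_ : Fin 1) => -α * β i)
        (α ^ 2 • (1 : Matrix (Fin d) (Fin d) ℝ))).PosSemidef ∧
      (0 < γ →
        (Matrix.fromBlocks
          (Matrix.of fun _ _ : Fin 1 => ‖β‖ ^ 2 + γ * α ^ 2)
          (Matrix.of fun (_ : Fin 1) (j : Fin d) => -α * β j)
          (Matrix.of fun (i : Fin d) (_ : Fin 1) => -α * β i)
          (α ^ 2 • (1 : Matrix (Fin d) (Fin d) ℝ))).PosDef) := by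
  set M : Matrix (Fin 1 ⊕ Fin d) (Fin 1 ⊕ Fin d) ℝ := Matrix.fromBlocks
    (Matrix.of fun _ _ : Fin 1 => ‖β‖ ^ 2 + γ * α ^ 2)
    (Matrix.of fun (_ : Fin 1) (j : Fin d) => -α * β j)
    (Matrix.of fun (i : Fin d) (_ : Fin 1) => -α * β i)
    (α ^ 2 • (1 : Matrix (Fin d) (Fin d) ℝ)) with hM
  have hT : 0 < ‖β‖ ^ 2 + (γ + 1) * α ^ 2 := by positivity
  have bounds : ∀ z : Fin 1 ⊕ Fin d → ℝ,
      γ * α ^ 4 / (‖β‖ ^ 2 + (γ + 1) * α ^ 2) * ∑ i, (z i) ^ 2 ≤ z ⬝ᵥ M.mulVec z ∧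
        z ⬝ᵥ M.mulVec z ≤ (‖β‖ ^ 2 + (γ + 1) * α ^ 2) * ∑ i, (z i) ^ 2 := by
    intro z
    rw [hM, dotProduct_fromBlocks_mulVec, Fintype.sum_sum_type, Fin.sum_univ_one,
      div_mul_eq_mul_div, div_le_iff₀ hT]
    have hβ : ‖β‖ ^ 2 = ∑ i, β i ^ 2 := EuclideanSpace.real_norm_sq_eq β
    have cauchy : (∑ i, β i * z (.inr i)) ^ 2 ≤ ‖β‖ ^ 2 * ∑ i, z (.inr i) ^ 2 :=
      hβ ▸ Finset.sum_mul_sq_le_sq_mul_sq _ _ _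
    have square : 0 ≤ ‖β‖ ^ 2 * z (.inl 0) ^ 2
        - 2 * α * z (.inl 0) * (∑ i, β i * z (.inr i)) + α ^ 2 * ∑ i, z (.inr i) ^ 2 := by
      have h : 0 ≤ ∑ i, (β i * z (.inl 0) - α * z (.inr i)) ^ 2 :=
        Finset.sum_nonneg fun i _ => sq_nonneg _
      convert h using 1
      rw [hβ, Finset.sum_mul, Finset.mul_sum, Finset.mul_sum, ← Finset.sum_sub_distrib,
        ← Finset.sum_add_distrib]
      exact Finset.sum_congr rfl fun i _ => by ring
    have hW : 0 ≤ ∑ i, z (.inr i) ^ 2 := Finset.sum_nonneg fun i _ => sq_nonneg _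
    generalize ∑ i, z (.inr i) ^ 2 = W at *
    generalize ∑ i, β i * z (.inr i) = c at *
    generalize ‖β‖ ^ 2 = B at *
    generalize z (.inl 0) = x at *
    constructor
    · linear_combination sq_nonneg ((B + γ * α ^ 2) * x - α * c) + α ^ 2 * square
        + α ^ 2 * cauchy
    · have hγW : 0 ≤ γ * α ^ 2 * W := by positivity
      linear_combination sq_nonneg (α * x + c) + cauchy + hγW
  have hherm : M.IsHermitian := by
    refine Matrix.IsHermitian.fromBlocks ?_ ?_ ?_
    · ext; simp
    · ext; simp
    · ext i j; simp [Matrix.one_apply, eq_comm]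
  refine ⟨bounds, .of_dotProduct_mulVec_nonneg hherm fun z => ?_,
    fun hγ' => .of_dotProduct_mulVec_pos hherm fun z hz => ?_⟩
  · rw [star_trivial]
    exact le_trans (by positivity) (bounds z).1
  · rw [star_trivial]
    refine lt_of_lt_of_le ?_ (bounds z).1
    obtain ⟨i, hi⟩ := Function.ne_iff.mp hz
    have hsum : 0 < ∑ i, z i ^ 2 :=
      Finset.sum_pos' (fun i _ => sq_nonneg _) ⟨i, Finset.mem_univ i, sq_pos_of_ne_zero hi⟩
    positivity
end

section
/- In the bilevel lower-level setting, for every ξ the minimizer η*(ξ) of 𝓛(·, ξ) over H exists and is unique, the map ξ ↦ η*(ξ) is differentiable on ℝ^{d_u}, and its Jacobian is given by ∇η*(ξ) = −V₂ (V₂ᵀ ∇²_{ηη}𝓛(η*(ξ), ξ) V₂)^{−1} V₂ᵀ ∇²_{ηξ}𝓛(η*(ξ), ξ), where V₂ is any matrix whose columns form an orthonormal basis of ker A (in particular V₂ᵀ ∇²_{ηη}𝓛(η*(ξ), ξ) V₂ is invertible). -/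
open Matrix

noncomputable section

/-- The block `∇²_{ηη}𝓛(η,ξ) ∈ ℝ^{d_l×d_l}` of the Hessian of `𝓛`. -/
def hessEtaEta (dl du : ℕ)
    (L : EuclideanSpace ℝ (Fin dl) → EuclideanSpace ℝ (Fin du) → ℝ)
    (η : EuclideanSpace ℝ (Fin dl)) (ξ : EuclideanSpace ℝ (Fin du)) :
    Matrix (Fin dl) (Fin dl) ℝ :=
  Matrix.of fun i k =>
    fderiv ℝ (fun a => gradient (fun b => L b ξ) a) η (EuclideanSpace.single k 1) i

/-- The block `∇²_{ηξ}𝓛(η,ξ) ∈ ℝ^{d_l×d_u}` of the Hessian of `𝓛`. -/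
def hessEtaXi (dl du : ℕ)
    (L : EuclideanSpace ℝ (Fin dl) → EuclideanSpace ℝ (Fin du) → ℝ)
    (η : EuclideanSpace ℝ (Fin dl)) (ξ : EuclideanSpace ℝ (Fin du)) :
    Matrix (Fin dl) (Fin du) ℝ :=
  Matrix.of fun i k =>
    fderiv ℝ (fun ζ => gradient (fun b => L b ζ) η) ξ (EuclideanSpace.single k 1) i

/-- The Jacobian matrix of a map `g : ℝ^{d_u} → ℝ^{d_l}` at `ξ`. -/
def jacMatrix (dl du : ℕ)
    (g : EuclideanSpace ℝ (Fin du) → EuclideanSpace ℝ (Fin dl))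
    (ξ : EuclideanSpace ℝ (Fin du)) : Matrix (Fin dl) (Fin du) ℝ :=
  Matrix.of fun i k => fderiv ℝ g ξ (EuclideanSpace.single k 1) i

open Topology RealInnerProductSpace in
/-- A strongly convex function lies above its tangent paraboloids. -/
lemma StrongConvexOn.add_inner_add_le {E : Type*} [NormedAddCommGroup E] [InnerProductSpace ℝ E]
    [CompleteSpace E] {f : E → ℝ} {μ : ℝ} (hf : StrongConvexOn Set.univ μ f) {x g : E}
    (hg : HasGradientAt f g x) (y : E) :
    f x + ⟪g, y - x⟫ + μ / 2 * ‖y - x‖ ^ 2 ≤ f y := by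
  have hline : HasDerivAt (fun t : ℝ => f (x + t • (y - x))) ⟪g, y - x⟫ 0 :=
    hg.hasFDerivAt.hasLineDerivAt (y - x)
  have hslope := hline.tendsto_slope_zero_right
  have hrhs : Filter.Tendsto (fun t : ℝ => f y - f x - (1 - t) * (μ / 2 * ‖y - x‖ ^ 2)) (𝓝[>] 0)
      (𝓝 (f y - f x - (1 - 0) * (μ / 2 * ‖y - x‖ ^ 2))) :=
    (Continuous.tendsto (by fun_prop) 0).mono_left nhdsWithin_le_nhds
  have key := le_of_tendsto_of_tendsto hslope hrhs (by
    filter_upwards [Ioo_mem_nhdsGT (zero_lt_one' ℝ)] with t ⟨h0, h1⟩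
    have h := hf.2 (Set.mem_univ x) (Set.mem_univ y) (sub_nonneg.2 h1.le) h0.le (by ring)
    have hpt : (1 - t) • x + t • y = x + t • (y - x) := by module
    rw [hpt, norm_sub_rev] at h
    simp only [smul_eq_mul] at h
    simp only [zero_add, zero_smul, add_zero, smul_eq_mul]
    rw [inv_mul_le_iff₀ h0]
    linarith)
  linarith

open RealInnerProductSpace in
lemma StrongConvexOn.mul_sq_norm_sub_le_inner {E : Type*} [NormedAddCommGroup E]
    [InnerProductSpace ℝ E] [CompleteSpace E] {f : E → ℝ} {μ : ℝ}
    (hf : StrongConvexOn Set.univ μ f) {x y gx gy : E}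
    (hx : HasGradientAt f gx x) (hy : HasGradientAt f gy y) :
    μ * ‖x - y‖ ^ 2 ≤ ⟪gx - gy, x - y⟫ := by
  have h1 := hf.add_inner_add_le hx y
  have h2 := hf.add_inner_add_le hy x
  rw [norm_sub_rev, ← neg_sub x y, inner_neg_right] at h1
  rw [inner_sub_left]
  linarith

open Topology RealInnerProductSpace in
/-- The derivative of a strongly monotone map is coercive. -/
lemma HasFDerivAt.mul_sq_norm_le_inner_of_stronglyMonotone {E : Type*} [NormedAddCommGroup E]
    [InnerProductSpace ℝ E] {G : E → E} {μ : ℝ}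
    (hG : ∀ x y, μ * ‖x - y‖ ^ 2 ≤ ⟪G x - G y, x - y⟫) {x : E} {G' : E →L[ℝ] E}
    (hG' : HasFDerivAt G G' x) (v : E) : μ * ‖v‖ ^ 2 ≤ ⟪G' v, v⟫ := by
  have hline : HasDerivAt (fun t : ℝ => G (x + t • v)) (G' v) 0 := hG'.hasLineDerivAt v
  have hslope := hline.tendsto_slope_zero_right.inner (𝕜 := ℝ) (tendsto_const_nhds (x := v))
  refine ge_of_tendsto hslope ?_
  filter_upwards [self_mem_nhdsWithin] with t (ht : 0 < t)
  have h := hG (x + t • v) x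
  simp only [zero_add, zero_smul, add_zero, real_inner_smul_left]
  rw [add_sub_cancel_left, real_inner_smul_right, norm_smul, mul_pow, Real.norm_eq_abs,
    sq_abs] at h
  have h3 : t * (t * (μ * ‖v‖ ^ 2)) ≤ t * ⟪G (x + t • v) - G x, v⟫ := by linarith
  have h4 := le_of_mul_le_mul_left h3 ht
  rw [← div_eq_inv_mul, le_div_iff₀ ht]
  linarith

open RealInnerProductSpace in
lemma StrongConvexOn.exists_isMinOn {E : Type*} [NormedAddCommGroup E] [InnerProductSpace ℝ E]
    [FiniteDimensional ℝ E] {f : E → ℝ} {μ : ℝ} (hμ : 0 < μ)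
    (hf : StrongConvexOn Set.univ μ f) (hd : Differentiable ℝ f) {s : Set E} (hs : IsClosed s)
    (hne : s.Nonempty) : ∃ x ∈ s, IsMinOn f s x := by
  obtain ⟨x₀, hx₀⟩ := hne
  refine hd.continuous.continuousOn.exists_isMinOn' hs hx₀ (Filter.Eventually.filter_mono
    inf_le_left ?_)
  filter_upwards [(isCompact_closedBall x₀ (2 * ‖gradient f x₀‖ / μ)).compl_mem_cocompact] with y hy
  have h := hf.add_inner_add_le (hd x₀).hasGradientAt y
  have hcs := neg_le_of_abs_le (abs_real_inner_le_norm (gradient f x₀) (y - x₀))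
  rw [Set.mem_compl_iff, Metric.mem_closedBall, dist_eq_norm, not_le, div_lt_iff₀ hμ] at hy
  nlinarith [norm_nonneg (y - x₀)]

open RealInnerProductSpace in
lemma HasGradientAt.mem_orthogonal_of_forall_le {E : Type*} [NormedAddCommGroup E]
    [InnerProductSpace ℝ E] [CompleteSpace E] {f : E → ℝ} {x g : E} (hg : HasGradientAt f g x)
    {K : Submodule ℝ E} (hmin : ∀ k ∈ K, f x ≤ f (x + k)) : g ∈ Kᗮ := by
  rw [Submodule.mem_orthogonal']
  intro k hk
  have hline : HasDerivAt (fun t : ℝ => f (x + t • k)) ⟪g, k⟫ 0 :=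
    hg.hasFDerivAt.hasLineDerivAt k
  refine IsLocalMin.hasDerivAt_eq_zero (Filter.Eventually.of_forall fun t => ?_) hline
  simpa using hmin _ (K.smul_mem t hk)

open Topology RealInnerProductSpace in
/-- Differentiability of the solution of a strongly monotone variational equation on a translate
of a subspace, depending on a parameter. -/
lemma hasFDerivAt_of_stronglyMonotone {E X : Type*} [NormedAddCommGroup E]
    [InnerProductSpace ℝ E] [NormedAddCommGroup X] [NormedSpace ℝ X]
    {G : E → X → E} {μ : ℝ} (hμ : 0 < μ)
    (hG : ∀ ξ x y, μ * ‖x - y‖ ^ 2 ≤ ⟪G x ξ - G y ξ, x - y⟫)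
    {K : Submodule ℝ E} {η : X → E} (hηK : ∀ ξ ζ, η ξ - η ζ ∈ K) (hη : ∀ ξ, G (η ξ) ξ ∈ Kᗮ)
    {ξ : X} {G' : E × X →L[ℝ] E}
    (hG' : HasFDerivAt (fun p : E × X => G p.1 p.2) G' (η ξ, ξ))
    {D : X →L[ℝ] E} (hDK : ∀ h, D h ∈ K) (hD : ∀ h, G' (D h, h) ∈ Kᗮ) :
    HasFDerivAt η D ξ := by
  have hl : HasFDerivAt (fun ζ : X => (η ξ + D (ζ - ξ), ζ))
      (D.prod (ContinuousLinearMap.id ℝ X)) ξ := by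
    refine HasFDerivAt.prodMk ?_ (hasFDerivAt_id ξ)
    simpa using (D.hasFDerivAt.comp ξ ((hasFDerivAt_id ξ).sub_const ξ)).const_add (η ξ)
  have hG'' : HasFDerivAt (fun p : E × X => G p.1 p.2) G' (η ξ + D (ξ - ξ), ξ) := by
    simpa using hG'
  have hcomp : HasFDerivAt (fun ζ => G (η ξ + D (ζ - ξ)) ζ)
      (G'.comp (D.prod (ContinuousLinearMap.id ℝ X))) ξ :=
    HasFDerivAt.comp (f := fun ζ : X => (η ξ + D (ζ - ξ), ζ)) ξ hG'' hl
  rw [hasFDerivAt_iff_isLittleO] at hcomp ⊢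
  refine Asymptotics.IsBigO.trans_isLittleO (Asymptotics.IsBigO.of_bound μ⁻¹
    (Filter.Eventually.of_forall fun ζ => ?_)) hcomp
  set u := η ζ - η ξ - D (ζ - ξ) with hu
  have huK : u ∈ K := K.sub_mem (hηK ζ ξ) (hDK _)
  have h := hG ζ (η ζ) (η ξ + D (ζ - ξ))
  rw [← sub_sub, ← hu, inner_sub_left, Submodule.inner_left_of_mem_orthogonal huK (hη ζ)] at h
  have h1 := Submodule.inner_left_of_mem_orthogonal huK (hη ξ)
  have h2 := Submodule.inner_left_of_mem_orthogonal huK (hD (ζ - ξ))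
  set R := G (η ξ + D (ζ - ξ)) ζ - G (η ξ + D (ξ - ξ)) ξ
    - (G'.comp (D.prod (ContinuousLinearMap.id ℝ X))) (ζ - ξ) with hR
  have hRu : ⟪R, u⟫ = ⟪G (η ξ + D (ζ - ξ)) ζ, u⟫ := by
    rw [hR, inner_sub_left, inner_sub_left]
    simp only [sub_self, map_zero, add_zero, ContinuousLinearMap.comp_apply,
      ContinuousLinearMap.prod_apply, ContinuousLinearMap.id_apply, h1, h2, sub_zero]
  have hcs := neg_le_of_abs_le (abs_real_inner_le_norm R u)
  rw [← div_eq_inv_mul, le_div_iff₀ hμ]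
  rcases (norm_nonneg u).eq_or_lt' with h0 | h0
  · rw [h0, zero_mul]; exact norm_nonneg _
  · refine le_of_mul_le_mul_right ?_ h0
    linarith

lemma mulVec_of_apply_single {m n : ℕ}
    (T : EuclideanSpace ℝ (Fin n) →L[ℝ] EuclideanSpace ℝ (Fin m)) (v : EuclideanSpace ℝ (Fin n)) :
    (Matrix.of fun i k => T (EuclideanSpace.single k 1) i) *ᵥ v.ofLp = (T v).ofLp := by
  have hv : v = ∑ k, v k • EuclideanSpace.single k (1 : ℝ) := by
    ext i
    simp [Finset.sum_apply, Pi.single_apply]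
  ext i
  conv_rhs => rw [hv]
  simp [Matrix.mulVec, dotProduct, mul_comm]

/-- The kernel of a matrix has an orthonormal basis, given by the columns of a matrix. -/
lemma exists_orthonormal_columns_span_eq_ker {m n : ℕ} (A : Matrix (Fin m) (Fin n) ℝ) :
    ∃ (r : ℕ) (V : Matrix (Fin n) (Fin r) ℝ), Vᵀ * V = 1 ∧
      Submodule.span ℝ (Set.range fun k : Fin r => (fun i => V i k : Fin n → ℝ)) =
        LinearMap.ker A.mulVecLin := by
  let e := WithLp.linearEquiv 2 ℝ (Fin n → ℝ)
  let K : Submodule ℝ (EuclideanSpace ℝ (Fin n)) := (LinearMap.ker A.mulVecLin).comap e.toLinearMap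
  obtain ⟨d, ⟨b⟩⟩ : ∃ d, Nonempty (OrthonormalBasis (Fin d) ℝ K) :=
    ⟨_, ⟨stdOrthonormalBasis ℝ K⟩⟩
  refine ⟨_, Matrix.of fun i k => (b k : EuclideanSpace ℝ (Fin n)) i, ?_, ?_⟩
  · ext j k
    have h := orthonormal_iff_ite.1 b.orthonormal j k
    rw [Submodule.coe_inner, PiLp.inner_apply] at h
    rw [Matrix.mul_apply, Matrix.one_apply, ← h]
    refine Finset.sum_congr rfl fun i _ => ?_
    rw [RCLike.inner_apply, conj_trivial, mul_comm]
    rfl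
  · have h1 : Submodule.span ℝ (Set.range b) = ⊤ := by
      simpa using b.toBasis.span_eq
    have h2 := congrArg (Submodule.map (e.toLinearMap ∘ₗ K.subtype)) h1
    rw [Submodule.map_span, ← Set.range_comp, Submodule.map_top, LinearMap.range_comp,
      Submodule.range_subtype, Submodule.map_comap_eq_of_surjective e.surjective] at h2
    exact h2

lemma ContDiff.gradient_fst {E X : Type*} [NormedAddCommGroup E] [InnerProductSpace ℝ E]
    [CompleteSpace E] [NormedAddCommGroup X] [NormedSpace ℝ X] {L : E → X → ℝ} {m n : WithTop ℕ∞}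
    (hL : ContDiff ℝ n (fun p : E × X => L p.1 p.2)) (hmn : m + 1 ≤ n) :
    ContDiff ℝ m (fun p : E × X => gradient (fun b => L b p.2) p.1) := by
  have h : ContDiff ℝ m (fun p : E × X => fderiv ℝ (fun b => L b p.2) p.1) :=
    ContDiff.fderiv (f := fun (p : E × X) b => L b p.2)
      (hL.comp (contDiff_snd.prodMk (contDiff_snd.comp contDiff_fst))) contDiff_fst hmn
  exact (InnerProductSpace.toDual ℝ E).symm.contDiff.comp h

section Matrix

variable {n r : ℕ} {H : Matrix (Fin n) (Fin n) ℝ} {V : Matrix (Fin n) (Fin r) ℝ}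

lemma isUnit_transpose_mul_mul_of_pos (hH : ∀ v, v ≠ 0 → 0 < v ⬝ᵥ (H *ᵥ v)) (hV : Vᵀ * V = 1) :
    IsUnit (Vᵀ * H * V) := by
  rw [← Matrix.mulVec_injective_iff_isUnit]
  refine (injective_iff_map_eq_zero (Vᵀ * H * V).mulVecLin).2 fun w hw => ?_
  rw [Matrix.mulVecLin_apply] at hw
  have hquad : (V *ᵥ w) ⬝ᵥ (H *ᵥ (V *ᵥ w)) = 0 := by
    have h := congrArg (w ⬝ᵥ ·) hw
    simp only [dotProduct_zero, ← Matrix.mulVec_mulVec] at h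
    rwa [Matrix.dotProduct_mulVec, Matrix.vecMul_transpose] at h
  have hVw : V *ᵥ w = 0 := by
    by_contra hne
    exact (hH _ hne).ne' hquad
  simpa [hV] using congrArg (Vᵀ *ᵥ ·) hVw

lemma transpose_mul_neg_add_eq_zero {d : ℕ} (M : Matrix (Fin n) (Fin d) ℝ)
    (hu : IsUnit (Vᵀ * H * V)) :
    Vᵀ * (H * -(V * (Vᵀ * H * V)⁻¹ * Vᵀ * M) + M) = 0 := by
  have h : Vᵀ * H * V * (Vᵀ * H * V)⁻¹ = 1 :=
    Matrix.mul_nonsing_inv _ ((Matrix.isUnit_iff_isUnit_det _).1 hu)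
  calc Vᵀ * (H * -(V * (Vᵀ * H * V)⁻¹ * Vᵀ * M) + M)
      = -((Vᵀ * H * V * (Vᵀ * H * V)⁻¹) * (Vᵀ * M)) + Vᵀ * M := by
        simp only [Matrix.mul_add, Matrix.mul_neg, Matrix.mul_assoc]
    _ = 0 := by rw [h, Matrix.one_mul, neg_add_cancel]

lemma mem_span_range_columns_iff {x : Fin n → ℝ} :
    x ∈ Submodule.span ℝ (Set.range fun k : Fin r => (fun i => V i k : Fin n → ℝ)) ↔
      ∃ w, V *ᵥ w = x := by
  have h : (fun k : Fin r => (fun i => V i k : Fin n → ℝ)) = V.col := rfl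
  rw [h, ← Matrix.range_mulVecLin, LinearMap.mem_range]
  rfl

end Matrix

/-- **Regularity of the lower-level optimizer.**
In the bilevel lower-level setting (`𝓛` twice continuously differentiable,
`η ↦ 𝓛(η,ξ)` being `μ_l`-strongly convex for each `ξ`, nonempty affine constraint set
`H = {η : Aη = c}`), for every `ξ` the minimizer `η*(ξ)` of `𝓛(·,ξ)` over `H` exists and
is unique, `ξ ↦ η*(ξ)` is differentiable, and for any `V₂` whose columns form an
orthonormal basis of `ker A`, the matrix `V₂ᵀ∇²_{ηη}𝓛(η*(ξ),ξ)V₂` is invertible and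
`∇η*(ξ) = −V₂(V₂ᵀ∇²_{ηη}𝓛(η*(ξ),ξ)V₂)⁻¹V₂ᵀ∇²_{ηξ}𝓛(η*(ξ),ξ)`. -/
theorem stmt9 (dl du dc : ℕ) (μl : ℝ) (hμl : 0 < μl)
    (L : EuclideanSpace ℝ (Fin dl) → EuclideanSpace ℝ (Fin du) → ℝ)
    (hL : ContDiff ℝ 2 (fun p : WithLp 2 (EuclideanSpace ℝ (Fin dl) × EuclideanSpace ℝ (Fin du)) =>
      L (WithLp.equiv 2 (EuclideanSpace ℝ (Fin dl) × EuclideanSpace ℝ (Fin du)) p).1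
        (WithLp.equiv 2 (EuclideanSpace ℝ (Fin dl) × EuclideanSpace ℝ (Fin du)) p).2))
    (hsc : ∀ ξ : EuclideanSpace ℝ (Fin du),
      StrongConvexOn Set.univ μl (fun η : EuclideanSpace ℝ (Fin dl) => L η ξ))
    (A : Matrix (Fin dc) (Fin dl) ℝ) (cv : Fin dc → ℝ)
    (hHne : ∃ η : EuclideanSpace ℝ (Fin dl), A.mulVec (fun i => η i) = cv) :
    ∃ ηstar : EuclideanSpace ℝ (Fin du) → EuclideanSpace ℝ (Fin dl),
      (∀ ξ, A.mulVec (fun i => ηstar ξ i) = cv ∧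
        ∀ η : EuclideanSpace ℝ (Fin dl),
          A.mulVec (fun i => η i) = cv → L (ηstar ξ) ξ ≤ L η ξ) ∧
      (∀ ξ (η : EuclideanSpace ℝ (Fin dl)),
        A.mulVec (fun i => η i) = cv →
        (∀ η' : EuclideanSpace ℝ (Fin dl),
          A.mulVec (fun i => η' i) = cv → L η ξ ≤ L η' ξ) →
        η = ηstar ξ) ∧
      Differentiable ℝ ηstar ∧
      (∀ (r : ℕ) (V₂ : Matrix (Fin dl) (Fin r) ℝ),
        V₂ᵀ * V₂ = 1 →
        Submodule.span ℝ (Set.range fun k : Fin r => (fun i => V₂ i k : Fin dl → ℝ)) =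
          LinearMap.ker A.mulVecLin →
        ∀ ξ, IsUnit (V₂ᵀ * hessEtaEta dl du L (ηstar ξ) ξ * V₂) ∧
          jacMatrix dl du ηstar ξ =
            -(V₂ * (V₂ᵀ * hessEtaEta dl du L (ηstar ξ) ξ * V₂)⁻¹ * V₂ᵀ *
                hessEtaXi dl du L (ηstar ξ) ξ)) := by
  let E := EuclideanSpace ℝ (Fin dl)
  let X := EuclideanSpace ℝ (Fin du)
  have hL2 : ContDiff ℝ 2 (fun p : E × X => L p.1 p.2) :=
    hL.comp (WithLp.prodContinuousLinearEquiv 2 ℝ E X).symm.contDiff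
  have hLd : ∀ ξ, Differentiable ℝ (fun η => L η ξ) := fun ξ =>
    (hL2.comp (contDiff_id.prodMk contDiff_const)).differentiable (by norm_num)
  have hgrad : ∀ ξ η, HasGradientAt (fun b => L b ξ) (gradient (fun b => L b ξ) η) η :=
    fun ξ η => (hLd ξ η).hasGradientAt
  have hmono : ∀ (ξ : X) (x y : E), μl * ‖x - y‖ ^ 2 ≤
      inner ℝ (gradient (fun b => L b ξ) x - gradient (fun b => L b ξ) y) (x - y) :=
    fun ξ x y => (hsc ξ).mul_sq_norm_sub_le_inner (hgrad ξ x) (hgrad ξ y)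
  let K : Submodule ℝ E :=
    (LinearMap.ker A.mulVecLin).comap (WithLp.linearEquiv 2 ℝ (Fin dl → ℝ)).toLinearMap
  have hK : ∀ k : E, k ∈ K ↔ A *ᵥ k.ofLp = 0 := fun k => Iff.rfl
  have hclosed : IsClosed {η : E | A *ᵥ η.ofLp = cv} :=
    isClosed_eq (by fun_prop) continuous_const
  choose ηs hηs hmin using fun ξ =>
    (hsc ξ).exists_isMinOn hμl (hLd ξ) hclosed hHne
  have hsub : ∀ x y : E, A *ᵥ x.ofLp = cv → A *ᵥ y.ofLp = cv → x - y ∈ K := fun x y hx hy => by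
    rw [hK, WithLp.ofLp_sub, Matrix.mulVec_sub, hx, hy, sub_self]
  have hopt : ∀ ξ, gradient (fun b => L b ξ) (ηs ξ) ∈ Kᗮ := fun ξ => by
    refine (hgrad ξ (ηs ξ)).mem_orthogonal_of_forall_le fun k hk => hmin ξ ?_
    rw [Set.mem_ofPred_eq, WithLp.ofLp_add, Matrix.mulVec_add, (hK k).1 hk, add_zero]
    exact hηs ξ
  have hcore : ∀ (r : ℕ) (V : Matrix (Fin dl) (Fin r) ℝ), Vᵀ * V = 1 →
      Submodule.span ℝ (Set.range fun k : Fin r => (fun i => V i k : Fin dl → ℝ)) =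
        LinearMap.ker A.mulVecLin → ∀ ξ,
      IsUnit (Vᵀ * hessEtaEta dl du L (ηs ξ) ξ * V) ∧
      HasFDerivAt ηs (Matrix.toLpLin 2 2
        (-(V * (Vᵀ * hessEtaEta dl du L (ηs ξ) ξ * V)⁻¹ * Vᵀ *
          hessEtaXi dl du L (ηs ξ) ξ))).toContinuousLinearMap ξ := by
    intro r V hV hspan ξ
    have hKV : ∀ k : E, k ∈ K ↔ ∃ w, V *ᵥ w = k.ofLp := fun k => by
      rw [← mem_span_range_columns_iff, hspan]; rfl
    obtain ⟨G', hG'⟩ : ∃ G', HasFDerivAt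
        (fun p : E × X => gradient (fun b => L b p.2) p.1) G' (ηs ξ, ξ) :=
      ((hL2.gradient_fst (m := 1) (by norm_num)).differentiable (by norm_num)) _
    have hGη : HasFDerivAt (fun a => gradient (fun b => L b ξ) a)
        (G'.comp (ContinuousLinearMap.inl ℝ E X)) (ηs ξ) :=
      HasFDerivAt.comp (f := fun a : E => (a, ξ)) _ hG' (hasFDerivAt_prodMk_left _ _)
    have hGξ : HasFDerivAt (fun ζ => gradient (fun b => L b ζ) (ηs ξ))
        (G'.comp (ContinuousLinearMap.inr ℝ E X)) ξ :=
      HasFDerivAt.comp (f := fun ζ : X => (ηs ξ, ζ)) _ hG' (hasFDerivAt_prodMk_right _ _)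
    have hH : ∀ v : E, hessEtaEta dl du L (ηs ξ) ξ *ᵥ v.ofLp = (G' (v, 0)).ofLp := fun v => by
      rw [hessEtaEta, mulVec_of_apply_single, hGη.fderiv]; rfl
    have hM : ∀ h : X, hessEtaXi dl du L (ηs ξ) ξ *ᵥ h.ofLp = (G' (0, h)).ofLp := fun h => by
      rw [hessEtaXi, mulVec_of_apply_single, hGξ.fderiv]; rfl
    have hu : IsUnit (Vᵀ * hessEtaEta dl du L (ηs ξ) ξ * V) := by
      refine isUnit_transpose_mul_mul_of_pos (fun v hv => ?_) hV
      have h := hGη.mul_sq_norm_le_inner_of_stronglyMonotone (hmono ξ) (WithLp.toLp 2 v)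
      have hv' : 0 < ‖WithLp.toLp 2 v‖ := by simpa using hv
      rw [EuclideanSpace.inner_eq_star_dotProduct] at h
      have h' := hH (WithLp.toLp 2 v)
      simp only at h'
      rw [h']
      exact (by positivity : 0 < μl * ‖WithLp.toLp 2 v‖ ^ 2).trans_le h
    refine ⟨hu, hasFDerivAt_of_stronglyMonotone
      (G := fun a ζ => gradient (fun b => L b ζ) a) (K := K) hμl hmono
      (fun ζ ζ' => hsub _ _ (hηs ζ) (hηs ζ')) hopt hG' (fun h => ?_) (fun h => ?_)⟩
    · rw [hKV]
      refine ⟨-((Vᵀ * hessEtaEta dl du L (ηs ξ) ξ * V)⁻¹ *ᵥ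
        (Vᵀ *ᵥ (hessEtaXi dl du L (ηs ξ) ξ *ᵥ h.ofLp))), ?_⟩
      simp [Matrix.toLpLin_apply, Matrix.mulVec_neg, Matrix.mul_assoc]
    · rw [Submodule.mem_orthogonal']
      intro k hk
      obtain ⟨w, hw⟩ := (hKV k).1 hk
      set N := -(V * (Vᵀ * hessEtaEta dl du L (ηs ξ) ξ * V)⁻¹ * Vᵀ * hessEtaXi dl du L (ηs ξ) ξ)
        with hN
      have hsplit : (G' ((Matrix.toLpLin 2 2 N).toContinuousLinearMap h, h)).ofLp =
          (hessEtaEta dl du L (ηs ξ) ξ * N + hessEtaXi dl du L (ηs ξ) ξ) *ᵥ h.ofLp := by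
        rw [Matrix.add_mulVec, ← Matrix.mulVec_mulVec, hM]
        have h1 := hH (Matrix.toLpLin 2 2 N h)
        rw [Matrix.ofLp_toLpLin, Matrix.toLin'_apply] at h1
        rw [h1, ← WithLp.ofLp_add, ← map_add, Prod.mk_add_mk, add_zero, zero_add]
        rfl
      rw [real_inner_comm, EuclideanSpace.inner_eq_star_dotProduct, hsplit, ← hw, star_trivial,
        dotProduct_comm, ← Matrix.vecMul_transpose, ← Matrix.dotProduct_mulVec,
        Matrix.mulVec_mulVec, hN, transpose_mul_neg_add_eq_zero _ hu, Matrix.zero_mulVec,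
        dotProduct_zero]
  refine ⟨ηs, fun ξ => ⟨hηs ξ, fun η hη => hmin ξ hη⟩, fun ξ η hη hle => ?_, ?_, ?_⟩
  · have h := (hsc ξ).add_inner_add_le (hgrad ξ (ηs ξ)) η
    rw [Submodule.inner_left_of_mem_orthogonal (hsub _ _ hη (hηs ξ)) (hopt ξ)] at h
    have hle' := hle _ (hηs ξ)
    have hsq : ‖η - ηs ξ‖ ^ 2 ≤ 0 := by
      by_contra! hpos
      have := mul_pos (half_pos hμl) hpos
      linarith
    exact sub_eq_zero.1 (norm_eq_zero.1 (pow_eq_zero_iff two_ne_zero |>.1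
      (hsq.antisymm (sq_nonneg _))))
  · obtain ⟨r, V, hV, hspan⟩ := exists_orthonormal_columns_span_eq_ker A
    exact fun ξ => (hcore r V hV hspan ξ).2.differentiableAt
  · intro r V hV hspan ξ
    refine ⟨(hcore r V hV hspan ξ).1, ?_⟩
    rw [jacMatrix, (hcore r V hV hspan ξ).2.fderiv]
    generalize -(V * (Vᵀ * hessEtaEta dl du L (ηs ξ) ξ * V)⁻¹ * Vᵀ *
      hessEtaXi dl du L (ηs ξ) ξ) = N
    ext i k
    simp [Matrix.toLpLin_apply]

end
end

section
/- In the bilevel lower-level setting, assume additionally that ∇𝓛 is ℓ_{l,1}-Lipschitz and the full Hessian ∇²𝓛 is ℓ_{l,2}-Lipschitz (in (η, ξ), with respect to the operator norm). Then the Jacobian of the lower-level solution map is Lipschitz continuous with constant L_{ηξ} := ℓ_{l,2}(1 + ℓ_{l,1}/μ_l)²/μ_l: for all ξ₁, ξ₂, ‖∇η*(ξ₁) − ∇η*(ξ₂)‖ ≤ L_{ηξ}·‖ξ₁ − ξ₂‖, where ‖·‖ on matrices is the operator norm. -/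
open Matrix

open WithLp RealInnerProductSpace

section ProdL2

variable {E F : Type*} [NormedAddCommGroup E] [NormedAddCommGroup F]

lemma toLp_add_smul_fst [NormedSpace ℝ E] [NormedSpace ℝ F] (η v : E) (ξ : F) (t : ℝ) :
    toLp 2 (η, ξ) + t • toLp 2 (v, (0 : F)) = toLp 2 (η + t • v, ξ) := by
  rw [← toLp_smul, ← toLp_add]
  simp

lemma norm_toLp_two_le (x : E) (y : F) : ‖toLp 2 (x, y)‖ ≤ ‖x‖ + ‖y‖ := by
  have h : toLp 2 (x, y) = toLp 2 (x, (0 : F)) + toLp 2 ((0 : E), y) := by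
    rw [← toLp_add]
    simp
  rw [h]
  refine (norm_add_le _ _).trans_eq ?_
  rw [norm_toLp_fst, norm_toLp_snd]

lemma norm_toLp_two_le_of_norm_le {c : ℝ} {x : E} {y : F} (h : ‖x‖ ≤ c * ‖y‖) :
    ‖toLp 2 (x, y)‖ ≤ (1 + c) * ‖y‖ := by
  linarith [norm_toLp_two_le x y]

end ProdL2

section ParametricVariational

variable {E F : Type*} [NormedAddCommGroup E] [InnerProductSpace ℝ E]
  [NormedAddCommGroup F] [InnerProductSpace ℝ F]

/-- A bounded operator on `E × F` that is coercive on a finite-dimensional subspace `K` of the first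
factor admits a linear solution map `F → K` of the associated Galerkin problem. -/
lemma exists_galerkin_solution [CompleteSpace E] [CompleteSpace F] {K : Submodule ℝ E}
    [FiniteDimensional ℝ K] {μ : ℝ} (hμ : 0 < μ)
    {D : WithLp 2 (E × F) →L[ℝ] WithLp 2 (E × F)}
    (hD : ∀ k ∈ K, μ * ‖k‖ ^ 2 ≤ ⟪D (toLp 2 (k, 0)), toLp 2 (k, 0)⟫) :
    ∃ J : F →L[ℝ] E, (∀ w, J w ∈ K) ∧
      ∀ w, ∀ k ∈ K, ⟪D (toLp 2 (J w, w)), toLp 2 (k, 0)⟫ = 0 := by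
  let e := (prodContinuousLinearEquiv 2 ℝ E F).symm.toContinuousLinearMap
  let ι : K →L[ℝ] WithLp 2 (E × F) := e ∘L (ContinuousLinearMap.inl ℝ E F) ∘L K.subtypeL
  let κ : F →L[ℝ] WithLp 2 (E × F) := e ∘L (ContinuousLinearMap.inr ℝ E F)
  have hι : ∀ k : K, ι k = toLp 2 ((k : E), (0 : F)) := fun k => rfl
  have hκ : ∀ w : F, κ w = toLp 2 ((0 : E), w) := fun w => rfl
  let B : K →ₗ[ℝ] K := (ContinuousLinearMap.adjoint ι ∘L D ∘L ι).toLinearMap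
  have hB : ∀ k l : K, ⟪B k, l⟫ = ⟪D (ι k), ι l⟫ := fun k l =>
    ContinuousLinearMap.adjoint_inner_left ι l (D (ι k))
  have hinj : Function.Injective B := by
    refine (injective_iff_map_eq_zero B).2 fun k hk => ?_
    have h1 := hD k k.2
    rw [← hι, ← hB, hk, inner_zero_left] at h1
    have h2 : ‖(k : E)‖ ^ 2 = 0 := le_antisymm (by nlinarith) (sq_nonneg _)
    simpa using h2
  let R := LinearEquiv.ofInjectiveEndo B hinj
  have hR : ∀ x, B (R.symm x) = x := fun x => R.apply_symm_apply x
  let C : F →L[ℝ] K := ContinuousLinearMap.adjoint ι ∘L D ∘L κ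
  let J₀ : F →L[ℝ] K := -(LinearMap.toContinuousLinearMap R.symm.toLinearMap ∘L C)
  have hJ₀ : ∀ w, B (J₀ w) = -C w := fun w => by
    have : J₀ w = -(R.symm (C w)) := rfl
    rw [this, map_neg, hR]
  refine ⟨K.subtypeL ∘L J₀, fun w => (J₀ w).2, fun w k hk => ?_⟩
  have hsplit : toLp 2 (((K.subtypeL ∘L J₀) w : E), w) = ι (J₀ w) + κ w := by
    rw [hι, hκ, ← toLp_add]
    simp
  have hC : ⟪C w, (⟨k, hk⟩ : K)⟫ = ⟪D (κ w), ι ⟨k, hk⟩⟫ :=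
    ContinuousLinearMap.adjoint_inner_left ι _ _
  have h := hB (J₀ w) ⟨k, hk⟩
  rw [hJ₀, inner_neg_left, hC] at h
  rw [hsplit, map_add, inner_add_left, ← hι ⟨k, hk⟩]
  linarith

/-- The derivative of a partially strongly monotone map is partially coercive. -/
lemma coercive_of_strongly_monotone {μ : ℝ} {G : WithLp 2 (E × F) → WithLp 2 (E × F)}
    (hG : Differentiable ℝ G)
    (hmono : ∀ (η η' : E) (ξ : F), μ * ‖η - η'‖ ^ 2 ≤
      ⟪G (toLp 2 (η, ξ)) - G (toLp 2 (η', ξ)), toLp 2 (η - η', 0)⟫)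
    (p : WithLp 2 (E × F)) (k : E) :
    μ * ‖k‖ ^ 2 ≤ ⟪fderiv ℝ G p (toLp 2 (k, 0)), toLp 2 (k, 0)⟫ := by
  set v : WithLp 2 (E × F) := toLp 2 (k, 0) with hv
  have hpv : ∀ t : ℝ, p + t • v = toLp 2 (p.fst + t • k, p.snd) := fun t =>
    toLp_add_smul_fst p.fst k p.snd t
  have hline : HasDerivAt (fun t : ℝ => p + t • v) v 0 := by
    simpa using ((hasDerivAt_id (0 : ℝ)).smul_const v).const_add p
  have hGd : HasFDerivAt G (fderiv ℝ G p) (p + (0 : ℝ) • v) := by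
    simpa using (hG p).hasFDerivAt
  have hd : HasDerivAt (fun t : ℝ => ⟪G (p + t • v), v⟫ - t * (μ * ‖k‖ ^ 2))
      (⟪fderiv ℝ G p v, v⟫ - μ * ‖k‖ ^ 2) 0 := by
    have h1 := (hGd.comp_hasDerivAt (0 : ℝ) hline).inner ℝ (hasDerivAt_const (0 : ℝ) v)
    have h2 := (hasDerivAt_id (0 : ℝ)).mul_const (μ * ‖k‖ ^ 2)
    refine (h1.sub h2).congr_deriv ?_
    rw [inner_zero_right, zero_add, one_mul]
  have hm : Monotone (fun t : ℝ => ⟪G (p + t • v), v⟫ - t * (μ * ‖k‖ ^ 2)) := by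
    intro s t hst
    rcases hst.eq_or_lt with rfl | hst
    · exact le_rfl
    have h := hmono (p.fst + t • k) (p.fst + s • k) p.snd
    have hdir : p.fst + t • k - (p.fst + s • k) = (t - s) • k := by module
    have hlp : toLp 2 ((t - s) • k, (0 : F)) = (t - s) • v := by
      rw [hv, ← toLp_smul, Prod.smul_mk, smul_zero]
    rw [← hpv, ← hpv, hdir, hlp, norm_smul, inner_smul_right, inner_sub_left, mul_pow,
      Real.norm_eq_abs, sq_abs] at h
    have hpos : 0 < t - s := sub_pos.2 hst
    have h' : (t - s) * (μ * ‖k‖ ^ 2) ≤ ⟪G (p + t • v), v⟫ - ⟪G (p + s • v), v⟫ := by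
      refine le_of_mul_le_mul_left ?_ hpos
      linarith
    change ⟪G (p + s • v), v⟫ - s * (μ * ‖k‖ ^ 2) ≤ ⟪G (p + t • v), v⟫ - t * (μ * ‖k‖ ^ 2)
    linarith
  have := hm.deriv_nonneg (x := 0)
  rw [hd.deriv] at this
  linarith

variable {K : Submodule ℝ E} {μ ℓ₁ : ℝ} {G : WithLp 2 (E × F) → WithLp 2 (E × F)} {σ : F → E}

/-- Solutions of a strongly monotone parametric variational equation are Lipschitz in the
parameter. -/
lemma solution_norm_sub_le (hμ : 0 < μ)
    (hlip : ∀ p q, ‖G p - G q‖ ≤ ℓ₁ * ‖p - q‖)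
    (hmono : ∀ (η η' : E) (ξ : F), μ * ‖η - η'‖ ^ 2 ≤
      ⟪G (toLp 2 (η, ξ)) - G (toLp 2 (η', ξ)), toLp 2 (η - η', 0)⟫)
    (hσ : ∀ ξ ξ', σ ξ - σ ξ' ∈ K)
    (hcrit : ∀ ξ, ∀ k ∈ K, ⟪G (toLp 2 (σ ξ, ξ)), toLp 2 (k, 0)⟫ = 0) (ξ ξ' : F) :
    ‖σ ξ - σ ξ'‖ ≤ ℓ₁ / μ * ‖ξ - ξ'‖ := by
  have h1 := hmono (σ ξ) (σ ξ') ξ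
  have h2 := hcrit ξ _ (hσ ξ ξ')
  have h3 := hcrit ξ' _ (hσ ξ ξ')
  have h4 : ⟪G (toLp 2 (σ ξ, ξ)) - G (toLp 2 (σ ξ', ξ)), toLp 2 (σ ξ - σ ξ', (0 : F))⟫ =
      ⟪G (toLp 2 (σ ξ', ξ')) - G (toLp 2 (σ ξ', ξ)), toLp 2 (σ ξ - σ ξ', (0 : F))⟫ := by
    rw [inner_sub_left, inner_sub_left, h2, h3]
  have h5 := real_inner_le_norm (G (toLp 2 (σ ξ', ξ')) - G (toLp 2 (σ ξ', ξ)))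
    (toLp 2 (σ ξ - σ ξ', (0 : F)))
  have h6 := hlip (toLp 2 (σ ξ', ξ')) (toLp 2 (σ ξ', ξ))
  have hsub : toLp 2 (σ ξ', ξ') - toLp 2 (σ ξ', ξ) = toLp 2 ((0 : E), ξ' - ξ) := by
    rw [← toLp_sub, Prod.mk_sub_mk, sub_self]
  rw [hsub, norm_toLp_snd, norm_sub_rev ξ'] at h6
  rw [norm_toLp_fst] at h5
  rw [h4] at h1
  have h7 : ‖σ ξ - σ ξ'‖ * (μ * ‖σ ξ - σ ξ'‖) ≤ ‖σ ξ - σ ξ'‖ * (ℓ₁ * ‖ξ - ξ'‖) := by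
    nlinarith [mul_le_mul_of_nonneg_right h6 (norm_nonneg (σ ξ - σ ξ'))]
  rw [div_mul_eq_mul_div, le_div_iff₀ hμ, mul_comm]
  rcases (norm_nonneg (σ ξ - σ ξ')).eq_or_lt with h0 | h0
  · rw [← h0, mul_zero]
    exact (norm_nonneg _).trans h6
  · exact le_of_mul_le_mul_left h7 h0

/-- The linear solution map of the linearized variational equation is the derivative of the solution
map. -/
lemma hasFDerivAt_solution (hμ : 0 < μ) (hG : Differentiable ℝ G)
    (hlip : ∀ p q, ‖G p - G q‖ ≤ ℓ₁ * ‖p - q‖)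
    (hmono : ∀ (η η' : E) (ξ : F), μ * ‖η - η'‖ ^ 2 ≤
      ⟪G (toLp 2 (η, ξ)) - G (toLp 2 (η', ξ)), toLp 2 (η - η', 0)⟫)
    (hσ : ∀ ξ ξ', σ ξ - σ ξ' ∈ K)
    (hcrit : ∀ ξ, ∀ k ∈ K, ⟪G (toLp 2 (σ ξ, ξ)), toLp 2 (k, 0)⟫ = 0)
    {ξ : F} {J : F →L[ℝ] E} (hJK : ∀ w, J w ∈ K)
    (hJ : ∀ w, ∀ k ∈ K, ⟪fderiv ℝ G (toLp 2 (σ ξ, ξ)) (toLp 2 (J w, w)), toLp 2 (k, 0)⟫ = 0) :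
    HasFDerivAt σ J ξ := by
  have hσlip := solution_norm_sub_le hμ hlip hmono hσ hcrit
  set p : F → WithLp 2 (E × F) := fun ξ' => toLp 2 (σ ξ', ξ')
  have hpsub : ∀ ξ', p ξ' - p ξ = toLp 2 (σ ξ' - σ ξ, ξ' - ξ) := fun ξ' => by
    simp only [p]
    rw [← toLp_sub, Prod.mk_sub_mk]
  have hplip : ∀ ξ', ‖p ξ' - p ξ‖ ≤ (1 + ℓ₁ / μ) * ‖ξ' - ξ‖ := fun ξ' => by
    rw [hpsub]
    exact norm_toLp_two_le_of_norm_le (hσlip ξ' ξ)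
  have hpO : (fun ξ' => p ξ' - p ξ) =O[nhds ξ] fun ξ' => ξ' - ξ :=
    Asymptotics.IsBigO.of_bound (1 + ℓ₁ / μ) (Filter.Eventually.of_forall hplip)
  have hpt : Filter.Tendsto p (nhds ξ) (nhds (p ξ)) := by
    rw [tendsto_iff_norm_sub_tendsto_zero]
    refine squeeze_zero (fun _ => norm_nonneg _) hplip ?_
    have : Continuous fun ξ' : F => (1 + ℓ₁ / μ) * ‖ξ' - ξ‖ := by fun_prop
    simpa using this.tendsto ξ
  have ho : (fun ξ' => G (p ξ') - G (p ξ) - fderiv ℝ G (p ξ) (p ξ' - p ξ)) =o[nhds ξ]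
      fun ξ' => ξ' - ξ :=
    ((hG (p ξ)).hasFDerivAt.isLittleO.comp_tendsto hpt).trans_isBigO hpO
  refine HasFDerivAt.of_isLittleO (Asymptotics.IsBigO.trans_isLittleO ?_ ho)
  refine Asymptotics.IsBigO.of_bound μ⁻¹ (Filter.Eventually.of_forall fun ξ' => ?_)
  set e : E := σ ξ' - σ ξ - J (ξ' - ξ) with he
  set r := G (p ξ') - G (p ξ) - fderiv ℝ G (p ξ) (p ξ' - p ξ) with hr
  have heK : e ∈ K := K.sub_mem (hσ _ _) (hJK _)
  have hsplit : toLp 2 (e, (0 : F)) = (p ξ' - p ξ) - toLp 2 (J (ξ' - ξ), ξ' - ξ) := by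
    rw [hpsub, ← toLp_sub, Prod.mk_sub_mk, sub_self]
  have hco := coercive_of_strongly_monotone hG hmono (p ξ) e
  have hDe : fderiv ℝ G (p ξ) (toLp 2 (e, (0 : F))) =
      G (p ξ') - G (p ξ) - r - fderiv ℝ G (p ξ) (toLp 2 (J (ξ' - ξ), ξ' - ξ)) := by
    rw [hsplit, map_sub, hr]
    abel
  rw [hDe, inner_sub_left, inner_sub_left, inner_sub_left, hcrit ξ' e heK, hcrit ξ e heK,
    hJ _ e heK] at hco
  have hcs := real_inner_le_norm (-r) (toLp 2 (e, (0 : F)))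
  rw [inner_neg_left, norm_neg, norm_toLp_fst] at hcs
  rw [inv_mul_eq_div, le_div_iff₀ hμ, mul_comm]
  rcases (norm_nonneg e).eq_or_lt with h0 | h0
  · rw [← h0, mul_zero]
    exact norm_nonneg _
  · refine le_of_mul_le_mul_left ?_ h0
    nlinarith

/-- The solution map of a strongly monotone parametric variational equation with Lipschitz derivative
is differentiable with Lipschitz derivative. -/
theorem solution_differentiable_and_fderiv_lipschitz [CompleteSpace E] [CompleteSpace F]
    [FiniteDimensional ℝ K] {ℓ₂ : ℝ} (hμ : 0 < μ) (hℓ₁ : 0 ≤ ℓ₁) (hℓ₂ : 0 ≤ ℓ₂)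
    (hG : Differentiable ℝ G)
    (hlip : ∀ p q, ‖G p - G q‖ ≤ ℓ₁ * ‖p - q‖)
    (hlip' : ∀ p q, ‖fderiv ℝ G p - fderiv ℝ G q‖ ≤ ℓ₂ * ‖p - q‖)
    (hmono : ∀ (η η' : E) (ξ : F), μ * ‖η - η'‖ ^ 2 ≤
      ⟪G (toLp 2 (η, ξ)) - G (toLp 2 (η', ξ)), toLp 2 (η - η', 0)⟫)
    (hσ : ∀ ξ ξ', σ ξ - σ ξ' ∈ K)
    (hcrit : ∀ ξ, ∀ k ∈ K, ⟪G (toLp 2 (σ ξ, ξ)), toLp 2 (k, 0)⟫ = 0) :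
    Differentiable ℝ σ ∧ ∀ ξ₁ ξ₂ : F,
      ‖fderiv ℝ σ ξ₁ - fderiv ℝ σ ξ₂‖ ≤ ℓ₂ * (1 + ℓ₁ / μ) ^ 2 / μ * ‖ξ₁ - ξ₂‖ := by
  have hσlip := solution_norm_sub_le hμ hlip hmono hσ hcrit
  have hco := coercive_of_strongly_monotone hG hmono
  have hex := fun ξ => exists_galerkin_solution (K := K) hμ fun k _ => hco (toLp 2 (σ ξ, ξ)) k
  choose J hJK hJ using hex
  have hder : ∀ ξ, HasFDerivAt σ (J ξ) ξ := fun ξ =>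
    hasFDerivAt_solution hμ hG hlip hmono hσ hcrit (hJK ξ) (hJ ξ)
  have hc : 0 ≤ ℓ₁ / μ := div_nonneg hℓ₁ hμ.le
  have hJnorm : ∀ ξ w, ‖J ξ w‖ ≤ ℓ₁ / μ * ‖w‖ := fun ξ w =>
    (J ξ).le_of_opNorm_le
      ((hder ξ).le_of_lip' hc (Filter.Eventually.of_forall fun ξ' => hσlip ξ' ξ)) w
  refine ⟨fun ξ => (hder ξ).differentiableAt, fun ξ₁ ξ₂ => ?_⟩
  rw [(hder ξ₁).fderiv, (hder ξ₂).fderiv]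
  refine ContinuousLinearMap.opNorm_le_bound _ (by positivity) fun w => ?_
  set D₁ := fderiv ℝ G (toLp 2 (σ ξ₁, ξ₁))
  set D₂ := fderiv ℝ G (toLp 2 (σ ξ₂, ξ₂))
  set u : E := (J ξ₁ - J ξ₂) w with hu
  have huK : u ∈ K := K.sub_mem (hJK _ _) (hJK _ _)
  have hsplit : toLp 2 (u, (0 : F)) = toLp 2 (J ξ₁ w, w) - toLp 2 (J ξ₂ w, w) := by
    rw [← toLp_sub, Prod.mk_sub_mk, sub_self, hu, _root_.sub_apply]
  have hDu : D₁ (toLp 2 (u, (0 : F))) = D₁ (toLp 2 (J ξ₁ w, w)) - D₂ (toLp 2 (J ξ₂ w, w))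
      - (D₁ - D₂) (toLp 2 (J ξ₂ w, w)) := by
    rw [hsplit, map_sub, _root_.sub_apply]
    abel
  have h1 := hco (toLp 2 (σ ξ₁, ξ₁)) u
  rw [hDu, inner_sub_left, inner_sub_left, hJ ξ₁ w u huK, hJ ξ₂ w u huK] at h1
  have hcs := real_inner_le_norm (-((D₁ - D₂) (toLp 2 (J ξ₂ w, w)))) (toLp 2 (u, (0 : F)))
  rw [inner_neg_left, norm_neg, norm_toLp_fst] at hcs
  have hpq : ‖toLp 2 (σ ξ₁, ξ₁) - toLp 2 (σ ξ₂, ξ₂)‖ ≤ (1 + ℓ₁ / μ) * ‖ξ₁ - ξ₂‖ := by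
    rw [← toLp_sub, Prod.mk_sub_mk]
    exact norm_toLp_two_le_of_norm_le (hσlip ξ₁ ξ₂)
  have hDD : ‖D₁ - D₂‖ ≤ ℓ₂ * ((1 + ℓ₁ / μ) * ‖ξ₁ - ξ₂‖) :=
    (hlip' _ _).trans (mul_le_mul_of_nonneg_left hpq hℓ₂)
  have hbd : ‖(D₁ - D₂) (toLp 2 (J ξ₂ w, w))‖ ≤
      ℓ₂ * ((1 + ℓ₁ / μ) * ‖ξ₁ - ξ₂‖) * ((1 + ℓ₁ / μ) * ‖w‖) :=
    (D₁ - D₂).le_of_opNorm_le_of_le hDD (norm_toLp_two_le_of_norm_le (hJnorm ξ₂ w))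
  have hrw : ℓ₂ * (1 + ℓ₁ / μ) ^ 2 / μ * ‖ξ₁ - ξ₂‖ * ‖w‖ =
      ℓ₂ * ((1 + ℓ₁ / μ) * ‖ξ₁ - ξ₂‖) * ((1 + ℓ₁ / μ) * ‖w‖) / μ := by ring
  rw [hrw, le_div_iff₀ hμ, mul_comm]
  refine le_trans ?_ hbd
  rcases (norm_nonneg u).eq_or_lt with h0 | h0
  · rw [← h0, mul_zero]
    exact norm_nonneg _
  · refine le_of_mul_le_mul_left ?_ h0
    nlinarith

end ParametricVariational

/-- Derivative of a function along a line, in terms of its gradient. -/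
lemma hasDerivAt_comp_line {V : Type*} [NormedAddCommGroup V] [InnerProductSpace ℝ V]
    [CompleteSpace V] {f : V → ℝ} (hf : Differentiable ℝ f) (p v : V) (t : ℝ) :
    HasDerivAt (fun s : ℝ => f (p + s • v)) ⟪gradient f (p + t • v), v⟫ t := by
  have hline : HasDerivAt (fun s : ℝ => p + s • v) v t := by
    simpa using ((hasDerivAt_id t).smul_const v).const_add p
  exact (hf (p + t • v)).hasGradientAt.hasFDerivAt.comp_hasDerivAt t hline

section PartialGradient

variable {E F : Type*} [NormedAddCommGroup E] [InnerProductSpace ℝ E] [CompleteSpace E]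
  [NormedAddCommGroup F] [InnerProductSpace ℝ F] [CompleteSpace F] {f : WithLp 2 (E × F) → ℝ}

/-- Partial strong convexity makes the gradient partially strongly monotone. -/
lemma gradient_strongly_monotone (hf : Differentiable ℝ f) {μ : ℝ} {ξ : F}
    (hsc : StrongConvexOn Set.univ μ fun η : E => f (toLp 2 (η, ξ))) (η η' : E) :
    μ * ‖η - η'‖ ^ 2 ≤
      ⟪gradient f (toLp 2 (η, ξ)) - gradient f (toLp 2 (η', ξ)), toLp 2 (η - η', 0)⟫ := by
  have hconv := (strongConvexOn_iff_convex.1 hsc).comp_affineMap (AffineMap.lineMap η' η)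
  set v := η - η' with hv
  have hderiv : ∀ t : ℝ, HasDerivAt
      ((fun x => f (toLp 2 (x, ξ)) - μ / 2 * ‖x‖ ^ 2) ∘ AffineMap.lineMap (k := ℝ) η' η)
      (⟪gradient f (toLp 2 (η' + t • v, ξ)), toLp 2 (v, (0 : F))⟫ - μ * ⟪η' + t • v, v⟫) t := by
    intro t
    have h1 := hasDerivAt_comp_line hf (toLp 2 (η', ξ)) (toLp 2 (v, (0 : F))) t
    have h2 : HasDerivAt (fun s : ℝ => η' + s • v) v t := by
      simpa using ((hasDerivAt_id t).smul_const v).const_add η'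
    have h3 := h1.sub (h2.norm_sq.const_mul (μ / 2))
    simp only [toLp_add_smul_fst] at h3
    refine (h3.congr_deriv (by ring)).congr_of_eventuallyEq (Filter.Eventually.of_forall fun s => ?_)
    simp [AffineMap.lineMap_apply, hv, add_comm]
  have hmono := hconv.monotoneOn_deriv fun t _ => (hderiv t).differentiableAt
  have h := hmono (Set.mem_univ (0 : ℝ)) (Set.mem_univ (1 : ℝ)) zero_le_one
  rw [(hderiv 0).deriv, (hderiv 1).deriv, zero_smul, one_smul, add_zero,
    inner_add_left, real_inner_self_eq_norm_sq] at h
  have hη : η' + v = η := by rw [hv]; abel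
  rw [hη] at h
  rw [inner_sub_left]
  linarith

/-- First-order optimality along a direction in the first factor. -/
lemma inner_gradient_eq_zero_of_forall_le (hf : Differentiable ℝ f) {η v : E} {ξ : F}
    (hmin : ∀ t : ℝ, f (toLp 2 (η, ξ)) ≤ f (toLp 2 (η + t • v, ξ))) :
    ⟪gradient f (toLp 2 (η, ξ)), toLp 2 (v, 0)⟫ = 0 := by
  have h := hasDerivAt_comp_line hf (toLp 2 (η, ξ)) (toLp 2 (v, (0 : F))) 0
  simp only [toLp_add_smul_fst, zero_smul, add_zero] at h
  refine IsLocalMin.hasDerivAt_eq_zero (Filter.Eventually.of_forall fun t => ?_) h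
  simpa using hmin t

end PartialGradient

/-- **Lipschitz smoothness of the lower-level solution map.**
In the bilevel lower-level setting, if additionally the full gradient `∇𝓛` is
`ℓ_{l,1}`-Lipschitz and the full Hessian `∇²𝓛` is `ℓ_{l,2}`-Lipschitz (both on the
`ℓ²`-product space, the Hessian in operator norm), then the solution map `η*` is
differentiable and its Jacobian (as a continuous linear map, i.e. in operator norm) is
Lipschitz with constant `L_{ηξ} = ℓ_{l,2}(1 + ℓ_{l,1}/μ_l)²/μ_l`. -/
theorem stmt11 (dl du dc : ℕ) (μl ℓl1 ℓl2 : ℝ)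
    (hμl : 0 < μl) (hℓl1 : 0 < ℓl1) (hℓl2 : 0 < ℓl2)
    (L : EuclideanSpace ℝ (Fin dl) → EuclideanSpace ℝ (Fin du) → ℝ)
    (hL : ContDiff ℝ 2 (fun p : WithLp 2 (EuclideanSpace ℝ (Fin dl) × EuclideanSpace ℝ (Fin du)) =>
      L (WithLp.equiv 2 (EuclideanSpace ℝ (Fin dl) × EuclideanSpace ℝ (Fin du)) p).1
        (WithLp.equiv 2 (EuclideanSpace ℝ (Fin dl) × EuclideanSpace ℝ (Fin du)) p).2))
    (hgradLip : ∀ p q : WithLp 2 (EuclideanSpace ℝ (Fin dl) × EuclideanSpace ℝ (Fin du)),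
      ‖gradient (fun p : WithLp 2 (EuclideanSpace ℝ (Fin dl) × EuclideanSpace ℝ (Fin du)) =>
          L (WithLp.equiv 2 (EuclideanSpace ℝ (Fin dl) × EuclideanSpace ℝ (Fin du)) p).1
            (WithLp.equiv 2 (EuclideanSpace ℝ (Fin dl) × EuclideanSpace ℝ (Fin du)) p).2) p
        - gradient (fun p : WithLp 2 (EuclideanSpace ℝ (Fin dl) × EuclideanSpace ℝ (Fin du)) =>
          L (WithLp.equiv 2 (EuclideanSpace ℝ (Fin dl) × EuclideanSpace ℝ (Fin du)) p).1
            (WithLp.equiv 2 (EuclideanSpace ℝ (Fin dl) × EuclideanSpace ℝ (Fin du)) p).2) q‖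
        ≤ ℓl1 * ‖p - q‖)
    (hhessLip : ∀ p q : WithLp 2 (EuclideanSpace ℝ (Fin dl) × EuclideanSpace ℝ (Fin du)),
      ‖fderiv ℝ (gradient (fun p : WithLp 2 (EuclideanSpace ℝ (Fin dl) × EuclideanSpace ℝ (Fin du)) =>
            L (WithLp.equiv 2 (EuclideanSpace ℝ (Fin dl) × EuclideanSpace ℝ (Fin du)) p).1
              (WithLp.equiv 2 (EuclideanSpace ℝ (Fin dl) × EuclideanSpace ℝ (Fin du)) p).2)) p
        - fderiv ℝ (gradient (fun p : WithLp 2 (EuclideanSpace ℝ (Fin dl) × EuclideanSpace ℝ (Fin du)) =>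
            L (WithLp.equiv 2 (EuclideanSpace ℝ (Fin dl) × EuclideanSpace ℝ (Fin du)) p).1
              (WithLp.equiv 2 (EuclideanSpace ℝ (Fin dl) × EuclideanSpace ℝ (Fin du)) p).2)) q‖
        ≤ ℓl2 * ‖p - q‖)
    (hsc : ∀ ξ : EuclideanSpace ℝ (Fin du),
      StrongConvexOn Set.univ μl (fun η : EuclideanSpace ℝ (Fin dl) => L η ξ))
    (A : Matrix (Fin dc) (Fin dl) ℝ) (cv : Fin dc → ℝ)
    (hHne : ∃ η : EuclideanSpace ℝ (Fin dl), A.mulVec (fun i => η i) = cv)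
    (ηstar : EuclideanSpace ℝ (Fin du) → EuclideanSpace ℝ (Fin dl))
    (hstar_mem : ∀ ξ, A.mulVec (fun i => ηstar ξ i) = cv)
    (hstar_min : ∀ ξ, ∀ η : EuclideanSpace ℝ (Fin dl),
      A.mulVec (fun i => η i) = cv → L (ηstar ξ) ξ ≤ L η ξ) :
    Differentiable ℝ ηstar ∧
      ∀ ξ₁ ξ₂ : EuclideanSpace ℝ (Fin du),
        ‖fderiv ℝ ηstar ξ₁ - fderiv ℝ ηstar ξ₂‖ ≤
          ℓl2 * (1 + ℓl1 / μl) ^ 2 / μl * ‖ξ₁ - ξ₂‖ := by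
  set f : WithLp 2 (EuclideanSpace ℝ (Fin dl) × EuclideanSpace ℝ (Fin du)) → ℝ := fun p =>
    L (WithLp.equiv 2 (EuclideanSpace ℝ (Fin dl) × EuclideanSpace ℝ (Fin du)) p).1
      (WithLp.equiv 2 (EuclideanSpace ℝ (Fin dl) × EuclideanSpace ℝ (Fin du)) p).2
  have hf : Differentiable ℝ f := hL.differentiable (by norm_num)
  have hG : Differentiable ℝ (gradient f) :=
    (InnerProductSpace.toDual ℝ _).symm.toContinuousLinearEquiv.differentiable.comp
      ((hL.fderiv_right (m := 1) (by norm_num)).differentiable (by norm_num))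
  let T : EuclideanSpace ℝ (Fin dl) →ₗ[ℝ] (Fin dc → ℝ) :=
    A.mulVecLin ∘ₗ (WithLp.linearEquiv 2 ℝ (Fin dl → ℝ)).toLinearMap
  have hT : ∀ η, T η = A.mulVec (fun i => η i) := fun _ => rfl
  refine solution_differentiable_and_fderiv_lipschitz (K := LinearMap.ker T) hμl hℓl1.le hℓl2.le hG
    hgradLip hhessLip (fun η η' ξ => gradient_strongly_monotone hf (hsc ξ) η η')
    (fun ξ ξ' => ?_) fun ξ k hk => inner_gradient_eq_zero_of_forall_le hf fun t => ?_
  · rw [LinearMap.mem_ker, map_sub, hT, hT, hstar_mem, hstar_mem, sub_self]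
  · refine hstar_min ξ (ηstar ξ + t • k) ?_
    rw [← hT, map_add, map_smul, LinearMap.mem_ker.1 hk, smul_zero, add_zero, hT, hstar_mem]
end

section
/- In the bilevel lower-level setting with ∇𝓛 ℓ_{l,1}-Lipschitz and ∇²𝓛 ℓ_{l,2}-Lipschitz, let 𝓤 : ℝ^{d_l} × ℝ^{d_u} → ℝ be ℓ_{u,0}-Lipschitz with ℓ_{u,1}-Lipschitz gradient. Then the reduced upper-level objective u(ξ) := 𝓤(η*(ξ), ξ) is differentiable with ∇u(ξ) = ∇_ξ𝓤(η*(ξ), ξ) + ∇η*(ξ)ᵀ·∇_η𝓤(η*(ξ), ξ), and ∇u is Lipschitz continuous with constant L_u := ℓ_{u,1}·(1 + L_η)² + ℓ_{u,0}·L_{ηξ}, where L_η := ℓ_{l,1}/μ_l and L_{ηξ} := ℓ_{l,2}(1 + ℓ_{l,1}/μ_l)²/μ_l. -/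
open Matrix

open scoped InnerProductSpace

section ConvexMonotone

variable {E : Type*} [NormedAddCommGroup E] [InnerProductSpace ℝ E]

/-- The derivative of a differentiable strongly convex function is strongly monotone. -/
theorem StrongConvexOn.mul_norm_sq_le_fderiv_sub {f : E → ℝ} {μ : ℝ}
    (hf : StrongConvexOn Set.univ μ f) (hd : Differentiable ℝ f) (x y : E) :
    μ * ‖x - y‖ ^ 2 ≤ (fderiv ℝ f x - fderiv ℝ f y) (x - y) := by
  have hconv := (strongConvexOn_iff_convex.1 hf).comp_affineMap (AffineMap.lineMap (k := ℝ) y x)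
  have hder : ∀ t : ℝ, HasDerivAt
      ((fun z => f z - μ / 2 * ‖z‖ ^ 2) ∘ (AffineMap.lineMap (k := ℝ) y x))
      (fderiv ℝ f (AffineMap.lineMap y x t) (x - y)
        - μ / 2 * (2 * ⟪(AffineMap.lineMap y x t : E), x - y⟫_ℝ)) t := by
    intro t
    have hl : HasDerivAt (fun t : ℝ => (AffineMap.lineMap y x t : E)) (x - y) t :=
      AffineMap.hasDerivAt_lineMap
    exact ((hd _).hasFDerivAt.comp_hasDerivAt t hl).sub (hl.norm_sq.const_mul _)
  have hmono := hconv.monotoneOn_deriv (fun t _ => (hder t).differentiableAt)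
    (Set.mem_univ (0 : ℝ)) (Set.mem_univ (1 : ℝ)) zero_le_one
  rw [(hder 0).deriv, (hder 1).deriv] at hmono
  simp only [AffineMap.lineMap_apply_zero, AffineMap.lineMap_apply_one] at hmono
  have hsq : ⟪x, x - y⟫_ℝ - ⟪y, x - y⟫_ℝ = ‖x - y‖ ^ 2 := by
    rw [← inner_sub_left, real_inner_self_eq_norm_sq]
  rw [_root_.sub_apply, ← hsq]
  linarith

/-- If `G` is strongly monotone along the line `t ↦ p + t • u`, its derivative is coercive in
the direction `u`. -/
theorem le_inner_fderiv_of_strongMono {G : E → E} {T : E →L[ℝ] E} {p u : E} {c : ℝ}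
    (hG : HasFDerivAt G T p)
    (hmono : ∀ t : ℝ, c * t ^ 2 ≤ ⟪G (p + t • u) - G p, t • u⟫_ℝ) :
    c ≤ ⟪T u, u⟫_ℝ := by
  have hl : HasDerivAt (fun t : ℝ => p + t • u) u 0 := by
    simpa using ((hasDerivAt_id (0 : ℝ)).smul_const u).const_add p
  have hG' : HasFDerivAt G T (p + (0 : ℝ) • u) := by simpa using hG
  have hd : HasDerivAt (fun t : ℝ => ⟪G (p + t • u), u⟫_ℝ) ⟪T u, u⟫_ℝ 0 := by
    simpa using (hG'.comp_hasDerivAt (0 : ℝ) hl).inner ℝ (hasDerivAt_const (0 : ℝ) u)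
  have hlim := hd.tendsto_slope_zero_right
  refine ge_of_tendsto hlim ?_
  filter_upwards [self_mem_nhdsWithin] with t (ht : 0 < t)
  have h := hmono t
  rw [inner_smul_right, inner_sub_left] at h
  simp only [zero_add, zero_smul, add_zero, smul_eq_mul]
  rw [inv_mul_eq_div, le_div_iff₀ ht]
  nlinarith

end ConvexMonotone

section SolutionMap

theorem WithLp.norm_toLp_two_le {E F : Type*} [SeminormedAddCommGroup E]
    [SeminormedAddCommGroup F] (a : E) (b : F) :
    ‖WithLp.toLp 2 (a, b)‖ ≤ ‖a‖ + ‖b‖ := by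
  have h := WithLp.prod_norm_sq_eq_of_L2 (WithLp.toLp 2 (a, b))
  simp only [WithLp.toLp_fst, WithLp.toLp_snd] at h
  nlinarith [norm_nonneg a, norm_nonneg b, norm_nonneg (WithLp.toLp 2 (a, b))]

variable {E F : Type*} [NormedAddCommGroup E] [InnerProductSpace ℝ E]
  [NormedAddCommGroup F] [InnerProductSpace ℝ F]

/-- Solvability of the linearized optimality system on the subspace `V`. -/
theorem exists_linearized_solution [FiniteDimensional ℝ E] [CompleteSpace F] (V : Submodule ℝ E)
    {μ : ℝ} (hμ : 0 < μ) (T : WithLp 2 (E × F) →L[ℝ] WithLp 2 (E × F))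
    (hT : ∀ w ∈ V, μ * ‖w‖ ^ 2 ≤ ⟪T (WithLp.toLp 2 (w, 0)), WithLp.toLp 2 (w, (0 : F))⟫_ℝ) :
    ∃ J : F →L[ℝ] E, (∀ v, J v ∈ V) ∧
      ∀ v, ∀ w ∈ V, ⟪T (WithLp.toLp 2 (J v, v)), WithLp.toLp 2 (w, (0 : F))⟫_ℝ = 0 := by
  let e := (WithLp.prodContinuousLinearEquiv 2 ℝ E F).symm.toContinuousLinearMap
  let a : V →L[ℝ] WithLp 2 (E × F) := e ∘L ContinuousLinearMap.inl ℝ E F ∘L V.subtypeL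
  let b : F →L[ℝ] WithLp 2 (E × F) := e ∘L ContinuousLinearMap.inr ℝ E F
  have ha : ∀ w : V, a w = WithLp.toLp 2 ((w : E), (0 : F)) := fun _ => rfl
  have hb : ∀ v : F, b v = WithLp.toLp 2 ((0 : E), v) := fun _ => rfl
  let S : V →L[ℝ] V := ContinuousLinearMap.adjoint a ∘L T ∘L a
  have hS : Function.Injective S := by
    rw [injective_iff_map_eq_zero]
    intro w hw
    have h := hT w w.2
    rw [← ha, ← ContinuousLinearMap.adjoint_inner_left] at h
    change _ ≤ ⟪S w, w⟫_ℝ at h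
    rw [hw, inner_zero_left] at h
    have h0 : ‖(w : E)‖ ^ 2 ≤ 0 := by nlinarith [sq_nonneg ‖(w : E)‖]
    have h1 : ‖(w : E)‖ = 0 := by nlinarith [sq_nonneg ‖(w : E)‖, norm_nonneg (w : E)]
    exact Subtype.ext (norm_eq_zero.1 h1)
  let R : V →L[ℝ] V :=
    (LinearEquiv.ofInjectiveEndo (S : V →ₗ[ℝ] V) hS).symm.toLinearMap.toContinuousLinearMap
  have hR : ∀ w, S (R w) = w := fun w =>
    (LinearEquiv.ofInjectiveEndo (S : V →ₗ[ℝ] V) hS).apply_symm_apply w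
  let K : F →L[ℝ] V := -(R ∘L ContinuousLinearMap.adjoint a ∘L T ∘L b)
  refine ⟨V.subtypeL ∘L K, fun v => (K v).2, fun v w hw => ?_⟩
  have hsplit : WithLp.toLp 2 ((V.subtypeL ∘L K) v, v) = a (K v) + b v := by
    rw [ha, hb, ← WithLp.toLp_add]
    simp
  rw [hsplit, ← ha ⟨w, hw⟩, ← ContinuousLinearMap.adjoint_inner_left, map_add, map_add]
  have hK : ContinuousLinearMap.adjoint a (T (a (K v)))
      = -(ContinuousLinearMap.adjoint a (T (b v))) := by
    change S (-(R (ContinuousLinearMap.adjoint a (T (b v))))) = _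
    rw [map_neg, hR]
  rw [hK, neg_add_cancel, inner_zero_left]

variable {V : Submodule ℝ E} {μ : ℝ} {G : WithLp 2 (E × F) → WithLp 2 (E × F)} {s : F → E}

/-- The solution map of a strongly monotone variational equation is Lipschitz. -/
theorem norm_sub_le_of_strongMono {ℓ : ℝ} (hμ : 0 < μ)
    (hmono : ∀ (η₁ η₂ : E) (ξ : F), μ * ‖η₁ - η₂‖ ^ 2 ≤
      ⟪G (WithLp.toLp 2 (η₁, ξ)) - G (WithLp.toLp 2 (η₂, ξ)), WithLp.toLp 2 (η₁ - η₂, 0)⟫_ℝ)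
    (hLip : ∀ p q, ‖G p - G q‖ ≤ ℓ * ‖p - q‖)
    (horth : ∀ ξ, ∀ w ∈ V, ⟪G (WithLp.toLp 2 (s ξ, ξ)), WithLp.toLp 2 (w, 0)⟫_ℝ = 0)
    (hmem : ∀ ξ ξ', s ξ - s ξ' ∈ V) (ξ₁ ξ₂ : F) :
    ‖s ξ₁ - s ξ₂‖ ≤ ℓ / μ * ‖ξ₁ - ξ₂‖ := by
  set w := s ξ₁ - s ξ₂ with hw
  have h1 := hmono (s ξ₁) (s ξ₂) ξ₁
  rw [← hw, inner_sub_left, horth _ _ (hmem ξ₁ ξ₂), ← horth ξ₂ _ (hmem ξ₁ ξ₂), ← hw,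
    ← inner_sub_left] at h1
  have h2 := hLip (WithLp.toLp 2 (s ξ₂, ξ₂)) (WithLp.toLp 2 (s ξ₂, ξ₁))
  have hdiff : WithLp.toLp 2 (s ξ₂, ξ₂) - WithLp.toLp 2 (s ξ₂, ξ₁)
      = WithLp.toLp 2 ((0 : E), ξ₂ - ξ₁) := by
    rw [← WithLp.toLp_sub, Prod.mk_sub_mk, sub_self]
  rw [hdiff, WithLp.norm_toLp_snd, norm_sub_rev ξ₂] at h2
  have h3 := h1.trans (real_inner_le_norm _ _)
  rw [WithLp.norm_toLp_fst] at h3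
  have h4 : μ * ‖w‖ * ‖w‖ ≤ ℓ * ‖ξ₁ - ξ₂‖ * ‖w‖ := by
    nlinarith [mul_le_mul_of_nonneg_right h2 (norm_nonneg w)]
  rcases (norm_nonneg w).eq_or_lt with h0 | h0
  · rw [← h0]
    have := (norm_nonneg _).trans h2
    rw [div_mul_eq_mul_div]
    positivity
  · rw [div_mul_eq_mul_div, le_div_iff₀ hμ]
    linarith [le_of_mul_le_mul_right h4 h0]

/-- A solution of the linearized optimality system is the derivative of the solution map. -/
theorem hasFDerivAt_of_linearized_solution (hμ : 0 < μ) {C : ℝ}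
    {T : WithLp 2 (E × F) →L[ℝ] WithLp 2 (E × F)} {J : F →L[ℝ] E} {ξ₀ : F}
    (hG : HasFDerivAt G T (WithLp.toLp 2 (s ξ₀, ξ₀)))
    (hT : ∀ w ∈ V, μ * ‖w‖ ^ 2 ≤ ⟪T (WithLp.toLp 2 (w, 0)), WithLp.toLp 2 (w, (0 : F))⟫_ℝ)
    (horth : ∀ ξ, ∀ w ∈ V, ⟪G (WithLp.toLp 2 (s ξ, ξ)), WithLp.toLp 2 (w, 0)⟫_ℝ = 0)
    (hmem : ∀ ξ ξ', s ξ - s ξ' ∈ V) (hs : ∀ ξ, ‖s ξ - s ξ₀‖ ≤ C * ‖ξ - ξ₀‖)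
    (hJV : ∀ v, J v ∈ V)
    (hJ : ∀ v, ∀ w ∈ V, ⟪T (WithLp.toLp 2 (J v, v)), WithLp.toLp 2 (w, (0 : F))⟫_ℝ = 0) :
    HasFDerivAt s J ξ₀ := by
  have hbound : ∀ ξ, ‖WithLp.toLp 2 (s ξ, ξ) - WithLp.toLp 2 (s ξ₀, ξ₀)‖
      ≤ (C + 1) * ‖ξ - ξ₀‖ := by
    intro ξ
    rw [← WithLp.toLp_sub, Prod.mk_sub_mk]
    linarith [WithLp.norm_toLp_two_le (s ξ - s ξ₀) (ξ - ξ₀), hs ξ]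
  have hbigO : (fun ξ => WithLp.toLp 2 (s ξ, ξ) - WithLp.toLp 2 (s ξ₀, ξ₀))
      =O[nhds ξ₀] fun ξ => ξ - ξ₀ := .of_bound _ (.of_forall hbound)
  have hcont : Filter.Tendsto (fun ξ => WithLp.toLp 2 (s ξ, ξ)) (nhds ξ₀)
      (nhds (WithLp.toLp 2 (s ξ₀, ξ₀))) := by
    rw [tendsto_iff_norm_sub_tendsto_zero]
    refine squeeze_zero (fun _ => norm_nonneg _) hbound ?_
    have : Continuous fun ξ : F => (C + 1) * ‖ξ - ξ₀‖ := by fun_prop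
    simpa using this.tendsto ξ₀
  have hlittle := (hG.isLittleO.comp_tendsto hcont).trans_isBigO hbigO
  rw [hasFDerivAt_iff_isLittleO]
  refine Asymptotics.IsBigO.trans_isLittleO (.of_bound μ⁻¹ (.of_forall fun ξ => ?_)) hlittle
  set w := s ξ - s ξ₀ - J (ξ - ξ₀) with hw
  have hwV : w ∈ V := V.sub_mem (hmem _ _) (hJV _)
  set r := G (WithLp.toLp 2 (s ξ, ξ)) - G (WithLp.toLp 2 (s ξ₀, ξ₀))
    - T (WithLp.toLp 2 (s ξ, ξ) - WithLp.toLp 2 (s ξ₀, ξ₀)) with hr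
  have hsplit : WithLp.toLp 2 (s ξ, ξ) - WithLp.toLp 2 (s ξ₀, ξ₀)
      = WithLp.toLp 2 (w, (0 : F)) + WithLp.toLp 2 (J (ξ - ξ₀), ξ - ξ₀) := by
    rw [← WithLp.toLp_sub, ← WithLp.toLp_add, Prod.mk_sub_mk, Prod.mk_add_mk, hw,
      sub_add_cancel, zero_add]
  have hinner : ⟪r, WithLp.toLp 2 (w, (0 : F))⟫_ℝ
      = -⟪T (WithLp.toLp 2 (w, 0)), WithLp.toLp 2 (w, (0 : F))⟫_ℝ := by
    rw [hr, hsplit, map_add, inner_sub_left, inner_sub_left, inner_add_left, horth _ _ hwV,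
      horth _ _ hwV, hJ _ _ hwV]
    ring
  have h1 := hT w hwV
  have h2 := (abs_le.1 (abs_real_inner_le_norm r (WithLp.toLp 2 (w, (0 : F))))).1
  rw [WithLp.norm_toLp_fst, hinner] at h2
  change ‖w‖ ≤ μ⁻¹ * ‖r‖
  rw [inv_mul_eq_div, le_div_iff₀ hμ]
  rcases (norm_nonneg w).eq_or_lt with h0 | h0
  · rw [← h0, zero_mul]
    exact norm_nonneg _
  · exact le_of_mul_le_mul_right (by linarith [sq ‖w‖]) h0

/-- Stability of solutions of the linearized optimality system. -/
theorem norm_linearized_solution_sub_le (hμ : 0 < μ) {ℓ C d : ℝ}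
    {T₁ T₂ : WithLp 2 (E × F) →L[ℝ] WithLp 2 (E × F)} {J₁ J₂ : F →L[ℝ] E}
    (hT : ∀ w ∈ V, μ * ‖w‖ ^ 2 ≤ ⟪T₁ (WithLp.toLp 2 (w, 0)), WithLp.toLp 2 (w, (0 : F))⟫_ℝ)
    (hTT : ‖T₁ - T₂‖ ≤ ℓ * d) (hJ₂C : ∀ v, ‖J₂ v‖ ≤ C * ‖v‖)
    (hJV₁ : ∀ v, J₁ v ∈ V) (hJV₂ : ∀ v, J₂ v ∈ V)
    (hJ₁ : ∀ v, ∀ w ∈ V, ⟪T₁ (WithLp.toLp 2 (J₁ v, v)), WithLp.toLp 2 (w, (0 : F))⟫_ℝ = 0)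
    (hJ₂ : ∀ v, ∀ w ∈ V, ⟪T₂ (WithLp.toLp 2 (J₂ v, v)), WithLp.toLp 2 (w, (0 : F))⟫_ℝ = 0)
    (v : F) : ‖(J₁ - J₂) v‖ ≤ ℓ * d * (1 + C) / μ * ‖v‖ := by
  set w := (J₁ - J₂) v with hw
  have hwV : w ∈ V := V.sub_mem (hJV₁ _) (hJV₂ _)
  set z := WithLp.toLp 2 (J₂ v, v) with hz
  have hsplit : WithLp.toLp 2 (J₁ v, v) = WithLp.toLp 2 (w, (0 : F)) + z := by
    rw [hz, ← WithLp.toLp_add, Prod.mk_add_mk, hw, _root_.sub_apply,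
      sub_add_cancel, zero_add]
  have hinner : ⟪(T₁ - T₂) z, WithLp.toLp 2 (w, (0 : F))⟫_ℝ
      = -⟪T₁ (WithLp.toLp 2 (w, 0)), WithLp.toLp 2 (w, (0 : F))⟫_ℝ := by
    have h := hJ₁ v w hwV
    rw [hsplit, map_add, inner_add_left] at h
    rw [_root_.sub_apply, inner_sub_left, hJ₂ v w hwV]
    linarith
  have h1 := hT w hwV
  have h2 := (abs_le.1 (abs_real_inner_le_norm ((T₁ - T₂) z) (WithLp.toLp 2 (w, (0 : F))))).1
  rw [WithLp.norm_toLp_fst, hinner] at h2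
  have h3 : ‖(T₁ - T₂) z‖ ≤ ℓ * d * ((1 + C) * ‖v‖) := by
    refine (T₁ - T₂).le_of_opNorm_le_of_le hTT ?_
    linarith [WithLp.norm_toLp_two_le (J₂ v) v, hJ₂C v]
  have h4 : ‖w‖ * μ ≤ ‖(T₁ - T₂) z‖ := by
    rcases (norm_nonneg w).eq_or_lt with h0 | h0
    · rw [← h0, zero_mul]
      exact norm_nonneg _
    · exact le_of_mul_le_mul_right (by linarith [sq ‖w‖]) h0
  rw [div_mul_eq_mul_div, le_div_iff₀ hμ]
  linarith

variable [CompleteSpace F]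

/-- Gradient of a function composed with the graph map `ζ ↦ (s ζ, ζ)`, tested on a vector. -/
theorem inner_gradient_comp_graph [CompleteSpace E] {Φ : WithLp 2 (E × F) → ℝ}
    (hΦ : Differentiable ℝ Φ) {J : F →L[ℝ] E} {ξ : F} (hs : HasFDerivAt s J ξ) :
    DifferentiableAt ℝ (fun ζ => Φ (WithLp.toLp 2 (s ζ, ζ))) ξ ∧
      ∀ v, ⟪gradient (fun ζ => Φ (WithLp.toLp 2 (s ζ, ζ))) ξ, v⟫_ℝ
        = ⟪gradient Φ (WithLp.toLp 2 (s ξ, ξ)), WithLp.toLp 2 (J v, v)⟫_ℝ := by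
  have h := (hΦ (WithLp.toLp 2 (s ξ, ξ))).hasFDerivAt.comp ξ
    ((WithLp.prodContinuousLinearEquiv 2 ℝ E F).symm.hasFDerivAt.comp ξ
      (hs.prodMk (hasFDerivAt_id ξ)))
  refine ⟨h.differentiableAt, fun v => ?_⟩
  rw [inner_gradient_left, inner_gradient_left]
  exact congrArg (fun D : F →L[ℝ] ℝ => D v) h.fderiv

/-- Chain rule for the reduced objective in terms of partial gradients. -/
theorem gradient_comp_graph [CompleteSpace E] {Φ : WithLp 2 (E × F) → ℝ}
    (hΦ : Differentiable ℝ Φ) {ξ : F} (hs : DifferentiableAt ℝ s ξ) :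
    gradient (fun ζ => Φ (WithLp.toLp 2 (s ζ, ζ))) ξ =
      gradient (fun ζ => Φ (WithLp.toLp 2 (s ξ, ζ))) ξ +
        ContinuousLinearMap.adjoint (fderiv ℝ s ξ)
          (gradient (fun a => Φ (WithLp.toLp 2 (a, ξ))) (s ξ)) := by
  refine ext_inner_right ℝ fun v => ?_
  have h := (hΦ (WithLp.toLp 2 (s ξ, ξ))).hasFDerivAt.comp (s ξ)
    ((WithLp.prodContinuousLinearEquiv 2 ℝ E F).symm.hasFDerivAt.comp (s ξ)
      ((hasFDerivAt_id (s ξ)).prodMk (hasFDerivAt_const ξ (s ξ))))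
  have h1 : ⟪gradient (fun a => Φ (WithLp.toLp 2 (a, ξ))) (s ξ), fderiv ℝ s ξ v⟫_ℝ
      = ⟪gradient Φ (WithLp.toLp 2 (s ξ, ξ)), WithLp.toLp 2 (fderiv ℝ s ξ v, (0 : F))⟫_ℝ := by
    rw [inner_gradient_left, inner_gradient_left]
    exact congrArg (fun D : E →L[ℝ] ℝ => D (fderiv ℝ s ξ v)) h.fderiv
  have h2 := (inner_gradient_comp_graph hΦ (hasFDerivAt_const (s ξ) ξ)).2 v
  rw [inner_add_left, ContinuousLinearMap.adjoint_inner_left, h1, h2,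
    (inner_gradient_comp_graph hΦ hs.hasFDerivAt).2 v, ← inner_add_right, ← WithLp.toLp_add]
  simp

/-- Lipschitz estimate for the gradient of the reduced objective, given bounds on the solution map
and on its derivative. -/
theorem norm_gradient_comp_graph_sub_le [CompleteSpace E] {Φ : WithLp 2 (E × F) → ℝ}
    (hΦ : Differentiable ℝ Φ) {ℓ₀ ℓ₁ C D : ℝ} (hℓ₁ : 0 ≤ ℓ₁)
    (hgrad : ∀ p, ‖gradient Φ p‖ ≤ ℓ₀)
    (hgradLip : ∀ p q, ‖gradient Φ p - gradient Φ q‖ ≤ ℓ₁ * ‖p - q‖)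
    {J : F → F →L[ℝ] E} (hs : ∀ ξ, HasFDerivAt s (J ξ) ξ)
    (hsLip : ∀ ξ ξ', ‖s ξ - s ξ'‖ ≤ C * ‖ξ - ξ'‖) (hJC : ∀ ξ v, ‖J ξ v‖ ≤ C * ‖v‖)
    (hJLip : ∀ ξ ξ' v, ‖(J ξ - J ξ') v‖ ≤ D * ‖ξ - ξ'‖ * ‖v‖) (ξ₁ ξ₂ : F) :
    ‖gradient (fun ζ => Φ (WithLp.toLp 2 (s ζ, ζ))) ξ₁
      - gradient (fun ζ => Φ (WithLp.toLp 2 (s ζ, ζ))) ξ₂‖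
      ≤ (ℓ₁ * (1 + C) ^ 2 + ℓ₀ * D) * ‖ξ₁ - ξ₂‖ := by
  set v := gradient (fun ζ => Φ (WithLp.toLp 2 (s ζ, ζ))) ξ₁
    - gradient (fun ζ => Φ (WithLp.toLp 2 (s ζ, ζ))) ξ₂ with hv
  set p₁ := WithLp.toLp 2 (s ξ₁, ξ₁) with hp₁
  set p₂ := WithLp.toLp 2 (s ξ₂, ξ₂) with hp₂
  have hp : ‖p₁ - p₂‖ ≤ (1 + C) * ‖ξ₁ - ξ₂‖ := by
    rw [hp₁, hp₂, ← WithLp.toLp_sub, Prod.mk_sub_mk]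
    linarith [WithLp.norm_toLp_two_le (s ξ₁ - s ξ₂) (ξ₁ - ξ₂), hsLip ξ₁ ξ₂]
  have hMv : ‖WithLp.toLp 2 (J ξ₁ v, v)‖ ≤ (1 + C) * ‖v‖ := by
    linarith [WithLp.norm_toLp_two_le (J ξ₁ v) v, hJC ξ₁ v]
  have hsplit : WithLp.toLp 2 (J ξ₁ v, v)
      = WithLp.toLp 2 ((J ξ₁ - J ξ₂) v, (0 : F)) + WithLp.toLp 2 (J ξ₂ v, v) := by
    rw [← WithLp.toLp_add, Prod.mk_add_mk, _root_.sub_apply, sub_add_cancel, zero_add]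
  have hsq : ‖v‖ ^ 2 = ⟪gradient Φ p₁ - gradient Φ p₂, WithLp.toLp 2 (J ξ₁ v, v)⟫_ℝ
      + ⟪gradient Φ p₂, WithLp.toLp 2 ((J ξ₁ - J ξ₂) v, (0 : F))⟫_ℝ := by
    have h : ‖v‖ ^ 2 = ⟪gradient Φ p₁, WithLp.toLp 2 (J ξ₁ v, v)⟫_ℝ
        - ⟪gradient Φ p₂, WithLp.toLp 2 (J ξ₂ v, v)⟫_ℝ := by
      rw [← (inner_gradient_comp_graph hΦ (hs ξ₁)).2 v,
        ← (inner_gradient_comp_graph hΦ (hs ξ₂)).2 v, ← inner_sub_left, ← hv,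
        real_inner_self_eq_norm_sq]
    rw [h, inner_sub_left, eq_sub_of_add_eq' hsplit.symm, inner_sub_right]
    ring
  have h1 : ⟪gradient Φ p₁ - gradient Φ p₂, WithLp.toLp 2 (J ξ₁ v, v)⟫_ℝ
      ≤ ℓ₁ * ((1 + C) * ‖ξ₁ - ξ₂‖) * ((1 + C) * ‖v‖) :=
    (real_inner_le_norm _ _).trans <| mul_le_mul
      ((hgradLip _ _).trans (mul_le_mul_of_nonneg_left hp hℓ₁)) hMv (norm_nonneg _)
      (mul_nonneg hℓ₁ ((norm_nonneg _).trans hp))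
  have h2 : ⟪gradient Φ p₂, WithLp.toLp 2 ((J ξ₁ - J ξ₂) v, (0 : F))⟫_ℝ
      ≤ ℓ₀ * (D * ‖ξ₁ - ξ₂‖ * ‖v‖) := by
    refine (real_inner_le_norm _ _).trans ?_
    rw [WithLp.norm_toLp_fst]
    exact mul_le_mul (hgrad _) (hJLip _ _ _) (norm_nonneg _) ((norm_nonneg _).trans (hgrad p₂))
  rcases (norm_nonneg v).eq_or_lt with h0 | h0
  · rcases (norm_nonneg (ξ₁ - ξ₂)).eq_or_lt with h0' | h0'
    · rw [← h0, ← h0', mul_zero]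
    · have hℓ₀ : 0 ≤ ℓ₀ := (norm_nonneg _).trans (hgrad p₂)
      rw [← h0]
      refine mul_nonneg (add_nonneg (by positivity) (mul_nonneg hℓ₀ ?_)) h0'.le
      have := (norm_nonneg _).trans (hJLip ξ₁ ξ₂ (ξ₁ - ξ₂))
      rw [mul_assoc] at this
      exact nonneg_of_mul_nonneg_left this (mul_pos h0' h0')
  · refine le_of_mul_le_mul_right ?_ h0
    nlinarith

/-- Smoothness of the reduced objective for a lower-level problem constrained to translates of a
subspace `V`. -/
theorem reduced_objective_smooth [FiniteDimensional ℝ E] {Λ Φ : WithLp 2 (E × F) → ℝ}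
    {ℓ₁ ℓ₂ k₀ k₁ : ℝ} (hμ : 0 < μ) (hℓ₁ : 0 ≤ ℓ₁) (hℓ₂ : 0 ≤ ℓ₂) (hk₀ : 0 ≤ k₀) (hk₁ : 0 ≤ k₁)
    (hΛ : ContDiff ℝ 2 Λ)
    (hgradLip : ∀ p q, ‖gradient Λ p - gradient Λ q‖ ≤ ℓ₁ * ‖p - q‖)
    (hhessLip : ∀ p q, ‖fderiv ℝ (gradient Λ) p - fderiv ℝ (gradient Λ) q‖ ≤ ℓ₂ * ‖p - q‖)
    (hΦ : Differentiable ℝ Φ) (hΦ₀ : ∀ p q, |Φ p - Φ q| ≤ k₀ * ‖p - q‖)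
    (hΦ₁ : ∀ p q, ‖gradient Φ p - gradient Φ q‖ ≤ k₁ * ‖p - q‖)
    (hsc : ∀ ξ, StrongConvexOn Set.univ μ fun η => Λ (WithLp.toLp 2 (η, ξ)))
    (hmem : ∀ ξ ξ', s ξ - s ξ' ∈ V)
    (hmin : ∀ ξ, ∀ w ∈ V, Λ (WithLp.toLp 2 (s ξ, ξ)) ≤ Λ (WithLp.toLp 2 (s ξ + w, ξ))) :
    Differentiable ℝ s ∧ ∀ ξ₁ ξ₂,
      ‖gradient (fun ζ => Φ (WithLp.toLp 2 (s ζ, ζ))) ξ₁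
        - gradient (fun ζ => Φ (WithLp.toLp 2 (s ζ, ζ))) ξ₂‖
        ≤ (k₁ * (1 + ℓ₁ / μ) ^ 2 + k₀ * (ℓ₂ * (1 + ℓ₁ / μ) ^ 2 / μ)) * ‖ξ₁ - ξ₂‖ := by
  have hΛd : Differentiable ℝ Λ := hΛ.differentiable (by norm_num)
  have hpart : ∀ η ξ, HasFDerivAt (fun η => Λ (WithLp.toLp 2 (η, ξ)))
      (fderiv ℝ Λ (WithLp.toLp 2 (η, ξ)) ∘L
        (WithLp.prodContinuousLinearEquiv 2 ℝ E F).symm.toContinuousLinearMap ∘L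
          (ContinuousLinearMap.id ℝ E).prod (0 : E →L[ℝ] F)) η := fun η ξ =>
    (hΛd (WithLp.toLp 2 (η, ξ))).hasFDerivAt.comp η
      ((WithLp.prodContinuousLinearEquiv 2 ℝ E F).symm.hasFDerivAt.comp η
        ((hasFDerivAt_id η).prodMk (hasFDerivAt_const ξ η)))
  have hpart_apply : ∀ η ξ w, fderiv ℝ (fun η => Λ (WithLp.toLp 2 (η, ξ))) η w
      = ⟪gradient Λ (WithLp.toLp 2 (η, ξ)), WithLp.toLp 2 (w, 0)⟫_ℝ := fun η ξ w => by
    rw [(hpart η ξ).fderiv, inner_gradient_left]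
    rfl
  have hmono : ∀ (η₁ η₂ : E) (ξ : F), μ * ‖η₁ - η₂‖ ^ 2 ≤
      ⟪gradient Λ (WithLp.toLp 2 (η₁, ξ)) - gradient Λ (WithLp.toLp 2 (η₂, ξ)),
        WithLp.toLp 2 (η₁ - η₂, 0)⟫_ℝ := fun η₁ η₂ ξ => by
    rw [inner_sub_left, ← hpart_apply, ← hpart_apply]
    exact (hsc ξ).mul_norm_sq_le_fderiv_sub (fun η => (hpart η ξ).differentiableAt) η₁ η₂
  have horth : ∀ ξ, ∀ w ∈ V,
      ⟪gradient Λ (WithLp.toLp 2 (s ξ, ξ)), WithLp.toLp 2 (w, 0)⟫_ℝ = 0 := fun ξ w hw => by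
    have hl : HasDerivAt (fun t : ℝ => s ξ + t • w) w 0 := by
      simpa using ((hasDerivAt_id (0 : ℝ)).smul_const w).const_add (s ξ)
    have hd : HasFDerivAt (fun η => Λ (WithLp.toLp 2 (η, ξ)))
        (fderiv ℝ (fun η => Λ (WithLp.toLp 2 (η, ξ))) (s ξ)) (s ξ + (0 : ℝ) • w) := by
      simpa using (hpart (s ξ) ξ).differentiableAt.hasFDerivAt
    rw [← hpart_apply]
    refine IsLocalMin.hasDerivAt_eq_zero (.of_forall fun t => ?_) (hd.comp_hasDerivAt (0 : ℝ) hl)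
    simpa using hmin ξ _ (V.smul_mem t hw)
  have hG : ∀ p, HasFDerivAt (gradient Λ) (fderiv ℝ (gradient Λ) p) p := fun p => by
    have h1 : Differentiable ℝ (fderiv ℝ Λ) :=
      (hΛ.fderiv_right (m := 1) (by norm_num)).differentiable one_ne_zero
    have h2 : Differentiable ℝ (gradient Λ) :=
      (InnerProductSpace.toDual ℝ (WithLp 2 (E × F))).symm.differentiable.comp h1
    exact (h2 p).hasFDerivAt
  have hT : ∀ η ξ, ∀ w ∈ V, μ * ‖w‖ ^ 2 ≤
      ⟪fderiv ℝ (gradient Λ) (WithLp.toLp 2 (η, ξ)) (WithLp.toLp 2 (w, 0)),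
        WithLp.toLp 2 (w, (0 : F))⟫_ℝ := fun η ξ w _ => by
    refine le_inner_fderiv_of_strongMono (hG _) fun t => ?_
    have h := hmono (η + t • w) η ξ
    rw [add_sub_cancel_left, norm_smul, mul_pow, Real.norm_eq_abs, sq_abs] at h
    have e1 : WithLp.toLp 2 (η, ξ) + t • WithLp.toLp 2 (w, (0 : F))
        = WithLp.toLp 2 (η + t • w, ξ) := by
      rw [← WithLp.toLp_smul, ← WithLp.toLp_add]
      simp
    have e2 : t • WithLp.toLp 2 (w, (0 : F)) = WithLp.toLp 2 (t • w, (0 : F)) := by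
      rw [← WithLp.toLp_smul]
      simp
    rw [e1, e2]
    linarith
  have hsLip := norm_sub_le_of_strongMono hμ hmono hgradLip horth hmem
  choose J hJV hJ using fun ξ =>
    exists_linearized_solution V hμ (fderiv ℝ (gradient Λ) (WithLp.toLp 2 (s ξ, ξ))) (hT _ _)
  have hs : ∀ ξ, HasFDerivAt s (J ξ) ξ := fun ξ =>
    hasFDerivAt_of_linearized_solution hμ (hG _) (hT _ _) horth hmem (fun ζ => hsLip ζ ξ)
      (hJV ξ) (hJ ξ)
  have hC : 0 ≤ ℓ₁ / μ := by positivity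
  have hJC : ∀ ξ v, ‖J ξ v‖ ≤ ℓ₁ / μ * ‖v‖ := fun ξ v =>
    (J ξ).le_of_opNorm_le ((hs ξ).le_of_lip' hC (.of_forall fun ζ => hsLip ζ ξ)) v
  refine ⟨fun ξ => (hs ξ).differentiableAt, norm_gradient_comp_graph_sub_le hΦ hk₁ (fun p => ?_)
    hΦ₁ hs hsLip hJC fun ξ ξ' v => ?_⟩
  · rw [← (InnerProductSpace.toDual ℝ (WithLp 2 (E × F))).norm_map, toDual_gradient]
    exact (hΦ p).hasFDerivAt.le_of_lip' hk₀ (.of_forall fun q => hΦ₀ q p)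
  · have hTT : ‖fderiv ℝ (gradient Λ) (WithLp.toLp 2 (s ξ, ξ))
        - fderiv ℝ (gradient Λ) (WithLp.toLp 2 (s ξ', ξ'))‖
        ≤ ℓ₂ * ((1 + ℓ₁ / μ) * ‖ξ - ξ'‖) := by
      refine (hhessLip _ _).trans (mul_le_mul_of_nonneg_left ?_ hℓ₂)
      rw [← WithLp.toLp_sub, Prod.mk_sub_mk]
      linarith [WithLp.norm_toLp_two_le (s ξ - s ξ') (ξ - ξ'), hsLip ξ ξ']
    refine (norm_linearized_solution_sub_le hμ (hT _ _) hTT (hJC ξ') (hJV ξ) (hJV ξ') (hJ ξ)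
      (hJ ξ') v).trans_eq ?_
    ring

end SolutionMap

/-- **Smoothness of the reduced upper-level objective.**
In the bilevel lower-level setting with `∇𝓛` being `ℓ_{l,1}`-Lipschitz and `∇²𝓛` being
`ℓ_{l,2}`-Lipschitz, if `𝓤` is `ℓ_{u,0}`-Lipschitz with `ℓ_{u,1}`-Lipschitz gradient
(both on the `ℓ²`-product space), then `u(ξ) = 𝓤(η*(ξ),ξ)` is differentiable with
`∇u(ξ) = ∇_ξ𝓤(η*(ξ),ξ) + ∇η*(ξ)ᵀ∇_η𝓤(η*(ξ),ξ)`, and `∇u` is Lipschitz with constant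
`L_u = ℓ_{u,1}(1 + L_η)² + ℓ_{u,0}L_{ηξ}` where `L_η = ℓ_{l,1}/μ_l` and
`L_{ηξ} = ℓ_{l,2}(1 + ℓ_{l,1}/μ_l)²/μ_l`. -/
theorem stmt15 (dl du dc : ℕ) (μl ℓl1 ℓl2 ℓu0 ℓu1 : ℝ)
    (hμl : 0 < μl) (hℓl1 : 0 < ℓl1) (hℓl2 : 0 < ℓl2) (hℓu0 : 0 < ℓu0) (hℓu1 : 0 < ℓu1)
    (L U : EuclideanSpace ℝ (Fin dl) → EuclideanSpace ℝ (Fin du) → ℝ)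
    (hL : ContDiff ℝ 2 (fun p : WithLp 2 (EuclideanSpace ℝ (Fin dl) × EuclideanSpace ℝ (Fin du)) =>
      L (WithLp.equiv 2 (EuclideanSpace ℝ (Fin dl) × EuclideanSpace ℝ (Fin du)) p).1
        (WithLp.equiv 2 (EuclideanSpace ℝ (Fin dl) × EuclideanSpace ℝ (Fin du)) p).2))
    (hgradLip : ∀ p q : WithLp 2 (EuclideanSpace ℝ (Fin dl) × EuclideanSpace ℝ (Fin du)),
      ‖gradient (fun p : WithLp 2 (EuclideanSpace ℝ (Fin dl) × EuclideanSpace ℝ (Fin du)) =>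
          L (WithLp.equiv 2 (EuclideanSpace ℝ (Fin dl) × EuclideanSpace ℝ (Fin du)) p).1
            (WithLp.equiv 2 (EuclideanSpace ℝ (Fin dl) × EuclideanSpace ℝ (Fin du)) p).2) p
        - gradient (fun p : WithLp 2 (EuclideanSpace ℝ (Fin dl) × EuclideanSpace ℝ (Fin du)) =>
          L (WithLp.equiv 2 (EuclideanSpace ℝ (Fin dl) × EuclideanSpace ℝ (Fin du)) p).1
            (WithLp.equiv 2 (EuclideanSpace ℝ (Fin dl) × EuclideanSpace ℝ (Fin du)) p).2) q‖
        ≤ ℓl1 * ‖p - q‖)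
    (hhessLip : ∀ p q : WithLp 2 (EuclideanSpace ℝ (Fin dl) × EuclideanSpace ℝ (Fin du)),
      ‖fderiv ℝ (gradient (fun p : WithLp 2 (EuclideanSpace ℝ (Fin dl) × EuclideanSpace ℝ (Fin du)) =>
            L (WithLp.equiv 2 (EuclideanSpace ℝ (Fin dl) × EuclideanSpace ℝ (Fin du)) p).1
              (WithLp.equiv 2 (EuclideanSpace ℝ (Fin dl) × EuclideanSpace ℝ (Fin du)) p).2)) p
        - fderiv ℝ (gradient (fun p : WithLp 2 (EuclideanSpace ℝ (Fin dl) × EuclideanSpace ℝ (Fin du)) =>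
            L (WithLp.equiv 2 (EuclideanSpace ℝ (Fin dl) × EuclideanSpace ℝ (Fin du)) p).1
              (WithLp.equiv 2 (EuclideanSpace ℝ (Fin dl) × EuclideanSpace ℝ (Fin du)) p).2)) q‖
        ≤ ℓl2 * ‖p - q‖)
    (hUdiff : Differentiable ℝ
      (fun p : WithLp 2 (EuclideanSpace ℝ (Fin dl) × EuclideanSpace ℝ (Fin du)) =>
        U (WithLp.equiv 2 (EuclideanSpace ℝ (Fin dl) × EuclideanSpace ℝ (Fin du)) p).1
          (WithLp.equiv 2 (EuclideanSpace ℝ (Fin dl) × EuclideanSpace ℝ (Fin du)) p).2))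
    (hU0 : ∀ p q : WithLp 2 (EuclideanSpace ℝ (Fin dl) × EuclideanSpace ℝ (Fin du)),
      |U (WithLp.equiv 2 (EuclideanSpace ℝ (Fin dl) × EuclideanSpace ℝ (Fin du)) p).1
          (WithLp.equiv 2 (EuclideanSpace ℝ (Fin dl) × EuclideanSpace ℝ (Fin du)) p).2
        - U (WithLp.equiv 2 (EuclideanSpace ℝ (Fin dl) × EuclideanSpace ℝ (Fin du)) q).1
            (WithLp.equiv 2 (EuclideanSpace ℝ (Fin dl) × EuclideanSpace ℝ (Fin du)) q).2|
        ≤ ℓu0 * ‖p - q‖)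
    (hU1 : ∀ p q : WithLp 2 (EuclideanSpace ℝ (Fin dl) × EuclideanSpace ℝ (Fin du)),
      ‖gradient (fun p : WithLp 2 (EuclideanSpace ℝ (Fin dl) × EuclideanSpace ℝ (Fin du)) =>
          U (WithLp.equiv 2 (EuclideanSpace ℝ (Fin dl) × EuclideanSpace ℝ (Fin du)) p).1
            (WithLp.equiv 2 (EuclideanSpace ℝ (Fin dl) × EuclideanSpace ℝ (Fin du)) p).2) p
        - gradient (fun p : WithLp 2 (EuclideanSpace ℝ (Fin dl) × EuclideanSpace ℝ (Fin du)) =>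
          U (WithLp.equiv 2 (EuclideanSpace ℝ (Fin dl) × EuclideanSpace ℝ (Fin du)) p).1
            (WithLp.equiv 2 (EuclideanSpace ℝ (Fin dl) × EuclideanSpace ℝ (Fin du)) p).2) q‖
        ≤ ℓu1 * ‖p - q‖)
    (hsc : ∀ ξ : EuclideanSpace ℝ (Fin du),
      StrongConvexOn Set.univ μl (fun η : EuclideanSpace ℝ (Fin dl) => L η ξ))
    (A : Matrix (Fin dc) (Fin dl) ℝ) (cv : Fin dc → ℝ)
    (hHne : ∃ η : EuclideanSpace ℝ (Fin dl), A.mulVec (fun i => η i) = cv)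
    (ηstar : EuclideanSpace ℝ (Fin du) → EuclideanSpace ℝ (Fin dl))
    (hstar_mem : ∀ ξ, A.mulVec (fun i => ηstar ξ i) = cv)
    (hstar_min : ∀ ξ, ∀ η : EuclideanSpace ℝ (Fin dl),
      A.mulVec (fun i => η i) = cv → L (ηstar ξ) ξ ≤ L η ξ) :
    Differentiable ℝ (fun ξ => U (ηstar ξ) ξ) ∧
      (∀ ξ : EuclideanSpace ℝ (Fin du),
        gradient (fun ζ => U (ηstar ζ) ζ) ξ =
          gradient (fun ζ => U (ηstar ξ) ζ) ξ +
            (ContinuousLinearMap.adjoint (fderiv ℝ ηstar ξ))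
              (gradient (fun a => U a ξ) (ηstar ξ))) ∧
      (∀ ξ₁ ξ₂ : EuclideanSpace ℝ (Fin du),
        ‖gradient (fun ζ => U (ηstar ζ) ζ) ξ₁ - gradient (fun ζ => U (ηstar ζ) ζ) ξ₂‖ ≤
          (ℓu1 * (1 + ℓl1 / μl) ^ 2 + ℓu0 * (ℓl2 * (1 + ℓl1 / μl) ^ 2 / μl)) *
            ‖ξ₁ - ξ₂‖) := by
  have hdiff := reduced_objective_smooth (s := ηstar)
    (V := LinearMap.ker (A.mulVecLin ∘ₗ (WithLp.linearEquiv 2 ℝ (Fin dl → ℝ)).toLinearMap))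
    hμl hℓl1.le hℓl2.le hℓu0.le hℓu1.le hL hgradLip hhessLip hUdiff hU0 hU1 hsc
    (fun ξ ξ' => by
      rw [LinearMap.mem_ker, map_sub]
      exact sub_eq_zero.2 ((hstar_mem ξ).trans (hstar_mem ξ').symm))
    (fun ξ w hw => by
      refine hstar_min ξ (ηstar ξ + w) ?_
      have h : A.mulVec (fun i => w i) = 0 := hw
      change A.mulVec ((fun i => ηstar ξ i) + fun i => w i) = cv
      rw [Matrix.mulVec_add, hstar_mem, h, add_zero])
  exact ⟨fun ξ => (inner_gradient_comp_graph hUdiff (hdiff.1 ξ).hasFDerivAt).1,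
    fun ξ => gradient_comp_graph hUdiff (hdiff.1 ξ), hdiff.2⟩
end
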